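/- Let U_q^{′tw}(gl_n) denote the subalgebra of U_q(sp_{2n}) generated by the n elements s′_{i+1,i} := t_{i+1,i} t̄_{ii} + t_{i+1,i+1} t̄_{i,i+1}, i = 1,…,n. Then there is an F-algebra isomorphism from the ıquantum group 𝒰^ı of type CI onto U_q^{′tw}(gl_n) sending B_i to (q_i − q_i^{−1})^{−1} s′_{i+1,i} for each i = 1,…,n. -/

import Mathlib

noncomputable section

set_option synthInstance.maxHeartbeats 1000000
set_option maxHeartbeats 1000000

namespace CI

/-- The ground field F = ℂ(q). -/
abbrev F : Type := RatFunc ℂ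

/-- The formal variable q. -/
def q : F := RatFunc.X

/-- The index involution i ↦ i′ = 2n+1−i (here in 0-based form i ↦ 2n−1−i). -/
def pr (n : ℕ) (i : Fin (2*n)) : Fin (2*n) := ⟨2*n - 1 - i.val, by have := i.isLt; omega⟩

/-- ε_i = 1 for i ≤ n and ε_i = −1 for i > n (1-based). -/
def eps (n : ℕ) (i : Fin (2*n)) : F := if (i : ℕ) < n then 1 else -1

/-- (1̄,…,n̄,(n+1)̄,…,(2n)̄) = (n,…,1,−1,…,−n). -/
def bar (n : ℕ) (i : Fin (2*n)) : ℤ :=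
  if (i : ℕ) < n then (n : ℤ) - (i : ℕ) else (n : ℤ) - (i : ℕ) - 1

/-- The diagonal entries of D = diag(qⁿ,…,q,q⁻¹,…,q⁻ⁿ): D_{ii} = q^{ī}. -/
def dd (n : ℕ) (i : Fin (2*n)) : F := q ^ (bar n i)

/-- The entries of the R-matrix R = Σ_{i,j} q^{δ_{ij}−δ_{ij′}} e_{ii} ⊗ e_{jj}
    + (q−q⁻¹) Σ_{i<j} e_{ij} ⊗ e_{ji}
    − (q−q⁻¹) Σ_{i<j} q^{j̄−ī} ε_i ε_j e_{ij} ⊗ e_{i′j′}. -/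
def Rm (n : ℕ) (p s : Fin (2*n) × Fin (2*n)) : F :=
  (if p.1 = s.1 ∧ p.2 = s.2 then
      q ^ ((if p.1 = p.2 then (1:ℤ) else 0) - (if p.1 = pr n p.2 then (1:ℤ) else 0)) else 0)
  + (if p.1 < p.2 ∧ s.1 = p.2 ∧ s.2 = p.1 then q - q⁻¹ else 0)
  - (if p.1 < s.1 ∧ p.2 = pr n p.1 ∧ s.2 = pr n s.1 then
      (q - q⁻¹) * q ^ (bar n s.1 - bar n p.1) * eps n p.1 * eps n s.1 else 0)

/-- Generators t_{ij}, t̄_{ij} of the extended algebra. -/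
inductive Gen (n : ℕ) : Type
  | t (i j : Fin (2*n)) : Gen n
  | tb (i j : Fin (2*n)) : Gen n

/-- The free F-algebra on the generators. -/
abbrev FA (n : ℕ) : Type := FreeAlgebra F (Gen n)

def tF (n : ℕ) (i j : Fin (2*n)) : FA n := FreeAlgebra.ι F (Gen.t i j)
def tbF (n : ℕ) (i j : Fin (2*n)) : FA n := FreeAlgebra.ι F (Gen.tb i j)

/-- The defining relations of the RTT presentation U_q(sp_{2n}): the triangularity
    and diagonal relations, the entrywise RTT relations R T₁ T₂ = T₂ T₁ R,
    R T̄₁ T̄₂ = T̄₂ T̄₁ R, R T̄₁ T₂ = T₂ T̄₁ R, and the entrywise central relations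
    T D Tᵗ D⁻¹ = T̄ D T̄ᵗ D⁻¹ = I, D Tᵗ D⁻¹ T = D T̄ᵗ D⁻¹ T̄ = I
    (where ᵗ is the twisted transposition e_{ij}ᵗ = ε_i ε_j e_{j′i′}). -/
inductive rel (n : ℕ) : FA n → FA n → Prop
  | t_upper (i j : Fin (2*n)) (h : i < j) : rel n (tF n i j) 0
  | tb_lower (i j : Fin (2*n)) (h : j < i) : rel n (tbF n i j) 0
  | t_tb_diag (i : Fin (2*n)) : rel n (tF n i i * tbF n i i) 1
  | tb_t_diag (i : Fin (2*n)) : rel n (tbF n i i * tF n i i) 1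
  | rtt_tt (i a j b : Fin (2*n)) :
      rel n (∑ k, ∑ c, Rm n (i, a) (k, c) • (tF n k j * tF n c b))
            (∑ c, ∑ l, Rm n (l, c) (j, b) • (tF n a c * tF n i l))
  | rtt_bb (i a j b : Fin (2*n)) :
      rel n (∑ k, ∑ c, Rm n (i, a) (k, c) • (tbF n k j * tbF n c b))
            (∑ c, ∑ l, Rm n (l, c) (j, b) • (tbF n a c * tbF n i l))
  | rtt_bt (i a j b : Fin (2*n)) :
      rel n (∑ k, ∑ c, Rm n (i, a) (k, c) • (tbF n k j * tF n c b))
            (∑ c, ∑ l, Rm n (l, c) (j, b) • (tF n a c * tbF n i l))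
  | cent_t1 (i j : Fin (2*n)) :
      rel n (∑ k, (dd n k * (dd n j)⁻¹ * eps n (pr n k) * eps n (pr n j)) •
              (tF n i k * tF n (pr n j) (pr n k)))
            (if i = j then 1 else 0)
  | cent_tb1 (i j : Fin (2*n)) :
      rel n (∑ k, (dd n k * (dd n j)⁻¹ * eps n (pr n k) * eps n (pr n j)) •
              (tbF n i k * tbF n (pr n j) (pr n k)))
            (if i = j then 1 else 0)
  | cent_t2 (i j : Fin (2*n)) :
      rel n (∑ k, (dd n i * (dd n k)⁻¹ * eps n (pr n i) * eps n (pr n k)) •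
              (tF n (pr n k) (pr n i) * tF n k j))
            (if i = j then 1 else 0)
  | cent_tb2 (i j : Fin (2*n)) :
      rel n (∑ k, (dd n i * (dd n k)⁻¹ * eps n (pr n i) * eps n (pr n k)) •
              (tbF n (pr n k) (pr n i) * tbF n k j))
            (if i = j then 1 else 0)

/-- The RTT presentation U_q(sp_{2n}). -/
abbrev Usp (n : ℕ) : Type := RingQuot (rel n)

/-- The generator t_{ij} of U_q(sp_{2n}). -/
def tU (n : ℕ) (i j : Fin (2*n)) : Usp n := RingQuot.mkAlgHom F (rel n) (tF n i j)

/-- The generator t̄_{ij} of U_q(sp_{2n}). -/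
def tbU (n : ℕ) (i j : Fin (2*n)) : Usp n := RingQuot.mkAlgHom F (rel n) (tbF n i j)

/-- The entries s_{ij} = Σ_{k=j}^{i} ε_k t_{ik} t̄_{jk} of the matrix S = T J T̄^u. -/
def sU (n : ℕ) (i j : Fin (2*n)) : Usp n :=
  ∑ k ∈ Finset.Icc j i, eps n k • (tU n i k * tbU n j k)

/-- The entries s̄_{ij} = ε_i ε_j Σ_{k=j}^{i} ε_{k′} t̄_{i′k′} t_{j′k′} of the
    matrix S̄ = T̄^{ut} Jᵗ Tᵗ. -/
def sbU (n : ℕ) (i j : Fin (2*n)) : Usp n :=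
  (eps n i * eps n j) • ∑ k ∈ Finset.Icc j i,
    eps n (pr n k) • (tbU n (pr n i) (pr n k) * tU n (pr n j) (pr n k))

/-- The twisted quantized enveloping algebra U_q^{tw}(gl_n): the subalgebra of
    U_q(sp_{2n}) generated by the entries of S. -/
def Utw (n : ℕ) : Subalgebra F (Usp n) :=
  Algebra.adjoin F (Set.range fun p : Fin (2*n) × Fin (2*n) => sU n p.1 p.2)

/-- The free F-algebra on the generators B_1, …, B_n. -/
abbrev FB (n : ℕ) : Type := FreeAlgebra F (Fin n)

def Bgen (n : ℕ) (i : Fin n) : FB n := FreeAlgebra.ι F i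

/-- q_i = q for i < n and q_n = q² (1-based; here i : Fin n is 0-based). -/
def qi (n : ℕ) (i : Fin n) : F := if (i : ℕ) + 1 < n then q else q^2

/-- The defining relations of the ıquantum group 𝒰^ı of type CI (with Cartan matrix
    (c_{ij}) of type C_n): B_i B_j = B_j B_i if c_{ij} = 0; the q_i-Serre-type relation
    when c_{ij} = −1; and the quartic relation between B_{n−1} and B_n. -/
inductive iRel (n : ℕ) : FB n → FB n → Prop
  | comm (i j : Fin n) (h : (i : ℕ) + 2 ≤ (j : ℕ) ∨ (j : ℕ) + 2 ≤ (i : ℕ)) :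
      iRel n (Bgen n i * Bgen n j) (Bgen n j * Bgen n i)
  | serre (i j : Fin n) (hadj : (i : ℕ) + 1 = (j : ℕ) ∨ (j : ℕ) + 1 = (i : ℕ))
      (hexc : ¬((i : ℕ) + 2 = n ∧ (j : ℕ) + 1 = n)) :
      iRel n (Bgen n i ^ 2 * Bgen n j - (qi n i + (qi n i)⁻¹) • (Bgen n i * Bgen n j * Bgen n i)
              + Bgen n j * Bgen n i ^ 2)
             ((-(qi n i)⁻¹) • Bgen n j)
  | quartic (i j : Fin n) (hi : (i : ℕ) + 2 = n) (hj : (j : ℕ) + 1 = n) :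
      iRel n (Bgen n i ^ 3 * Bgen n j
              - (q^2 + 1 + (q^2)⁻¹) • (Bgen n i ^ 2 * Bgen n j * Bgen n i)
              + (q^2 + 1 + (q^2)⁻¹) • (Bgen n i * Bgen n j * Bgen n i ^ 2)
              - Bgen n j * Bgen n i ^ 3)
             ((-(q⁻¹) * (q + q⁻¹)^2) • (Bgen n i * Bgen n j - Bgen n j * Bgen n i))

/-- The ıquantum group 𝒰^ı of type CI. -/
abbrev UiCI (n : ℕ) : Type := RingQuot (iRel n)

def BU (n : ℕ) (i : Fin n) : UiCI n := RingQuot.mkAlgHom F (iRel n) (Bgen n i)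

/-- The elements s′_{i+1,i} = t_{i+1,i} t̄_{ii} + t_{i+1,i+1} t̄_{i,i+1}. -/
def s'gen (n : ℕ) (i : Fin n) : Usp n :=
  tU n ⟨i.val + 1, by have := i.isLt; omega⟩ ⟨i.val, by have := i.isLt; omega⟩ *
    tbU n ⟨i.val, by have := i.isLt; omega⟩ ⟨i.val, by have := i.isLt; omega⟩ +
  tU n ⟨i.val + 1, by have := i.isLt; omega⟩ ⟨i.val + 1, by have := i.isLt; omega⟩ *
    tbU n ⟨i.val, by have := i.isLt; omega⟩ ⟨i.val + 1, by have := i.isLt; omega⟩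

/-- The subalgebra U_q^{′tw}(gl_n) of U_q(sp_{2n}) generated by s′_{21}, …, s′_{n+1,n}. -/
def U'tw (n : ℕ) : Subalgebra F (Usp n) := Algebra.adjoin F (Set.range (s'gen n))

section
set_option synthInstance.maxHeartbeats 1000000
set_option maxHeartbeats 1000000
set_option linter.unusedSimpArgs false

/-- The ı-Serre relation of degree three from the Drinfeld-Jimbo type relations. -/
theorem iserre3 {K A : Type*} [Field K] [Ring A] [Algebra K A] (p : K) (hp : p ≠ 0)
    (hl : p - p⁻¹ ≠ 0) (F1 E1 Z F2 E2 : A)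
    (h11 : E1 * F1 = (p^2) • (F1 * E1) + (p - p⁻¹)⁻¹ • Z - (p - p⁻¹)⁻¹ • (1 : A))
    (h12 : E1 * F2 = p⁻¹ • (F2 * E1)) (h21 : E2 * F1 = p⁻¹ • (F1 * E2))
    (hZ1 : Z * F1 = (p^4) • (F1 * Z)) (hZ2 : Z * F2 = (p⁻¹^2) • (F2 * Z))
    (hE1 : E1 * Z = (p^4) • (Z * E1)) (hE2 : E2 * Z = (p⁻¹^2) • (Z * E2))
    (hF : F1 ^ 2 * F2 - (p + p⁻¹) • (F1 * F2 * F1) + F2 * F1 ^ 2 = 0)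
    (hE : E1 ^ 2 * E2 - (p + p⁻¹) • (E1 * E2 * E1) + E2 * E1 ^ 2 = 0) :
    (F1 + E1) ^ 2 * (F2 + E2) - (p + p⁻¹) • ((F1 + E1) * (F2 + E2) * (F1 + E1))
      + (F2 + E2) * (F1 + E1) ^ 2 = (-p⁻¹) • (F2 + E2) := by
  have ext : ∀ {a b : A}, a = b → ∀ x, a * x = b * x := fun h x => by rw [h]
  have a11 := fun x => ext h11 x
  have a12 := fun x => ext h12 x
  have a21 := fun x => ext h21 x
  have aZ1 := fun x => ext hZ1 x
  have aZ2 := fun x => ext hZ2 x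
  have aE1 := fun x => ext hE1 x
  have aE2 := fun x => ext hE2 x
  have hF' : F1 * (F1 * F2) = (p + p⁻¹) • (F1 * (F2 * F1)) - F2 * (F1 * F1) := by
    rw [← sub_eq_zero, ← hF]; simp only [pow_two, mul_assoc]; abel
  have hE' : E1 * (E1 * E2) = (p + p⁻¹) • (E1 * (E2 * E1)) - E2 * (E1 * E1) := by
    rw [← sub_eq_zero, ← hE]; simp only [pow_two, mul_assoc]; abel
  simp only [mul_assoc, add_mul, sub_mul, smul_mul_assoc, one_mul, mul_one] at a11 a12 a21 aZ1 aZ2 aE1 aE2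
  simp only [pow_two (F1 + E1), mul_add, add_mul, mul_assoc, mul_sub, sub_mul, smul_mul_assoc, mul_smul_comm,
    mul_one, one_mul,
    h11, h12, h21, hZ1, hZ2, hE1, hE2, a11, a12, a21, aZ1, aZ2, aE1, aE2, hF', hE']
  have hl' : p^2 - 1 ≠ 0 := by
    intro h; apply hl; field_simp; simpa using h
  match_scalars <;> field_simp <;> ring

theorem iserre4 {K A : Type*} [Field K] [Ring A] [Algebra K A] (p : K) (hp : p ≠ 0)
    (hl : p - p⁻¹ ≠ 0) (F1 E1 Z F2 E2 : A)
    (h11 : E1 * F1 = (p^2) • (F1 * E1) + (p - p⁻¹)⁻¹ • Z - (p - p⁻¹)⁻¹ • (1 : A))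
    (h12 : E1 * F2 = (p⁻¹^2) • (F2 * E1)) (h21 : E2 * F1 = (p⁻¹^2) • (F1 * E2))
    (hZ1 : Z * F1 = (p^4) • (F1 * Z)) (hZ2 : Z * F2 = (p⁻¹^4) • (F2 * Z))
    (hE1 : E1 * Z = (p^4) • (Z * E1)) (hE2 : E2 * Z = (p⁻¹^4) • (Z * E2))
    (hF : F1 ^ 3 * F2 - (p^2+1+(p^2)⁻¹) • (F1 ^ 2 * F2 * F1)
      + (p^2+1+(p^2)⁻¹) • (F1 * F2 * F1 ^ 2) - F2 * F1 ^ 3 = 0)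
    (hE : E1 ^ 3 * E2 - (p^2+1+(p^2)⁻¹) • (E1 ^ 2 * E2 * E1)
      + (p^2+1+(p^2)⁻¹) • (E1 * E2 * E1 ^ 2) - E2 * E1 ^ 3 = 0) :
    (F1 + E1) ^ 3 * (F2 + E2) - (p^2+1+(p^2)⁻¹) • ((F1 + E1) ^ 2 * (F2 + E2) * (F1 + E1))
      + (p^2+1+(p^2)⁻¹) • ((F1 + E1) * (F2 + E2) * (F1 + E1) ^ 2)
      - (F2 + E2) * (F1 + E1) ^ 3 = (-(p⁻¹) * (p + p⁻¹)^2) • ((F1 + E1) * (F2 + E2) - (F2 + E2) * (F1 + E1)) := by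
  have ext : ∀ {a b : A}, a = b → ∀ x, a * x = b * x := fun h x => by rw [h]
  have a11 := fun x => ext h11 x
  have a12 := fun x => ext h12 x
  have a21 := fun x => ext h21 x
  have aZ1 := fun x => ext hZ1 x
  have aZ2 := fun x => ext hZ2 x
  have aE1 := fun x => ext hE1 x
  have aE2 := fun x => ext hE2 x
  have hF' : F1 * (F1 * (F1 * F2)) = (p^2+1+(p^2)⁻¹) • (F1 * (F1 * (F2 * F1)))
     - (p^2+1+(p^2)⁻¹) • (F1 * (F2 * (F1 * F1))) + F2 * (F1 * (F1 * F1)) := by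
    rw [← sub_eq_zero, ← hF]; simp only [pow_succ, pow_zero, one_mul, mul_assoc]; abel
  have hE' : E1 * (E1 * (E1 * E2)) = (p^2+1+(p^2)⁻¹) • (E1 * (E1 * (E2 * E1)))
     - (p^2+1+(p^2)⁻¹) • (E1 * (E2 * (E1 * E1))) + E2 * (E1 * (E1 * E1)) := by
    rw [← sub_eq_zero, ← hE]; simp only [pow_succ, pow_zero, one_mul, mul_assoc]; abel
  simp only [mul_assoc, add_mul, sub_mul, smul_mul_assoc, one_mul, mul_one] at a11 a12 a21 aZ1 aZ2 aE1 aE2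
  have e3 : (F1 + E1)^3 = (F1 + E1) * ((F1 + E1) * (F1 + E1)) := by rw [pow_succ, pow_two, mul_assoc]
  simp only [e3, pow_two (F1 + E1), mul_add, add_mul, mul_assoc, mul_sub, sub_mul, smul_mul_assoc, mul_smul_comm,
    mul_one, one_mul,
    h11, h12, h21, hZ1, hZ2, hE1, hE2, a11, a12, a21, aZ1, aZ2, aE1, aE2, hF', hE']
  have hl' : p^2 - 1 ≠ 0 := by
    intro h; apply hl; field_simp; simpa using h
  match_scalars <;> field_simp <;> ring
end

section
set_option synthInstance.maxHeartbeats 1000000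
set_option maxHeartbeats 1000000
set_option linter.unusedSimpArgs false

/-- Cubic Serre relation (left version) from a q-commutator chain. -/
theorem serreL {K A : Type*} [Field K] [Ring A] [Algebra K A] (p c : K) (hp : p ≠ 0)
    (F1 F2 G : A) (h : F1 * F2 - p • (F2 * F1) = c • G) (hG : F1 * G = p⁻¹ • (G * F1)) :
    F1 ^ 2 * F2 - (p + p⁻¹) • (F1 * F2 * F1) + F2 * F1 ^ 2 = 0 := by
  have h1 : F1 * (F1 * F2 - p • (F2 * F1)) = p⁻¹ • ((F1 * F2 - p • (F2 * F1)) * F1) := by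
    rw [h, mul_smul_comm, hG, smul_mul_assoc, smul_comm]
  rw [← sub_eq_zero] at h1
  rw [← h1]
  simp only [mul_sub, sub_mul, mul_smul_comm, smul_mul_assoc, mul_assoc, pow_two, smul_sub]
  match_scalars <;> field_simp <;> ring

/-- Cubic Serre relation (right version) from a q-commutator chain. -/
theorem serreR {K A : Type*} [Field K] [Ring A] [Algebra K A] (p c : K) (hp : p ≠ 0)
    (F1 F2 G : A) (h : F1 * F2 - p • (F2 * F1) = c • G) (hG : G * F2 = p⁻¹ • (F2 * G)) :
    F2 ^ 2 * F1 - (p + p⁻¹) • (F2 * F1 * F2) + F1 * F2 ^ 2 = 0 := by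
  have h1 : (F1 * F2 - p • (F2 * F1)) * F2 = p⁻¹ • (F2 * (F1 * F2 - p • (F2 * F1))) := by
    rw [h, smul_mul_assoc, hG, mul_smul_comm, smul_comm]
  rw [← sub_eq_zero] at h1
  rw [← h1]
  simp only [mul_sub, sub_mul, mul_smul_comm, smul_mul_assoc, mul_assoc, pow_two, smul_sub]
  match_scalars <;> field_simp <;> ring

/-- Quartic Serre relation from a q-commutator chain. -/
theorem serre4 {K A : Type*} [Field K] [Ring A] [Algebra K A] (p c d u v w : K) (hp : p ≠ 0)
    (F1 F2 G H : A) (h : F1 * F2 - u • (F2 * F1) = c • G)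
    (hG : F1 * G - v • (G * F1) = d • H) (hH : F1 * H = w • (H * F1))
    (h1 : u + v + w = p^2+1+(p^2)⁻¹) (h2 : u*v+u*w+v*w = p^2+1+(p^2)⁻¹) (h3 : u*v*w = 1) :
    F1 ^ 3 * F2 - (p^2+1+(p^2)⁻¹) • (F1 ^ 2 * F2 * F1)
      + (p^2+1+(p^2)⁻¹) • (F1 * F2 * F1 ^ 2) - F2 * F1 ^ 3 = 0 := by
  have e1 : F1 * (F1 * F2 - u • (F2 * F1)) - v • ((F1 * F2 - u • (F2 * F1)) * F1) = (c * d) • H := by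
    rw [h, mul_smul_comm, smul_mul_assoc, smul_comm v, ← smul_sub, hG, smul_smul]
  have e2 : F1 * (F1 * (F1 * F2 - u • (F2 * F1)) - v • ((F1 * F2 - u • (F2 * F1)) * F1))
     - w • ((F1 * (F1 * F2 - u • (F2 * F1)) - v • ((F1 * F2 - u • (F2 * F1)) * F1)) * F1) = 0 := by
    rw [e1, mul_smul_comm, hH, smul_mul_assoc, smul_comm, sub_self]
  rw [← e2]
  simp only [← h1]
  have : ∀ x : A, F2 * F1^3 = (u*v*w) • (F2 * F1^3) := fun _ => by rw [h3, one_smul]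
  rw [this 0]
  have : (u + v + w) • (F1 * F2 * F1 ^ 2) = (u*v+u*w+v*w) • (F1 * F2 * F1 ^ 2) := by rw [h1, h2]
  rw [this]
  simp only [mul_sub, sub_mul, mul_smul_comm, smul_mul_assoc, mul_assoc, pow_succ, pow_zero, one_mul, smul_sub]
  module

/-- The quadratic exchange relation `R X₁ Y₂ = Y₂ X₁ R`, entrywise. -/
def RTT {A : Type*} [Ring A] [Algebra F A] (n : ℕ) (X Y : Fin (2*n) → Fin (2*n) → A) : Prop :=
  ∀ i a j b : Fin (2*n), ∑ k, ∑ c, Rm n (i, a) (k, c) • (X k j * Y c b) =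
    ∑ c, ∑ l, Rm n (l, c) (j, b) • (Y a c * X i l)

theorem sum_Rm_row {A : Type*} [AddCommGroup A] [Module F A] (n : ℕ) (i a : Fin (2*n))
    (f : Fin (2*n) → Fin (2*n) → A) :
    ∑ k, ∑ c, Rm n (i, a) (k, c) • f k c =
      q ^ ((if i = a then (1:ℤ) else 0) - (if i = pr n a then (1:ℤ) else 0)) • f i a
      + (if i < a then (q - q⁻¹) • f a i else 0)
      - (if a = pr n i then ∑ k, if i < k then ((q - q⁻¹) * q ^ (bar n k - bar n i) * eps n i * eps n k) •
            f k (pr n k) else 0 else 0) := by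
  have e : ∀ k c, Rm n (i, a) (k, c) • f k c =
     (if k = i then (if c = a then q ^ ((if i = a then (1:ℤ) else 0) - (if i = pr n a then (1:ℤ) else 0)) • f i a else 0) else 0)
     + (if k = a then (if c = i then (if i < a then (q - q⁻¹) • f a i else 0) else 0) else 0)
     - (if c = pr n k then (if a = pr n i then (if i < k then ((q - q⁻¹) * q ^ (bar n k - bar n i) * eps n i * eps n k) •
            f k (pr n k) else 0) else 0) else 0) := by
    intro k c
    simp only [Rm, sub_smul, add_smul]
    congr 1
    · congr 1
      · by_cases h1 : i = k
        · subst h1; by_cases h2 : a = c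
          · subst h2; simp
          · rw [if_neg (by tauto), if_pos rfl, if_neg (fun h => h2 h.symm), zero_smul]
        · rw [if_neg (by tauto), if_neg (fun h => h1 h.symm), zero_smul]
      · by_cases h1 : k = a
        · subst h1; by_cases h2 : c = i
          · subst h2; by_cases h3 : c < k <;> simp [h3, sub_smul]
          · simp [h2]
        · simp [h1]
    · by_cases h1 : c = pr n k
      · subst h1; by_cases h2 : a = pr n i
        · subst h2; by_cases h3 : i < k <;> simp [h3]
        · simp [h2]
      · simp [h1]
  simp only [e, Finset.sum_add_distrib, Finset.sum_sub_distrib]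
  congr 1
  · congr 1
    · simp
    · simp
  · simp only [Finset.sum_ite_eq', Finset.mem_univ, if_true]
    by_cases h : a = pr n i <;> simp [h]

theorem sum_Rm_col {A : Type*} [AddCommGroup A] [Module F A] (n : ℕ) (j b : Fin (2*n))
    (f : Fin (2*n) → Fin (2*n) → A) :
    ∑ c, ∑ l, Rm n (l, c) (j, b) • f l c =
      q ^ ((if j = b then (1:ℤ) else 0) - (if j = pr n b then (1:ℤ) else 0)) • f j b
      + (if b < j then (q - q⁻¹) • f b j else 0)
      - (if b = pr n j then ∑ l, if l < j then ((q - q⁻¹) * q ^ (bar n j - bar n l) * eps n l * eps n j) •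
            f l (pr n l) else 0 else 0) := by
  have e : ∀ l c, Rm n (l, c) (j, b) • f l c =
     (if l = j then (if c = b then q ^ ((if j = b then (1:ℤ) else 0) - (if j = pr n b then (1:ℤ) else 0)) • f j b else 0) else 0)
     + (if l = b then (if c = j then (if b < j then (q - q⁻¹) • f b j else 0) else 0) else 0)
     - (if c = pr n l then (if b = pr n j then (if l < j then ((q - q⁻¹) * q ^ (bar n j - bar n l) * eps n l * eps n j) •
            f l (pr n l) else 0) else 0) else 0) := by
    intro l c
    simp only [Rm, sub_smul, add_smul]
    congr 1
    · congr 1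
      · by_cases h1 : l = j
        · subst h1; by_cases h2 : c = b
          · subst h2; simp
          · simp [h2]
        · simp [h1]
      · by_cases h1 : l = b
        · subst h1; by_cases h2 : c = j
          · subst h2; by_cases h3 : l < c <;> simp [h3, sub_smul]
          · have : ¬ (j = c) := fun h => h2 h.symm
            simp [h2, this]
        · have : ¬ (b = l) := fun h => h1 h.symm
          simp [h1, this]
    · by_cases h1 : c = pr n l
      · subst h1; by_cases h2 : b = pr n j
        · subst h2; by_cases h3 : l < j <;> simp [h3]
        · simp [h2]
      · simp [h1]
  rw [Finset.sum_comm]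
  simp only [e, Finset.sum_add_distrib, Finset.sum_sub_distrib]
  congr 1
  · congr 1
    · simp
    · simp
  · simp only [Finset.sum_ite_eq', Finset.mem_univ, if_true]
    by_cases h : b = pr n j <;> simp [h]

/-- Expanded form of the exchange relations. -/
theorem RTT.expand {A : Type*} [Ring A] [Algebra F A] {n : ℕ} {X Y : Fin (2*n) → Fin (2*n) → A}
    (h : RTT n X Y) (i a j b : Fin (2*n)) :
      q ^ ((if i = a then (1:ℤ) else 0) - (if i = pr n a then (1:ℤ) else 0)) • (X i j * Y a b)
      + (if i < a then (q - q⁻¹) • (X a j * Y i b) else 0)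
      - (if a = pr n i then ∑ k, if i < k then ((q - q⁻¹) * q ^ (bar n k - bar n i) * eps n i * eps n k) •
            (X k j * Y (pr n k) b) else 0 else 0) =
      q ^ ((if j = b then (1:ℤ) else 0) - (if j = pr n b then (1:ℤ) else 0)) • (Y a b * X i j)
      + (if b < j then (q - q⁻¹) • (Y a j * X i b) else 0)
      - (if b = pr n j then ∑ l, if l < j then ((q - q⁻¹) * q ^ (bar n j - bar n l) * eps n l * eps n j) •
            (Y a (pr n l) * X i l) else 0 else 0) := by
  have := h i a j b
  rw [sum_Rm_row n i a (fun k c => X k j * Y c b), sum_Rm_col n j b (fun l c => Y a c * X i l)] at this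
  exact this

theorem RTT_tt (n : ℕ) : RTT n (tU n) (tU n) := fun i a j b => by
  have := RingQuot.mkAlgHom_rel F (rel.rtt_tt (n := n) i a j b)
  simpa [map_sum, tU] using this
theorem RTT_bb (n : ℕ) : RTT n (tbU n) (tbU n) := fun i a j b => by
  have := RingQuot.mkAlgHom_rel F (rel.rtt_bb (n := n) i a j b)
  simpa [map_sum, tbU] using this
theorem RTT_bt (n : ℕ) : RTT n (tbU n) (tU n) := fun i a j b => by
  have := RingQuot.mkAlgHom_rel F (rel.rtt_bt (n := n) i a j b)
  simpa [map_sum, tU, tbU] using this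
theorem tU_upper (n : ℕ) (i j : Fin (2*n)) (h : i < j) : tU n i j = 0 := by
  have := RingQuot.mkAlgHom_rel F (rel.t_upper (n := n) i j h)
  simpa [tU] using this
theorem tbU_lower (n : ℕ) (i j : Fin (2*n)) (h : j < i) : tbU n i j = 0 := by
  have := RingQuot.mkAlgHom_rel F (rel.tb_lower (n := n) i j h)
  simpa [tbU] using this
theorem t_tb (n : ℕ) (i : Fin (2*n)) : tU n i i * tbU n i i = 1 := by
  have := RingQuot.mkAlgHom_rel F (rel.t_tb_diag (n := n) i)
  simpa [tU, tbU] using this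
theorem tb_t (n : ℕ) (i : Fin (2*n)) : tbU n i i * tU n i i = 1 := by
  have := RingQuot.mkAlgHom_rel F (rel.tb_t_diag (n := n) i)
  simpa [tU, tbU] using this
end

section
set_option synthInstance.maxHeartbeats 1000000
set_option maxHeartbeats 1000000
set_option linter.unusedSimpArgs false

theorem q_ne : q ≠ 0 := RatFunc.X_ne_zero
theorem pr_val (n : ℕ) (i : Fin (2*n)) : (pr n i).val = 2*n - 1 - i.val := rfl
theorem pr_pr (n : ℕ) (i : Fin (2*n)) : pr n (pr n i) = i := by
  apply Fin.ext; simp only [pr_val]; have := i.isLt; omega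
theorem pr_ne (n : ℕ) (i : Fin (2*n)) : i ≠ pr n i := by
  intro h; have := congrArg Fin.val h; simp only [pr_val] at this; have := i.isLt; omega
theorem eq_pr_comm {n : ℕ} {i j : Fin (2*n)} : i = pr n j ↔ j = pr n i := by
  constructor <;> (intro h; rw [h, pr_pr])

/-- exchange relation without opposite indices -/
theorem RTT.gen {A : Type*} [Ring A] [Algebra F A] {n : ℕ} {X Y : Fin (2*n) → Fin (2*n) → A}
    (h : RTT n X Y) (i a j b : Fin (2*n)) (h1 : a ≠ pr n i) (h2 : b ≠ pr n j) :
      (if i = a then q else 1) • (X i j * Y a b)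
      + (if i < a then (q - q⁻¹) • (X a j * Y i b) else 0) =
      (if j = b then q else 1) • (Y a b * X i j)
      + (if b < j then (q - q⁻¹) • (Y a j * X i b) else 0) := by
  have := h.expand i a j b
  have h1' : i ≠ pr n a := fun h => h1 (eq_pr_comm.1 h)
  have h2' : j ≠ pr n b := fun h => h2 (eq_pr_comm.1 h)
  simp only [h1, h2, h1', h2', if_false, sub_zero] at this
  have e : ∀ P : Prop, ∀ [Decidable P], q ^ (if P then (1:ℤ) else 0) = if P then q else 1 := by
    intro P _; split_ifs <;> simp
  simpa only [e] using this

/-- Lower triangular solutions of the exchange relation. -/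
structure LT {A : Type*} [Ring A] [Algebra F A] (n : ℕ) (T : Fin (2*n) → Fin (2*n) → A) : Prop where
  rtt : RTT n T T
  up : ∀ i j, i < j → T i j = 0

variable {A : Type*} [Ring A] [Algebra F A] {n : ℕ} {T : Fin (2*n) → Fin (2*n) → A}

theorem solve1 {x y z: A} (h : q • x = y) : x = q⁻¹ • y := by
  rw [← h, smul_smul, inv_mul_cancel₀ q_ne, one_smul]

section typeA
variable (h : LT n T)
include h
theorem LT.kk (a b : Fin (2*n)) (hab : b ≠ pr n a) : T a a * T b b = T b b * T a a := by
  have := h.rtt.gen a b a b hab hab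
  rcases lt_trichotomy a b with l | l | l
  · simpa [l, l.ne, h.up _ _ l, not_lt_of_gt l] using this
  · rw [l]
  · simpa [l, l.ne', h.up _ _ l, not_lt_of_gt l] using this
/-- `k_a t_{ba} = q⁻¹ t_{ba} k_a`. -/
theorem LT.kax (a b : Fin (2*n)) (hab : a < b) (hp : b ≠ pr n a) :
    T a a * T b a = q⁻¹ • (T b a * T a a) := by
  have := h.rtt.gen b a a a (fun h => hp (eq_pr_comm.1 h)) (pr_ne n a)
  simp [hab.ne', not_lt_of_gt hab] at this
  rw [this, smul_smul, inv_mul_cancel₀ q_ne, one_smul]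
theorem LT.kbx (a b : Fin (2*n)) (hab : a < b) (hp : b ≠ pr n a) :
    T b b * T b a = q • (T b a * T b b) := by
  have := h.rtt.gen b b b a (pr_ne n b) (fun h => hp (eq_pr_comm.1 h))
  simp [hab.ne', hab, not_lt_of_gt hab] at this
  rw [← sub_eq_iff_eq_add, ← sub_smul] at this
  rw [← this, smul_smul]; simp [q_ne]
/-- diagonal entries outside commute -/
theorem LT.kcx (a b c : Fin (2*n)) (hab : a < b) (hc : c < a ∨ b < c) (hp : c ≠ pr n a) (hp' : c ≠ pr n b) :
    T c c * T b a = T b a * T c c := by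
  have := h.rtt.gen c b c a (fun h => hp' (eq_pr_comm.1 h)) (fun h => hp (eq_pr_comm.1 h))
  rcases hc with hc | hc
  · have h1 := hc.trans hab
    simpa [hc.ne, hc, h1, h1.ne, h.up _ _ hc, not_lt_of_gt hc] using this
  · have h1 := hab.trans hc
    simpa [hc.ne', hc, h1, h1.ne', h.up _ _ hc, not_lt_of_gt hc] using this
theorem LT.comm (a b c d : Fin (2*n)) (hab : a < b) (hbc : b < c) (hcd : c < d)
    (h1 : d ≠ pr n b) (h2 : c ≠ pr n a) :
    T b a * T d c = T d c * T b a := by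
  have := h.rtt.gen b d a c h1 h2
  have e1 := hbc.trans hcd
  have e2 := hab.trans hbc
  simpa [e1, e1.ne, e2, e2.ne, not_lt_of_gt e2, h.up _ _ hbc] using this
theorem LT.xy (a b c : Fin (2*n)) (hab : a < b) (hbc : b < c) (h1 : c ≠ pr n b) (h2 : b ≠ pr n a) :
    T b a * T c b = T c b * T b a - (q - q⁻¹) • (T c a * T b b) := by
  have := h.rtt.gen b c a b h1 h2
  rw [eq_sub_iff_add_eq]
  simpa [hbc, hbc.ne, hab, hab.ne, not_lt_of_gt hab] using this
theorem LT.xz (a b c : Fin (2*n)) (hbc : b < c) (h1 : c ≠ pr n b) :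
    T b a * T c a = q⁻¹ • (T c a * T b a) := by
  have := h.rtt.gen b c a a h1 (pr_ne n a)
  simp [hbc, hbc.ne] at this
  rw [← eq_sub_iff_add_eq, ← sub_smul] at this
  rw [this]; simp
theorem LT.zy (a b c : Fin (2*n)) (hab : a < b) (h1 : b ≠ pr n a) :
    T c a * T c b = q⁻¹ • (T c b * T c a) := by
  have := h.rtt.gen c c a b (pr_ne n c) h1
  simp [hab, hab.ne, not_lt_of_gt hab] at this
  rw [← this, smul_smul, inv_mul_cancel₀ q_ne, one_smul]
end typeA
end

section
set_option synthInstance.maxHeartbeats 1000000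
set_option maxHeartbeats 1000000
set_option linter.unusedSimpArgs false
local instance natAlgF : Algebra ℕ F := Semiring.toNatAlgebra
local instance intAlgF : Algebra ℤ F := Ring.toIntAlgebra _
variable {A : Type*} [Ring A] [Algebra F A] {n : ℕ} {T : Fin (2*n) → Fin (2*n) → A}

theorem hq2 : q - q⁻¹ ≠ 0 := by
  intro h
  have h1 : q * q = 1 := by
    have := sub_eq_zero.1 h
    nth_rewrite 2 [this]; exact mul_inv_cancel₀ q_ne
  have h2 : (RatFunc.X : RatFunc ℂ) = algebraMap (Polynomial ℂ) _ Polynomial.X := (RatFunc.algebraMap_X).symm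
  rw [show q = algebraMap (Polynomial ℂ) _ Polynomial.X from h2, ← map_mul, ← map_one (algebraMap (Polynomial ℂ) (RatFunc ℂ))] at h1
  have h3 := RatFunc.algebraMap_injective ℂ h1
  have := congrArg Polynomial.natDegree h3
  simp [Polynomial.natDegree_mul] at this

section typeC
variable (h : LT n T)
include h

theorem LT.kk' (a : Fin (2*n)) : T a a * T (pr n a) (pr n a) = T (pr n a) (pr n a) * T a a := by
  have := h.rtt.expand a (pr n a) a (pr n a)
  have e1 : ∀ k, (if a < k then ((q - q⁻¹) * q ^ (bar n k - bar n a) * eps n a * eps n k) •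
            (T k a * T (pr n k) (pr n a)) else 0) = 0 := by
    intro k; split_ifs with hk
    · rw [h.up (pr n k) (pr n a) (by rw [Fin.lt_def] at *; simp only [pr_val]; have := k.isLt; omega)]; simp
    · rfl
  have e2 : ∀ k, (if k < a then ((q - q⁻¹) * q ^ (bar n a - bar n k) * eps n k * eps n a) •
            (T (pr n a) (pr n k) * T a k) else 0) = 0 := by
    intro k; split_ifs with hk
    · rw [h.up (pr n a) (pr n k) (by rw [Fin.lt_def] at *; simp only [pr_val]; have := a.isLt; omega)]; simp
    · rfl
  simp only [e1, e2, pr_pr, pr_ne, if_true, if_false, Finset.sum_const_zero, sub_zero, ite_self] at this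
  have e3 : (if a < pr n a then (q - q⁻¹) • (T (pr n a) a * T a (pr n a)) else 0) = 0 := by
    split_ifs with hk
    · rw [h.up a (pr n a) hk]; simp
    · rfl
  have e4 : (if pr n a < a then (q - q⁻¹) • (T (pr n a) a * T a (pr n a)) else 0) = 0 := by
    split_ifs with hk
    · rw [h.up (pr n a) a hk]; simp
    · rfl
  rw [e3, e4, add_zero, add_zero] at this
  exact smul_right_injective A (zpow_ne_zero _ q_ne) this

/-- generic: the row sum vanishes when everything above is out of range -/
theorem LT.expandR0 (i j b : Fin (2*n)) (hb : pr n i ≤ b) (hj : b ≠ pr n j) :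
      q⁻¹ • (T i j * T (pr n i) b) + (if i < pr n i then (q - q⁻¹) • (T (pr n i) j * T i b) else 0) =
      (if j = b then q else 1) • (T (pr n i) b * T i j)
      + (if b < j then (q - q⁻¹) • (T (pr n i) j * T i b) else 0) := by
  have := h.rtt.expand i (pr n i) j b
  have e1 : ∀ k, (if i < k then ((q - q⁻¹) * q ^ (bar n k - bar n i) * eps n i * eps n k) •
            (T k j * T (pr n k) b) else 0) = 0 := by
    intro k; split_ifs with hk
    · rw [h.up (pr n k) b (lt_of_lt_of_le (by rw [Fin.lt_def] at *; simp only [pr_val]; have := k.isLt; omega) hb)]; simp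
    · rfl
  have hj' : j ≠ pr n b := fun h => hj (eq_pr_comm.1 h)
  simp only [e1, hj, hj', pr_pr, pr_ne, if_true, if_false, Finset.sum_const_zero, sub_zero] at this
  have e : ∀ P : Prop, ∀ [Decidable P], q ^ (if P then (1:ℤ) else 0) = if P then q else 1 := by
    intro P _; split_ifs <;> simp
  simpa only [e, zero_sub, zpow_neg, zpow_one] using this

variable (a b c d : Fin (2*n)) (ha : a.val + 2 = n) (hb : b.val + 1 = n) (hc : c.val = n) (hd : d.val = n+1)
include hb hc

theorem LT.kby : T b b * T c b = (q⁻¹^2) • (T c b * T b b) := by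
  have e : b = pr n c := by apply Fin.ext; simp only [pr_val]; omega
  have := h.expandR0 c b b (by rw [← e]) (pr_ne n b)
  rw [← e] at this
  have l : b < c := by rw [Fin.lt_def]; omega
  simp [not_lt_of_gt l] at this
  rw [pow_two, mul_smul, this, smul_smul, inv_mul_cancel₀ q_ne, one_smul]

theorem bar_bc : bar n c - bar n b = -2 := by
  simp only [bar, hc]; rw [if_neg (by omega), if_pos (by omega)]; omega
theorem eps_bc : eps n b * eps n c = -1 := by
  simp only [eps, hc]; rw [if_pos (by omega), if_neg (by omega)]; simp

theorem LT.kcy : T c c * T c b = (q^2) • (T c b * T c c) := by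
  have e : b = pr n c := by apply Fin.ext; simp only [pr_val]; omega
  have e' : c = pr n b := by rw [e, pr_pr]
  have l : b < c := by rw [Fin.lt_def]; omega
  have := h.rtt.expand c c c b
  rw [if_neg (pr_ne n c), if_neg (pr_ne n c), if_pos e, Fintype.sum_eq_single b] at this
  · simp [l, l.ne', ← e'] at this
    simp only [bar_bc h b c hb hc, mul_assoc, eps_bc h b c hb hc] at this
    have k1 : (q^3 : F) • ((q - (q - q⁻¹) - (q - q⁻¹) * q⁻¹^2) • (T c c * T c b)) = (q^3 : F) • (q⁻¹ • (T c b * T c c)) := by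
      congr 1
      rw [← sub_eq_zero] at this ⊢
      rw [← this]
      match_scalars <;> simp [zpow_neg]
      ring
    rw [smul_smul, smul_smul] at k1
    have hq := q_ne
    rw [show q^3 * (q - (q - q⁻¹) - (q - q⁻¹) * q⁻¹^2) = 1 by field_simp; ring, one_smul] at k1
    rw [k1]; congr 1; field_simp
  · intro k hk
    split_ifs with h1
    · rw [h.up c (pr n k)]
      · simp
      · rw [Fin.lt_def, pr_val] at *; have : k.val ≠ b.val := fun h => hk (Fin.ext h)
        omega
    · rfl

include ha

theorem LT.kcx' : T c c * T b a = q⁻¹ • (T b a * T c c) := by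
  have e' : c = pr n b := by apply Fin.ext; simp only [pr_val]; omega
  have l : b < c := by rw [Fin.lt_def]; omega
  have l' : a < c := by rw [Fin.lt_def]; omega
  have := h.expandR0 b a c (by rw [← e']) (by intro h; have := congrArg Fin.val h; simp only [pr_val] at this; omega)
  rw [← e'] at this
  simpa [l, l'.ne, not_lt_of_gt l', h.up _ _ l] using this.symm

theorem LT.xyC : q⁻¹ • (T b a * T c b) - T c b * T b a = (-(q - q⁻¹) * (1 + q⁻¹^2)) • (T c a * T b b) := by
  have e' : c = pr n b := by apply Fin.ext; simp only [pr_val]; omega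
  have e : b = pr n c := by rw [e', pr_pr]
  have l : b < c := by rw [Fin.lt_def]; omega
  have l' : a < b := by rw [Fin.lt_def]; omega
  have := h.rtt.expand b c a b
  have n1 : b ≠ pr n a := by intro h; have := congrArg Fin.val h; simp only [pr_val] at this; omega
  have n2 : a ≠ pr n b := fun h => n1 (eq_pr_comm.1 h)
  rw [if_pos e', if_pos l, if_pos e, if_neg n1, if_neg n2, if_neg l'.ne, if_neg l.ne, if_neg (not_lt_of_gt l'), Fintype.sum_eq_single c] at this
  · simp [l, ← e] at this
    simp only [bar_bc h b c hb hc, mul_assoc, eps_bc h b c hb hc] at this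
    rw [← sub_eq_zero] at this ⊢
    rw [← this]
    match_scalars <;> simp [zpow_neg]
    ring
  · intro k hk
    split_ifs with h1
    · rw [h.up (pr n k) b]
      · simp
      · rw [Fin.lt_def, pr_val] at *; have : k.val ≠ c.val := fun h => hk (Fin.ext h)
        omega
    · rfl

theorem LT.kbz : T b b * T c a = q⁻¹ • (T c a * T b b) := by
  have e : b = pr n c := by apply Fin.ext; simp only [pr_val]; omega
  have l : b < c := by rw [Fin.lt_def]; omega
  have l' : a < b := by rw [Fin.lt_def]; omega
  have := h.expandR0 c a b (by rw [← e]) (by intro h; have := congrArg Fin.val h; simp only [pr_val] at this; omega)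
  rw [← e] at this
  simpa [not_lt_of_gt l, l'.ne, not_lt_of_gt l'] using this.symm

include hd
theorem LT.kaw : T a a * T d a = (q⁻¹^2) • (T d a * T a a) := by
  have e : a = pr n d := by apply Fin.ext; simp only [pr_val]; omega
  have l : a < d := by rw [Fin.lt_def]; omega
  have := h.expandR0 d a a (by rw [← e]) (pr_ne n a)
  rw [← e] at this
  simp [not_lt_of_gt l] at this
  rw [pow_two, mul_smul, this, smul_smul, inv_mul_cancel₀ q_ne, one_smul]

theorem LT.xzC : T b a * T c a = (q⁻¹^2) • (T c a * T b a) - (q⁻¹^2 * (q - q⁻¹)) • (T d a * T a a) := by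
  have e' : c = pr n b := by apply Fin.ext; simp only [pr_val]; omega
  have e : b = pr n c := by rw [e', pr_pr]
  have ed : a = pr n d := by apply Fin.ext; simp only [pr_val]; omega
  have l : b < c := by rw [Fin.lt_def]; omega
  have l2 : b < d := by rw [Fin.lt_def]; omega
  have l3 : c ≠ d := by intro h; have := congrArg Fin.val h; omega
  have := h.rtt.expand b c a a
  rw [if_pos e', if_pos l, if_pos e, if_neg (pr_ne n a), if_neg l.ne, if_neg (lt_irrefl a), Fintype.sum_eq_add c d l3, if_pos l, if_pos l2, ← e, ← ed] at this
  · have bd : bar n d - bar n b = -3 := by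
      simp only [bar, hd]; rw [if_neg (by omega), if_pos (by omega)]; omega
    have ebd : eps n b * eps n d = -1 := by
      simp only [eps, hd]; rw [if_pos (by omega), if_neg (by omega)]; simp
    simp only [bar_bc h b c hb hc, mul_assoc, eps_bc h b c hb hc, bd, ebd, if_neg (pr_ne n a), if_true] at this
    have k : T b a * T c a = q • (q⁻¹ • (T b a * T c a)) := by
      rw [smul_smul, mul_inv_cancel₀ q_ne, one_smul]
    rw [k]
    have this' : q⁻¹ • (T b a * T c a) = (q⁻¹^3) • (T c a * T b a) - (q⁻¹^3 * (q - q⁻¹)) • (T d a * T a a) := by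
      rw [← sub_eq_zero] at this ⊢
      rw [← this]
      have hq := q_ne
      have z2 : q ^ (-2 : ℤ) = q⁻¹ ^ 2 := by rw [zpow_neg, inv_pow]; rfl
      have z3 : q ^ (-3 : ℤ) = q⁻¹ ^ 3 := by rw [zpow_neg, inv_pow]; rfl
      simp only [z2, z3, zero_sub, zpow_neg, zpow_one, sub_zero, add_zero]
      match_scalars <;> field_simp <;> ring
    rw [this']
    have hq := q_ne
    match_scalars <;> field_simp
  · intro k hk
    split_ifs with h1
    · rw [h.up (pr n k) a]
      · simp
      · rw [Fin.lt_def, pr_val] at *; have : k.val ≠ c.val := fun h => hk.1 (Fin.ext h)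
        have : k.val ≠ d.val := fun h => hk.2 (Fin.ext h)
        omega
    · rfl
end typeC
end

section
set_option synthInstance.maxHeartbeats 1000000
set_option maxHeartbeats 1000000
set_option linter.unusedSimpArgs false
set_option linter.unusedVariables false

section abs
variable {K A : Type*} [Field K] [Ring A] [Algebra K A]

theorem inv_comm (s : K) (hs : s ≠ 0) {k j x : A} (h1 : k * j = 1) (h2 : j * k = 1)
    (h : k * x = s • (x * k)) : j * x = s⁻¹ • (x * j) := by
  have : j * (k * x) * j = s • (j * (x * k) * j) := by rw [h, mul_smul_comm, smul_mul_assoc]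
  rw [← mul_assoc j k, h2, one_mul, mul_assoc j, mul_assoc x, h1, mul_one] at this
  rw [this, smul_smul, inv_mul_cancel₀ hs, one_smul]

theorem inv_comm1 {k j x : A} (h1 : k * j = 1) (h2 : j * k = 1)
    (h : k * x = x * k) : j * x = x * j := by
  have : j * (k * x) * j = j * (x * k) * j := by rw [h]
  rw [← mul_assoc j k, h2, one_mul, mul_assoc j, mul_assoc x, h1, mul_one] at this
  exact this.symm

theorem absA (p : K) (hp : p ≠ 0) (x y z kb ja jb : A)
    (hay : ja * y = y * ja) (hbx : jb * x = p⁻¹ • (x * jb)) (haz : ja * z = p • (z * ja))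
    (hax : ja * x = p • (x * ja)) (hbz : jb * z = z * jb) (hb : kb * jb = 1) (hab : jb * ja = ja * jb)
    (hxy : x * y = y * x - (p - p⁻¹) • (z * kb)) (hxz : x * z = p⁻¹ • (z * x)) (hzy : z * y = p⁻¹ • (y * z)) :
    (x * ja) ^ 2 * (y * jb) - (p + p⁻¹) • ((x * ja) * (y * jb) * (x * ja)) + (y * jb) * (x * ja) ^ 2 = 0 ∧
    (y * jb) ^ 2 * (x * ja) - (p + p⁻¹) • ((y * jb) * (x * ja) * (y * jb)) + (x * ja) * (y * jb) ^ 2 = 0 := by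
  have r : ∀ {a b : A}, a = b → ∀ x, a * x = b * x := fun h x => by rw [h]
  have a1 := r hay; have a2 := r hbx; have a3 := r haz; have a4 := r hax; have a5 := r hbz
  have a6 := r hb; have a7 := r hab; have a8 := r hxy; have a9 := r hxz; have a10 := r hzy
  simp only [mul_assoc, add_mul, sub_mul, smul_mul_assoc, one_mul, mul_one] at a1 a2 a3 a4 a5 a6 a7 a8 a9 a10
  have k1 : (x * ja) * (y * jb) - p • ((y * jb) * (x * ja)) = (-(p - p⁻¹)) • (z * ja) := by
    have : kb * (ja * jb) = ja := by rw [← hab, ← mul_assoc, hb, one_mul]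
    simp only [mul_assoc, mul_sub, sub_mul, smul_mul_assoc, mul_smul_comm, hay, hbx, haz, hax, hbz, hb, hab, hxy, hxz, hzy, a1, a2, a3, a4, a5, a6, a7, a8, a9, a10, this]
    match_scalars <;> field_simp <;> ring
  refine ⟨serreL p _ hp _ _ _ k1 ?_, serreR p _ hp _ _ _ k1 ?_⟩
  · simp only [mul_assoc, mul_sub, sub_mul, smul_mul_assoc, mul_smul_comm, hay, hbx, haz, hax, hbz, hb, hab, hxy, hxz, hzy, a1, a2, a3, a4, a5, a6, a7, a8, a9, a10]
    match_scalars; ring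
  · simp only [mul_assoc, mul_sub, sub_mul, smul_mul_assoc, mul_smul_comm, hay, hbx, haz, hax, hbz, hb, hab, hxy, hxz, hzy, a1, a2, a3, a4, a5, a6, a7, a8, a9, a10]

theorem absC (p : K) (hp : p ≠ 0) (x y z w ka kb ja jb : A)
    (hay : ja * y = y * ja) (hbx : jb * x = p⁻¹ • (x * jb)) (haz : ja * z = p • (z * ja))
    (hax : ja * x = p • (x * ja)) (hbz : jb * z = p • (z * jb)) (haw : ja * w = (p^2) • (w * ja))
    (hb : kb * jb = 1) (ha : ka * ja = 1) (hab : jb * ja = ja * jb)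
    (hxy : p⁻¹ • (x * y) - y * x = (-(p - p⁻¹) * (1 + p⁻¹^2)) • (z * kb))
    (hxz : x * z = (p⁻¹^2) • (z * x) - (p⁻¹^2 * (p - p⁻¹)) • (w * ka))
    (hzy : z * y = p⁻¹ • (y * z)) (hxw : x * w = p⁻¹ • (w * x)):
    ((x * ja) ^ 3 * (y * jb) - (p^2+1+(p^2)⁻¹) • ((x * ja)^2 * (y * jb) * (x * ja)) + (p^2+1+(p^2)⁻¹) • ((x * ja) * (y * jb) * (x * ja) ^ 2)
      - (y * jb) * (x * ja) ^ 3 = 0) ∧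
    ((y * jb) ^ 2 * (x * ja) - (p^2 + (p^2)⁻¹) • ((y * jb) * (x * ja) * (y * jb)) + (x * ja) * (y * jb) ^ 2 = 0) := by
  have hxy' : x * y = p • (y * x) - (p * (p - p⁻¹) * (1 + p⁻¹^2)) • (z * kb) := by
    have : p • (p⁻¹ • (x * y) - y * x) = p • ((-(p - p⁻¹) * (1 + p⁻¹^2)) • (z * kb)) := by rw [hxy]
    rw [smul_sub, smul_smul, mul_inv_cancel₀ hp, one_smul, sub_eq_iff_eq_add] at this
    rw [this]; match_scalars <;> ring
  have r : ∀ {a b : A}, a = b → ∀ x, a * x = b * x := fun h x => by rw [h]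
  have a1 := r hay; have a2 := r hbx; have a3 := r haz; have a4 := r hax; have a5 := r hbz
  have a6 := r hb; have a7 := r hab; have a8 := r hxy'; have a9 := r hxz; have a10 := r hzy
  have a11 := r ha; have a12 := r hxw; have a13 := r haw
  simp only [mul_assoc, add_mul, sub_mul, smul_mul_assoc, one_mul, mul_one] at a1 a2 a3 a4 a5 a6 a7 a8 a9 a10 a11 a12 a13
  have k1 : (x * ja) * (y * jb) - (p^2) • ((y * jb) * (x * ja)) = (-(p * (p - p⁻¹)* (1 + p⁻¹^2))) • (z * ja) := by
    have : kb * (ja * jb) = ja := by rw [← hab, ← mul_assoc, hb, one_mul]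
    simp only [mul_assoc, mul_sub, sub_mul, smul_mul_assoc, mul_smul_comm, hay, hbx, haz, hax, hbz, hb, hab, hxy', hxz, hzy, a1, a2, a3, a4, a5, a6, a7, a8, a9, a10, this]
    match_scalars <;> field_simp <;> ring
  refine ⟨serre4 p _ (-(p⁻¹ * (p - p⁻¹))) (p^2) ((p^2)⁻¹) 1 hp _ _ _ (w * ja) k1 ?_ ?_ ?_ ?_ ?_, serreR (p^2) _ (pow_ne_zero 2 hp) _ _ _ k1 ?_⟩
  · simp only [mul_assoc, mul_sub, sub_mul, smul_mul_assoc, mul_smul_comm, hay, hbx, haz, hax, hbz, hb, hab, hxy', hxz, hzy, a1, a2, a3, a4, a5, a6, a7, a8, a9, a10, a11, ha]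
    match_scalars <;> field_simp <;> ring
  · simp only [mul_assoc, mul_sub, sub_mul, smul_mul_assoc, mul_smul_comm, hax, haw, hxw, a4, a12, a13]
    match_scalars; field_simp
  · ring
  · field_simp; ring
  · field_simp
  · simp only [mul_assoc, mul_sub, sub_mul, smul_mul_assoc, mul_smul_comm, hay, hbx, haz, hax, hbz, hb, hab, hxz, hzy, a1, a2, a3, a4, a5, a6, a7, a9, a10]
    match_scalars; field_simp

/-- twisting Serre relations by commuting Cartan elements -/
theorem twist3 (p c11 c12 c22: K) (h1 : c11 ≠ 0) (h2 : c12 ≠ 0)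
    (F1 F2 K1 K2 : A) (hK : K2 * K1 = K1 * K2) (h11 : F1 * K1 = c11 • (K1 * F1))
    (h12 : F1 * K2 = c12 • (K2 * F1)) (h21 : F2 * K1 = c12 • (K1 * F2)) (h22 : F2 * K2 = c22 • (K2 * F2))
    (h : F1 ^ 2 * F2 - (p + p⁻¹) • (F1 * F2 * F1) + F2 * F1 ^ 2 = 0) :
    (K1 * F1) ^ 2 * (K2 * F2) - (p + p⁻¹) • ((K1 * F1) * (K2 * F2) * (K1 * F1)) + (K2 * F2) * (K1 * F1) ^ 2 = 0 := by
  have r : ∀ {a b : A}, a = b → ∀ x, a * x = b * x := fun h x => by rw [h]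
  have a1 := r hK; have a2 := r h11; have a3 := r h12; have a4 := r h21; have a5 := r h22
  simp only [mul_assoc, smul_mul_assoc] at a1 a2 a3 a4 a5
  have e : (K1 * F1) ^ 2 * (K2 * F2) - (p + p⁻¹) • ((K1 * F1) * (K2 * F2) * (K1 * F1)) + (K2 * F2) * (K1 * F1) ^ 2
     = (c11 * c12^2) • (K1 * K1 * K2 * (F1 ^ 2 * F2 - (p + p⁻¹) • (F1 * F2 * F1) + F2 * F1 ^ 2)) := by
    simp only [pow_two, mul_add, mul_sub, mul_assoc, smul_mul_assoc, mul_smul_comm, hK, h11, h12, h21, a1, a2, a3, a4]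
    module
  rw [e, h, mul_zero, smul_zero]

theorem twist4 (p c11 c12 c22: K) (h1 : c11 ≠ 0) (h2 : c12 ≠ 0)
    (F1 F2 K1 K2 : A) (hK : K2 * K1 = K1 * K2) (h11 : F1 * K1 = c11 • (K1 * F1))
    (h12 : F1 * K2 = c12 • (K2 * F1)) (h21 : F2 * K1 = c12 • (K1 * F2)) (h22 : F2 * K2 = c22 • (K2 * F2))
    (h : F1 ^ 3 * F2 - p • (F1 ^ 2 * F2 * F1) + p • (F1 * F2 * F1^2) - F2 * F1 ^ 3 = 0) :
    (K1 * F1) ^ 3 * (K2 * F2) - p • ((K1 * F1)^2 * (K2 * F2) * (K1 * F1)) + p • ((K1 * F1) * (K2 * F2) * (K1 * F1)^2)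
     - (K2 * F2) * (K1 * F1) ^ 3 = 0 := by
  have r : ∀ {a b : A}, a = b → ∀ x, a * x = b * x := fun h x => by rw [h]
  have a1 := r hK; have a2 := r h11; have a3 := r h12; have a4 := r h21; have a5 := r h22
  simp only [mul_assoc, smul_mul_assoc] at a1 a2 a3 a4 a5
  have e : (K1 * F1) ^ 3 * (K2 * F2) - p • ((K1 * F1)^2 * (K2 * F2) * (K1 * F1)) + p • ((K1 * F1) * (K2 * F2) * (K1 * F1)^2)
     - (K2 * F2) * (K1 * F1) ^ 3
     = (c11^3 * c12^3) • (K1 * K1 * K1 * K2 * (F1 ^ 3 * F2 - p • (F1 ^ 2 * F2 * F1) + p • (F1 * F2 * F1^2) - F2 * F1 ^ 3)) := by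
    simp only [pow_succ, pow_zero, one_mul, mul_add, mul_sub, mul_assoc, smul_mul_assoc, mul_smul_comm, hK, h11, h12, h21, a1, a2, a3, a4]
    module
  rw [e, h, mul_zero, smul_zero]
end abs
end

section
set_option synthInstance.maxHeartbeats 1000000
set_option maxHeartbeats 1000000
set_option linter.unusedSimpArgs false
set_option linter.unusedVariables false
local instance natAlgF2 : Algebra ℕ F := Semiring.toNatAlgebra
local instance intAlgF2 : Algebra ℤ F := Ring.toIntAlgebra _
variable {A : Type*} [Ring A] [Algebra F A] {n : ℕ} {T : Fin (2*n) → Fin (2*n) → A}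

def lo (i : Fin n) : Fin (2*n) := ⟨i.val, by have := i.isLt; omega⟩
def hi (i : Fin n) : Fin (2*n) := ⟨i.val + 1, by have := i.isLt; omega⟩
@[simp] theorem lo_val (i : Fin n) : (lo i).val = i.val := rfl
@[simp] theorem hi_val (i : Fin n) : (hi i).val = i.val + 1 := rfl
theorem lo_lt_hi (i : Fin n) : lo i < hi i := by rw [Fin.lt_def]; simp

theorem ne_pr_of {i j : Fin (2*n)} (h : i.val + j.val + 1 ≠ 2 * n) : i ≠ pr n j := by
  intro e; have := congrArg Fin.val e; simp only [pr_val] at this; have := j.isLt; omega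

/-- q-Serre relations of type C. -/
structure QS {A : Type*} [Ring A] [Algebra F A] (n : ℕ) (f : Fin n → A) : Prop where
  comm : ∀ i j : Fin n, (i : ℕ) + 2 ≤ (j : ℕ) → f i * f j = f j * f i
  serre : ∀ i j : Fin n, ((i : ℕ) + 1 = (j : ℕ) ∨ (j : ℕ) + 1 = (i : ℕ)) →
      ¬((i : ℕ) + 2 = n ∧ (j : ℕ) + 1 = n) →
      f i ^ 2 * f j - (qi n i + (qi n i)⁻¹) • (f i * f j * f i) + f j * f i ^ 2 = 0
  quartic : ∀ i j : Fin n, (i : ℕ) + 2 = n → (j : ℕ) + 1 = n →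
      f i ^ 3 * f j - (q^2 + 1 + (q^2)⁻¹) • (f i ^ 2 * f j * f i)
              + (q^2 + 1 + (q^2)⁻¹) • (f i * f j * f i ^ 2) - f j * f i ^ 3 = 0

theorem QS.smul {f : Fin n → A} (h : QS n f) (c : Fin n → F) : QS n (fun i => c i • f i) where
  comm i j hij := by
    simp only [smul_mul_assoc, mul_smul_comm, h.comm i j hij]; rw [smul_comm]
  serre i j h1 h2 := by
    have e : ((c i)^2 * c j) • (f i ^ 2 * f j - (qi n i + (qi n i)⁻¹) • (f i * f j * f i) + f j * f i ^ 2) = 0 := by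
      rw [h.serre i j h1 h2, smul_zero]
    rw [← e]; simp only [smul_mul_assoc, mul_smul_comm, smul_pow]
    module
  quartic i j h1 h2 := by
    have e : ((c i)^3 * c j) • (f i ^ 3 * f j - (q^2 + 1 + (q^2)⁻¹) • (f i ^ 2 * f j * f i)
              + (q^2 + 1 + (q^2)⁻¹) • (f i * f j * f i ^ 2) - f j * f i ^ 3) = 0 := by
      rw [h.quartic i j h1 h2, smul_zero]
    rw [← e]; simp only [smul_mul_assoc, mul_smul_comm, smul_pow]
    module

/-- weight of `k_m` on the j-th simple root vector -/
def wt (n m j : ℕ) : F :=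
  if j + 1 < n then
    (if m = j then q⁻¹ else if m = j + 1 then q else if m = n ∧ j + 2 = n then q⁻¹ else 1)
  else (if m = j then q⁻¹^2 else if m = j + 1 then q^2 else 1)

theorem wt_ne (m j : ℕ) : wt n m j ≠ 0 := by
  have := q_ne
  unfold wt; split_ifs <;> simp [this]

theorem LT.kx (h : LT n T) (m : Fin (2*n)) (hm : m.val ≤ n) (j : Fin n) :
    T m m * T (hi j) (lo j) = wt n m j • (T (hi j) (lo j) * T m m) := by
  have hj := j.isLt
  unfold wt
  by_cases h1 : j.val + 1 < n
  · rw [if_pos h1]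
    by_cases h2 : m.val = j.val
    · rw [if_pos h2]
      have : m = lo j := Fin.ext h2
      subst this
      exact h.kax _ _ (lo_lt_hi j) (ne_pr_of (by simp only [lo_val, hi_val]; omega))
    rw [if_neg h2]
    by_cases h3 : m.val = j.val + 1
    · rw [if_pos h3]
      have : m = hi j := Fin.ext h3
      subst this
      exact h.kbx _ _ (lo_lt_hi j) (ne_pr_of (by simp only [lo_val, hi_val]; omega))
    rw [if_neg h3]
    by_cases h4 : m.val = n ∧ j.val + 2 = n
    · rw [if_pos h4]
      exact h.kcx' (lo j) (hi j) m (by simp only [lo_val, hi_val]; omega) (by simp only [lo_val, hi_val]; omega) h4.1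
    rw [if_neg h4, one_smul]
    exact h.kcx (lo j) (hi j) m (lo_lt_hi j) (by simp only [Fin.lt_def, lo_val, hi_val]; omega) (ne_pr_of (by simp only [lo_val, hi_val]; omega)) (ne_pr_of (by simp only [lo_val, hi_val]; omega))
  · rw [if_neg h1]
    by_cases h2 : m.val = j.val
    · rw [if_pos h2]
      have : m = lo j := Fin.ext h2
      subst this
      exact h.kby _ _ (by simp only [lo_val, hi_val]; omega) (by simp only [lo_val, hi_val]; omega)
    rw [if_neg h2]
    by_cases h3 : m.val = j.val + 1
    · rw [if_pos h3]
      have : m = hi j := Fin.ext h3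
      subst this
      exact h.kcy _ _ (by simp only [lo_val, hi_val]; omega) (by simp only [lo_val, hi_val]; omega)
    rw [if_neg h3, one_smul]
    exact h.kcx (lo j) (hi j) m (lo_lt_hi j) (by simp only [Fin.lt_def, lo_val, hi_val]; omega) (ne_pr_of (by simp only [lo_val, hi_val]; omega)) (ne_pr_of (by simp only [lo_val, hi_val]; omega))

theorem LT.kmid (h : LT n T) (a b c : Fin (2*n)) (hab : a < b) (hbc : b < c) (hp : c ≠ pr n b) (hp' : a ≠ pr n b) :
    T b b * T c a = T c a * T b b := by
  have := h.rtt.gen b c b a hp hp'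
  simpa [hab, hbc, hab.ne', hbc.ne] using this

variable (h : LT n T) (J : Fin (2*n) → A) (h1 : ∀ a, T a a * J a = 1) (h2 : ∀ a, J a * T a a = 1)
include h h1 h2

theorem LT.kkall (a b : Fin (2*n)) : T a a * T b b = T b b * T a a := by
  by_cases hh : b = pr n a
  · subst hh; exact h.kk' a
  · exact h.kk a b hh
theorem LT.JT (a b : Fin (2*n)) : J a * T b b = T b b * J a :=
  inv_comm1 (h1 a) (h2 a) (h.kkall J h1 h2 a b)
theorem LT.JJ (a b : Fin (2*n)) : J a * J b = J b * J a :=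
  inv_comm1 (h1 a) (h2 a) ((h.JT J h1 h2 b a).symm)
theorem LT.Jx (m : Fin (2*n)) (hm : m.val ≤ n) (j : Fin n) :
    J m * T (hi j) (lo j) = (wt n m j)⁻¹ • (T (hi j) (lo j) * J m) :=
  inv_comm _ (wt_ne _ _) (h1 m) (h2 m) (h.kx m hm j)

theorem LT.serreA (i j : Fin n) (hij : i.val + 1 = j.val) (hj : j.val + 1 < n) :
    let f := fun i : Fin n => T (hi i) (lo i) * J (lo i)
    (f i ^ 2 * f j - (q + q⁻¹) • (f i * f j * f i) + f j * f i ^ 2 = 0) ∧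
    (f j ^ 2 * f i - (q + q⁻¹) • (f j * f i * f j) + f i * f j ^ 2 = 0) := by
  have hl : lo j = hi i := Fin.ext (by simp only [lo_val, hi_val]; omega)
  have vi := lo_val i
  have vj := lo_val j
  have hjlt := j.isLt
  have hilt := i.isLt
  have e1 := h.Jx J h1 h2 (lo i) (by simp only [lo_val, hi_val]; omega) j
  have e2 := h.Jx J h1 h2 (lo j) (by simp only [lo_val, hi_val]; omega) i
  have e3 := h.Jx J h1 h2 (lo i) (by simp only [lo_val, hi_val]; omega) i
  rw [show wt n (lo i) j = 1 by unfold wt; split_ifs <;> first | (exfalso; omega) | rfl, inv_one, one_smul] at e1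
  rw [show wt n (lo j) i = q by unfold wt; split_ifs <;> first | (exfalso; omega) | rfl] at e2
  rw [show wt n (lo i) i = q⁻¹ by unfold wt; split_ifs <;> first | (exfalso; omega) | rfl, inv_inv] at e3
  have l1 : lo i < lo j := by rw [Fin.lt_def]; simp; omega
  have l2 : lo j < hi j := lo_lt_hi j
  have l3 := l1.trans l2
  have e4 := inv_comm _ (inv_ne_zero q_ne) (h1 _) (h2 _) (h.kax (lo i) (hi j) l3 (ne_pr_of (by simp only [lo_val, hi_val]; omega)))
  rw [inv_inv] at e4
  have e5 := inv_comm1 (h1 _) (h2 _) (h.kmid (lo i) (lo j) (hi j) l1 l2 (ne_pr_of (by simp only [lo_val, hi_val]; omega)) (ne_pr_of (by simp only [lo_val, hi_val]; omega)))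
  have e6 := h.xy (lo i) (lo j) (hi j) l1 l2 (ne_pr_of (by simp only [lo_val, hi_val]; omega)) (ne_pr_of (by simp only [lo_val, hi_val]; omega))
  have e7 := h.xz (lo i) (lo j) (hi j) l2 (ne_pr_of (by simp only [lo_val, hi_val]; omega))
  have e8 := h.zy (lo i) (lo j) (hi j) l1 (ne_pr_of (by simp only [lo_val, hi_val]; omega))
  rw [← hl] at e2 e3
  have := absA q q_ne _ _ _ (T (lo j) (lo j)) _ _ e1 e2 e4 e3 e5 (h1 _) (h.JJ J h1 h2 _ _) e6 e7 e8
  simpa only [hl] using this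

theorem LT.serreC (i j : Fin n) (hij : i.val + 2 = n) (hj : j.val + 1 = n) :
    let f := fun i : Fin n => T (hi i) (lo i) * J (lo i)
    (f i ^ 3 * f j - (q^2 + 1 + (q^2)⁻¹) • (f i ^ 2 * f j * f i)
              + (q^2 + 1 + (q^2)⁻¹) • (f i * f j * f i ^ 2) - f j * f i ^ 3 = 0) ∧
    (f j ^ 2 * f i - (q^2 + (q^2)⁻¹) • (f j * f i * f j) + f i * f j ^ 2 = 0) := by
  have hl : lo j = hi i := Fin.ext (by simp only [lo_val, hi_val]; omega)
  have vi := lo_val i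
  have vj := lo_val j
  have hjlt := j.isLt
  have hilt := i.isLt
  have e1 := h.Jx J h1 h2 (lo i) (by simp only [lo_val, hi_val]; omega) j
  have e2 := h.Jx J h1 h2 (lo j) (by simp only [lo_val, hi_val]; omega) i
  have e3 := h.Jx J h1 h2 (lo i) (by simp only [lo_val, hi_val]; omega) i
  rw [show wt n (lo i) j = 1 by unfold wt; split_ifs <;> first | (exfalso; omega) | rfl, inv_one, one_smul] at e1
  rw [show wt n (lo j) i = q by unfold wt; split_ifs <;> first | (exfalso; omega) | rfl] at e2
  rw [show wt n (lo i) i = q⁻¹ by unfold wt; split_ifs <;> first | (exfalso; omega) | rfl, inv_inv] at e3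
  have l1 : lo i < lo j := by rw [Fin.lt_def]; simp; omega
  have l2 : lo j < hi j := lo_lt_hi j
  have l3 := l1.trans l2
  obtain ⟨d, hd⟩ : ∃ d : Fin (2*n), d.val = n + 1 := ⟨⟨n+1, by omega⟩, rfl⟩
  have v1 : (lo i).val + 2 = n := hij
  have v2 : (lo j).val + 1 = n := hj
  have v3 : (hi j).val = n := hj
  have e4 := inv_comm _ (inv_ne_zero q_ne) (h1 _) (h2 _) (h.kax (lo i) (hi j) l3 (ne_pr_of (by omega)))
  rw [inv_inv] at e4
  have e5 := inv_comm _ (inv_ne_zero q_ne) (h1 _) (h2 _) (h.kbz (lo i) (lo j) (hi j) v1 v2 v3)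
  rw [inv_inv] at e5
  have e5' := inv_comm _ (pow_ne_zero 2 (inv_ne_zero q_ne)) (h1 _) (h2 _) (h.kaw (lo i) (lo j) (hi j) d v1 v2 v3 hd)
  rw [inv_pow, inv_inv] at e5'
  have e6 := h.xyC (lo i) (lo j) (hi j) v1 v2 v3
  have e7 := h.xzC (lo i) (lo j) (hi j) d v1 v2 v3 hd
  have e8 := h.zy (lo i) (lo j) (hi j) l1 (ne_pr_of (by omega))
  have e9 := h.xz (lo i) (lo j) d (by rw [Fin.lt_def]; omega) (ne_pr_of (by omega))
  rw [← hl] at e2 e3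
  have := absC q q_ne _ _ _ _ (T (lo i) (lo i)) (T (lo j) (lo j)) _ _ e1 e2 e4 e3 e5 e5' (h1 _) (h1 _) (h.JJ J h1 h2 _ _) e6 e7 e8 e9
  simpa only [hl] using this

theorem LT.qs : QS n (fun i => T (hi i) (lo i) * J (lo i)) where
  comm i j hij := by
    have hj := j.isLt
    have vi := lo_val i
    have vj := lo_val j
    have e1 := h.Jx J h1 h2 (lo i) (by simp only [lo_val, hi_val]; omega) j
    have e2 := h.Jx J h1 h2 (lo j) (by simp only [lo_val, hi_val]; omega) i
    rw [show wt n (lo i) j = 1 by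
      unfold wt; split_ifs <;> first | (exfalso; omega) | rfl, inv_one, one_smul] at e1
    rw [show wt n (lo j) i = 1 by
      unfold wt; split_ifs <;> first | (exfalso; omega) | rfl, inv_one, one_smul] at e2
    have e3 := h.comm (lo i) (hi i) (lo j) (hi j) (lo_lt_hi i) (by rw [Fin.lt_def]; simp; omega) (lo_lt_hi j)
      (ne_pr_of (by simp only [lo_val, hi_val]; omega)) (ne_pr_of (by simp only [lo_val, hi_val]; omega))
    show T (hi i) (lo i) * J (lo i) * (T (hi j) (lo j) * J (lo j)) = T (hi j) (lo j) * J (lo j) * (T (hi i) (lo i) * J (lo i))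
    rw [mul_assoc, ← mul_assoc (J (lo i)), e1, mul_assoc, ← mul_assoc, e3, h.JJ J h1 h2, mul_assoc _ (J (lo j)), ← mul_assoc (J (lo j)), e2]
    simp only [mul_assoc]
  serre i j hij hx := by
    have hi' := i.isLt
    have hj' := j.isLt
    rcases hij with hij | hij
    · have := (h.serreA J h1 h2 i j hij (by omega)).1
      rwa [show qi n i = q by simp only [qi]; rw [if_pos (by omega)]]
    · by_cases h3 : i.val + 1 < n
      · have := (h.serreA J h1 h2 j i hij h3).2
        rwa [show qi n i = q by simp only [qi]; rw [if_pos (by omega)]]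
      · have := (h.serreC J h1 h2 j i (by omega) (by omega)).2
        rwa [show qi n i = q^2 by simp only [qi]; rw [if_neg (by omega)]]
  quartic i j hi hj := (h.serreC J h1 h2 i j hi hj).1
end

section
set_option synthInstance.maxHeartbeats 1000000
set_option maxHeartbeats 1000000
set_option linter.unusedSimpArgs false
set_option linter.unusedVariables false
local instance natAlgF3 : Algebra ℕ F := Semiring.toNatAlgebra
local instance intAlgF3 : Algebra ℤ F := Ring.toIntAlgebra _

theorem bar_pr (n : ℕ) (i : Fin (2*n)) : bar n (pr n i) = - bar n i := by
  have := i.isLt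
  simp only [bar, pr_val]; split_ifs <;> omega
theorem eps_pr (n : ℕ) (i : Fin (2*n)) : eps n (pr n i) = - eps n i := by
  have := i.isLt
  unfold eps
  by_cases h : i.val < n
  · rw [if_pos h, if_neg (by rw [pr_val]; omega)]
  · rw [if_neg h, if_pos (by rw [pr_val]; omega), neg_neg]
theorem pr_lt (n : ℕ) (i j : Fin (2*n)) : pr n i < pr n j ↔ j < i := by
  have := i.isLt; have := j.isLt
  simp only [Fin.lt_def, pr_val]; omega
theorem eps_sq (n : ℕ) (i : Fin (2*n)) : eps n i * eps n i = 1 := by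
  simp only [eps]; split_ifs <;> simp

theorem Rm_symm (n : ℕ) (i a k c : Fin (2*n)) : Rm n (i, a) (k, c) = Rm n (c, k) (a, i) := by
  simp only [Rm]
  congr 1
  · congr 1
    · by_cases h : i = k ∧ a = c
      · obtain ⟨rfl, rfl⟩ := h
        simp only [and_self, if_true]
        congr 1
        simp only [eq_comm (a := i) (b := a), eq_pr_comm (i := i) (j := a)]
      · rw [if_neg h, if_neg (by tauto)]
    · congr 1
      simp only [eq_iff_iff]; constructor
      · rintro ⟨h1, rfl, rfl⟩; exact ⟨h1, rfl, rfl⟩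
      · rintro ⟨h1, rfl, rfl⟩; exact ⟨h1, rfl, rfl⟩
  · by_cases h : i < k ∧ a = pr n i ∧ c = pr n k
    · obtain ⟨h1, rfl, rfl⟩ := h
      rw [if_pos ⟨h1, rfl, rfl⟩, if_pos ⟨(pr_lt _ _ _).2 h1, (pr_pr _ _).symm, (pr_pr _ _).symm⟩]
      simp only [bar_pr, eps_pr]
      rw [show -bar n i - -bar n k = bar n k - bar n i by ring]; ring
    · rw [if_neg h, if_neg]
      rintro ⟨h1, h2, h3⟩; apply h
      subst h2; subst h3
      simp only [pr_lt, pr_pr] at *; tauto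

theorem RTT.transp {A : Type*} [Ring A] [Algebra F A] {n : ℕ} {X Y : Fin (2*n) → Fin (2*n) → A}
    (h : RTT n X Y) : RTT n (fun i j => Y j i) (fun i j => X j i) := by
  intro i a j b
  have := h b j a i
  simp only [Rm_symm n i a]
  simp only [Rm_symm n b j] at this
  rw [this.symm, Finset.sum_comm]

theorem LT_t (n : ℕ) : LT n (tU n) := ⟨RTT_tt n, tU_upper n⟩
theorem LT_b (n : ℕ) : LT n (fun i j => tbU n j i) := ⟨(RTT_bb n).transp, fun i j h => tbU_lower n j i h⟩

def Fu (n : ℕ) (i : Fin n) : Usp n := tU n (hi i) (lo i) * tbU n (lo i) (lo i)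
def Eu (n : ℕ) (i : Fin n) : Usp n := tU n (hi i) (hi i) * tbU n (lo i) (hi i)
def Ku (n : ℕ) (i : Fin n) : Usp n := tU n (hi i) (hi i) * tbU n (lo i) (lo i)
theorem s'gen_eq (n : ℕ) (i : Fin n) : s'gen n i = Fu n i + Eu n i := rfl

def dw (n i j : ℕ) : F := wt n (i+1) j * (wt n i j)⁻¹
theorem dw_ne (n i j : ℕ) : dw n i j ≠ 0 := mul_ne_zero (wt_ne _ _) (inv_ne_zero (wt_ne _ _))

theorem dw_self {n i : ℕ} (h : i + 1 < n) : dw n i i = q^2 := by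
  have hq := q_ne
  simp [dw, wt, h]; ring
theorem dw_self' {n i : ℕ} (h : i + 1 = n) : dw n i i = q^4 := by
  have hq := q_ne
  subst h
  simp [dw, wt]; ring
theorem dw_succ {n i : ℕ} (h : i + 2 < n) : dw n i (i+1) = q⁻¹ := by
  simp only [dw, wt]; split_ifs <;> first | (exfalso; omega) | simp
theorem dw_pred {n i : ℕ} (h : i + 2 < n) : dw n (i+1) i = q⁻¹ := by
  simp only [dw, wt]; split_ifs <;> first | (exfalso; omega) | simp
theorem dw_succ' {n i : ℕ} (h : i + 2 = n) : dw n i (i+1) = q⁻¹^2 := by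
  simp only [dw, wt]; split_ifs <;> first | (exfalso; omega) | simp
theorem dw_pred' {n i : ℕ} (h : i + 2 = n) : dw n (i+1) i = q⁻¹^2 := by
  simp only [dw, wt]; split_ifs <;> first | (exfalso; omega) | (simp; try ring)
theorem dw_far {n i j : ℕ} (hj : j < n) (hi : i < n) (h : i + 2 ≤ j ∨ j + 2 ≤ i) : dw n i j = 1 := by
  simp only [dw, wt]; split_ifs <;> first | (exfalso; omega) | simp

section
variable {n : ℕ}

theorem bt_comm (a b : Fin (2*n)) : tbU n a a * tU n b b = tU n b b * tbU n a a :=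
  (LT_t n).JT (fun i => tbU n i i) (t_tb n) (tb_t n) a b

theorem Ku_comm (i j : Fin n) : Ku n j * Ku n i = Ku n i * Ku n j := by
  have e1 := (LT_t n).kkall (fun i => tbU n i i) (t_tb n) (tb_t n)
  have e2 := (LT_t n).JJ (fun i => tbU n i i) (t_tb n) (tb_t n)
  simp only [Ku]
  rw [mul_assoc, ← mul_assoc (tbU n _ _), bt_comm, mul_assoc, ← mul_assoc, e1, e2 (lo j)]
  rw [mul_assoc (tU n _ _), mul_assoc (tU n _ _), ← mul_assoc (tbU n _ _) (tU n _ _), bt_comm]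
  simp only [mul_assoc]

theorem Ku_Fu (i j : Fin n) : Ku n i * Fu n j = dw n i j • (Fu n j * Ku n i) := by
  have hi' := i.isLt
  have e1 := (LT_t n).Jx (fun i => tbU n i i) (t_tb n) (tb_t n) (lo i) (by simp only [lo_val]; omega) j
  have e2 := (LT_t n).kx (hi i) (by simp only [hi_val]; omega) j
  have e3 := (LT_t n).JJ (fun i => tbU n i i) (t_tb n) (tb_t n)
  simp only [Ku, Fu]
  rw [mul_assoc, ← mul_assoc (tbU n _ _), e1, smul_mul_assoc, mul_smul_comm, mul_assoc, e3 (lo i), ← mul_assoc, e2,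
    smul_mul_assoc, smul_smul, mul_assoc, ← mul_assoc (tU n (hi i) (hi i)), ← bt_comm]
  simp only [mul_assoc, dw, lo_val, hi_val]
  rw [mul_comm]

/-- the opposite root vectors -/
def Gu (n : ℕ) (i : Fin n) : Usp n := tbU n (lo i) (hi i) * tU n (lo i) (lo i)

theorem Gu_Ku (i j : Fin n) : Gu n j * Ku n i = dw n i j • (Ku n i * Gu n j) := by
  have hi' := i.isLt
  have e1 := (LT_b n).Jx (fun i => tU n i i) (tb_t n) (t_tb n) (hi i) (by simp only [hi_val]; omega) j
  have e2 := (LT_b n).kx (lo i) (by simp only [lo_val]; omega) j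
  have e3 := (LT_t n).kkall (fun i => tbU n i i) (t_tb n) (tb_t n)
  have w1 := wt_ne (n := n) (hi i).val j.val
  have w2 := wt_ne (n := n) (lo i).val j.val
  have e1' : tbU n (lo j) (hi j) * tU n (hi i) (hi i) = wt n (hi i) j • (tU n (hi i) (hi i) * tbU n (lo j) (hi j)) := by
    rw [e1, smul_smul, mul_inv_cancel₀ w1, one_smul]
  have e2' : tbU n (lo j) (hi j) * tbU n (lo i) (lo i) = (wt n (lo i) j)⁻¹ • (tbU n (lo i) (lo i) * tbU n (lo j) (hi j)) := by
    rw [e2, smul_smul, inv_mul_cancel₀ w2, one_smul]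
  simp only [Ku, Gu]
  rw [mul_assoc, ← mul_assoc (tU n (lo j) _), e3 (lo j), mul_assoc, ← bt_comm, ← mul_assoc, e1', smul_mul_assoc, mul_assoc,
    ← mul_assoc (tbU n (lo j) _), e2', smul_mul_assoc, mul_smul_comm, smul_smul]
  simp only [mul_assoc, dw, lo_val, hi_val]

theorem Gu_qs (n : ℕ) : QS n (Gu n) := (LT_b n).qs (fun i => tU n i i) (tb_t n) (t_tb n)
theorem Fu_qs (n : ℕ) : QS n (Fu n) := (LT_t n).qs (fun i => tbU n i i) (t_tb n) (tb_t n)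

theorem Eu_Gu (i : Fin n) : Eu n i = qi n i • (Ku n i * Gu n i) := by
  have hi' := i.isLt
  have e2 := (LT_b n).kx (lo i) (by simp only [lo_val]; omega) i
  have : wt n (lo i) i = (qi n i)⁻¹ := by
    simp only [wt, qi, lo_val]; split_ifs <;> first | (exfalso; omega) | simp
  rw [this] at e2
  have hq : qi n i ≠ 0 := by have := q_ne; simp only [qi]; split_ifs <;> simp [this]
  simp only [Eu, Ku, Gu]
  rw [mul_assoc, ← mul_assoc (tbU n _ _), e2, smul_mul_assoc, mul_smul_comm, smul_smul, mul_inv_cancel₀ hq, one_smul,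
    mul_assoc (tbU n _ _), tb_t, mul_one]

theorem qi_ne (i : Fin n) : qi n i ≠ 0 := by
  have := q_ne; simp only [qi]; split_ifs <;> simp [this]

theorem Eu_qs (n : ℕ) : QS n (Eu n) := by
  have key : QS n (fun i => Ku n i * Gu n i) := by
    have g := Gu_qs n
    constructor
    · intro i j hij
      have a1 := Gu_Ku j i
      have a2 := Gu_Ku i j
      rw [dw_far i.isLt j.isLt (by omega), one_smul] at a1
      rw [dw_far j.isLt i.isLt (by omega), one_smul] at a2
      rw [mul_assoc, ← mul_assoc (Gu n i), a1, mul_assoc, g.comm i j hij, ← mul_assoc, Ku_comm, mul_assoc,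
        ← mul_assoc (Ku n i), ← a2]; simp only [mul_assoc]
    · intro i j hij hx
      have hh : dw n i j = dw n j i := by
        have := i.isLt; have := j.isLt
        rcases hij with h | h
        · rw [← h, dw_succ (by omega), dw_pred (by omega)]
        · by_cases h2 : j.val + 2 < n
          · rw [← h, dw_succ h2, dw_pred h2]
          · rw [← h, dw_succ' (by omega), dw_pred' (by omega)]
      exact twist3 (qi n i) _ _ _ (dw_ne n i i) (dw_ne n j i) _ _ _ _ (Ku_comm i j) (Gu_Ku i i) (Gu_Ku j i) (hh ▸ Gu_Ku i j) (Gu_Ku j j) (g.serre i j hij hx)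
    · intro i j h1 h2
      have hh : dw n i j = dw n j i := by
        have h : i.val + 1 = j.val := by omega
        rw [← h, dw_succ' h1, dw_pred' h1]
      exact twist4 _ _ _ _ (dw_ne n i i) (dw_ne n j i) _ _ _ _ (Ku_comm i j) (Gu_Ku i i) (Gu_Ku j i) (hh ▸ Gu_Ku i j) (Gu_Ku j j) (g.quartic i j h1 h2)
  have := key.smul (qi n)
  have e : (fun i => qi n i • (Ku n i * Gu n i)) = Eu n := by funext i; rw [Eu_Gu]
  rwa [e] at this

theorem Eu_Ku (i j : Fin n) : Eu n j * Ku n i = dw n i j • (Ku n i * Eu n j) := by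
  rw [Eu_Gu, smul_mul_assoc, mul_assoc, Gu_Ku, mul_smul_comm, ← mul_assoc, Ku_comm, mul_smul_comm, smul_comm, mul_assoc]
end
end

section
set_option synthInstance.maxHeartbeats 1000000
set_option maxHeartbeats 1000000
set_option linter.unusedSimpArgs false
set_option linter.unusedVariables false
local instance natAlgF4 : Algebra ℕ F := Semiring.toNatAlgebra
local instance intAlgF4 : Algebra ℤ F := Ring.toIntAlgebra _
variable {n : ℕ}

def rw1 (i j : ℕ) : F := if j = i + 1 then q else if i = j + 1 then q⁻¹ else 1

theorem bt_off (i j : Fin n) (hij : i ≠ j) :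
    tbU n (lo i) (hi i) * tU n (hi j) (lo j) = rw1 i j • (tU n (hi j) (lo j) * tbU n (lo i) (hi i)) := by
  have hi' := i.isLt
  have hj' := j.isLt
  have hne : i.val ≠ j.val := fun h => hij (Fin.ext h)
  have := (RTT_bt n).gen (lo i) (hi j) (hi i) (lo j) (ne_pr_of (by simp only [lo_val, hi_val]; omega)) (ne_pr_of (by simp only [lo_val, hi_val]; omega))
  by_cases h1 : j.val = i.val + 1
  · have e : hi i = lo j := Fin.ext (by simp [h1])
    have l : lo i < hi j := by rw [Fin.lt_def]; simp only [lo_val, hi_val]; omega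
    rw [e] at this ⊢
    rw [if_neg l.ne, one_smul, if_pos l, if_pos rfl, if_neg (lt_irrefl _), tbU_lower n (hi j) (lo j) (lo_lt_hi j)] at this
    rw [rw1, if_pos h1]; simpa using this
  by_cases h2 : i.val = j.val + 1
  · have e : hi j = lo i := Fin.ext (by simp [h2])
    have l : lo j < hi i := by rw [Fin.lt_def]; simp only [lo_val, hi_val]; omega
    rw [e] at this ⊢
    rw [if_neg l.ne', one_smul, if_pos rfl, if_neg (lt_irrefl _), if_pos l, tU_upper n (lo i) (hi i) (lo_lt_hi i)] at this
    rw [rw1, if_neg h1, if_pos h2]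
    simp only [add_zero, zero_mul, smul_zero] at this
    rw [← this, smul_smul, inv_mul_cancel₀ q_ne, one_smul]
  · rw [rw1, if_neg h1, if_neg h2, one_smul]
    have n1 : lo i ≠ hi j := fun h => h2 (by have := congrArg Fin.val h; simpa using this)
    have n2 : hi i ≠ lo j := fun h => h1 (by have := congrArg Fin.val h; simpa using this.symm)
    rw [if_neg n1, if_neg n2, one_smul, one_smul] at this
    by_cases h3 : i.val < j.val
    · have l1 : lo i < hi j := by rw [Fin.lt_def]; simp only [lo_val, hi_val]; omega
      have l2 : ¬ lo j < hi i := by rw [Fin.lt_def]; simp only [lo_val, hi_val]; omega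
      have l3 : hi i < hi j := by rw [Fin.lt_def]; simp only [lo_val, hi_val]; omega
      rw [if_pos l1, if_neg l2, tbU_lower n _ _ l3] at this
      simpa using this
    · have l1 : ¬ lo i < hi j := by rw [Fin.lt_def]; simp only [lo_val, hi_val]; omega
      have l2 : lo j < hi i := by rw [Fin.lt_def]; simp only [lo_val, hi_val]; omega
      have l3 : hi j < hi i := by rw [Fin.lt_def]; simp only [lo_val, hi_val]; omega
      rw [if_neg l1, if_pos l2, tU_upper n _ _ l3] at this
      simpa using this

theorem bt_diag (i : Fin n) :
    tbU n (lo i) (hi i) * tU n (hi i) (lo i) = tU n (hi i) (lo i) * tbU n (lo i) (hi i)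
     + (qi n i - (qi n i)⁻¹) • (tU n (hi i) (hi i) * tbU n (lo i) (lo i) - tbU n (hi i) (hi i) * tU n (lo i) (lo i)) := by
  have hi' := i.isLt
  have l := lo_lt_hi i
  by_cases h : i.val + 1 < n
  · have := (RTT_bt n).gen (lo i) (hi i) (hi i) (lo i) (ne_pr_of (by simp only [lo_val, hi_val]; omega)) (ne_pr_of (by simp only [lo_val, hi_val]; omega))
    rw [if_neg l.ne, if_neg l.ne', if_pos l, if_pos l, one_smul, one_smul] at this
    rw [qi, if_pos h, smul_sub, add_sub, ← this]; abel
  · have e : hi i = pr n (lo i) := by apply Fin.ext; simp only [pr_val, lo_val, hi_val]; omega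
    have e' : lo i = pr n (hi i) := by rw [e, pr_pr]
    have := (RTT_bt n).expand (lo i) (hi i) (hi i) (lo i)
    rw [if_neg l.ne, if_neg l.ne', if_pos l, if_pos l, if_pos e, if_pos e', if_pos e', if_pos e,
      Fintype.sum_eq_single (hi i), Fintype.sum_eq_single (lo i), if_pos l, if_pos l, ← e, ← e'] at this
    · have c1 : bar n (hi i) - bar n (lo i) = -2 := by
        have v1 := lo_val i; have v2 := hi_val i
        unfold bar; rw [if_neg (by omega), if_pos (by omega)]; omega
      have c2 : eps n (lo i) * eps n (hi i) = -1 := by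
        have v1 := lo_val i; have v2 := hi_val i
        unfold eps; rw [if_pos (by omega), if_neg (by omega)]; simp
      simp only [mul_assoc, c1, c2] at this
      have z2 : q ^ (-2 : ℤ) = q⁻¹ ^ 2 := by rw [zpow_neg, inv_pow]; rfl
      simp only [z2, zero_sub, zpow_neg, zpow_one] at this
      rw [qi, if_neg h]
      have h3 : q⁻¹ • (tbU n (lo i) (hi i) * tU n (hi i) (lo i)) = q⁻¹ • (tU n (hi i) (lo i) * tbU n (lo i) (hi i)
     + (q^2 - (q^2)⁻¹) • (tU n (hi i) (hi i) * tbU n (lo i) (lo i) - tbU n (hi i) (hi i) * tU n (lo i) (lo i))) := by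
        rw [← sub_eq_zero] at this ⊢
        rw [← this]
        have hq := q_ne
        match_scalars <;> field_simp <;> ring
      exact smul_right_injective _ (inv_ne_zero q_ne) h3
    · intro k hk
      split_ifs with h1
      · rw [tbU_lower n (lo i) k]
        · simp
        · rw [Fin.lt_def] at *; have : k.val ≠ (lo i).val := fun h => hk (Fin.ext h)
          simp only [lo_val, hi_val] at *; omega
      · rfl
    · intro k hk
      split_ifs with h1
      · rw [tbU_lower n k (hi i)]
        · simp
        · rw [Fin.lt_def] at *; have : k.val ≠ (hi i).val := fun h => hk (Fin.ext h)
          simp only [lo_val, hi_val] at *; omega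
      · rfl

theorem tb_kb (m : Fin (2*n)) (hm : m.val ≤ n) (i : Fin n) :
    tbU n (lo i) (hi i) * tbU n m m = (wt n m i)⁻¹ • (tbU n m m * tbU n (lo i) (hi i)) := by
  have e2 := (LT_b n).kx m hm i
  have w2 := wt_ne (n := n) m.val i.val
  have e2' : tbU n m m * tbU n (lo i) (hi i) = wt n m i • (tbU n (lo i) (hi i) * tbU n m m) := e2
  rw [e2', smul_smul, inv_mul_cancel₀ w2, one_smul]

/-- moving the Cartan parts -/
theorem sandwich (i j : Fin n) :
    tU n (hi i) (hi i) * (tU n (hi j) (lo j) * tbU n (lo i) (hi i)) * tbU n (lo j) (lo j)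
     = (wt n (i+1) j * (wt n j i)⁻¹) • (Fu n j * Eu n i) := by
  have hi' := i.isLt
  have hj' := j.isLt
  have e1 := (LT_t n).kx (hi i) (by simp only [hi_val]; omega) j
  have e2 := tb_kb (lo j) (by simp only [lo_val]; omega) i
  rw [← mul_assoc, e1, smul_mul_assoc, smul_mul_assoc, mul_assoc, e2, mul_smul_comm, smul_smul, Fu, Eu]
  rw [mul_assoc (tU n (hi j) _), mul_assoc (tU n (hi j) _), ← mul_assoc (tbU n _ _) (tU n _ _), bt_comm]
  simp only [mul_assoc, lo_val, hi_val]

theorem EF_off (i j : Fin n) (hij : i ≠ j) : Eu n i * Fu n j = dw n i j • (Fu n j * Eu n i) := by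
  have hi' := i.isLt
  have hj' := j.isLt
  have hne : i.val ≠ j.val := fun h => hij (Fin.ext h)
  have := sandwich i j
  have h1 : Eu n i * Fu n j = tU n (hi i) (hi i) * (tbU n (lo i) (hi i) * tU n (hi j) (lo j)) * tbU n (lo j) (lo j) := by
    simp only [Eu, Fu, mul_assoc]
  rw [h1, bt_off i j hij, mul_smul_comm, smul_mul_assoc, this, smul_smul]
  congr 1
  have hq := q_ne
  simp only [rw1, dw, wt]
  split_ifs <;> first | (exfalso; omega) | (field_simp)

theorem EF_diag (i : Fin n) : Eu n i * Fu n i = (qi n i ^2) • (Fu n i * Eu n i) + (qi n i - (qi n i)⁻¹) • (Ku n i ^ 2 - 1) := by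
  have hi' := i.isLt
  have := sandwich i i
  have h1 : Eu n i * Fu n i = tU n (hi i) (hi i) * (tbU n (lo i) (hi i) * tU n (hi i) (lo i)) * tbU n (lo i) (lo i) := by
    simp only [Eu, Fu, mul_assoc]
  rw [h1, bt_diag i, mul_add, add_mul, this]
  congr 1
  · congr 1
    have hq := q_ne
    simp only [wt, qi]
    split_ifs <;> first | (exfalso; omega) | (field_simp)
  · rw [mul_smul_comm, smul_mul_assoc]
    congr 1
    rw [mul_sub, sub_mul]
    congr 1
    · rw [pow_two, Ku]
      have hc := bt_comm (n := n) (lo i) (hi i)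
      simp only [mul_assoc]
      rw [← mul_assoc (tbU n _ _) (tU n _ _), hc]
      simp only [mul_assoc]
    · rw [← mul_assoc, t_tb, one_mul, t_tb]

theorem qi_sub_ne (i : Fin n) : qi n i - (qi n i)⁻¹ ≠ 0 := by
  unfold qi
  split_ifs
  · exact hq2
  · intro h
    have h1 : q^2 * q^2 = 1 := by
      have := sub_eq_zero.1 h
      nth_rewrite 2 [this]; exact mul_inv_cancel₀ (pow_ne_zero 2 q_ne)
    have h2 : (RatFunc.X : RatFunc ℂ) = algebraMap (Polynomial ℂ) _ Polynomial.X := (RatFunc.algebraMap_X).symm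
    rw [show q = algebraMap (Polynomial ℂ) _ Polynomial.X from h2, ← map_pow, ← map_mul, ← map_one (algebraMap (Polynomial ℂ) (RatFunc ℂ))] at h1
    have h3 := RatFunc.algebraMap_injective ℂ h1
    have := congrArg Polynomial.natDegree h3
    rw [← pow_add] at this
    simp at this

/-- normalized root vectors -/
def Fh (n : ℕ) (i : Fin n) : Usp n := (qi n i - (qi n i)⁻¹)⁻¹ • Fu n i
def Eh (n : ℕ) (i : Fin n) : Usp n := (qi n i - (qi n i)⁻¹)⁻¹ • Eu n i
def Bh (n : ℕ) (i : Fin n) : Usp n := Fh n i + Eh n i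
theorem Fh_qs (n : ℕ) : QS n (Fh n) := (Fu_qs n).smul _
theorem Eh_qs (n : ℕ) : QS n (Eh n) := (Eu_qs n).smul _

theorem hEF_off (i j : Fin n) (hij : i ≠ j) : Eh n i * Fh n j = dw n i j • (Fh n j * Eh n i) := by
  simp only [Eh, Fh, smul_mul_assoc, mul_smul_comm, EF_off i j hij]
  module
theorem hEF (i : Fin n) : Eh n i * Fh n i = (qi n i ^2) • (Fh n i * Eh n i) + (qi n i - (qi n i)⁻¹)⁻¹ • Ku n i ^ 2
    - (qi n i - (qi n i)⁻¹)⁻¹ • 1 := by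
  simp only [Eh, Fh, smul_mul_assoc, mul_smul_comm, EF_diag i, smul_add]
  have := qi_sub_ne i
  generalize hc : qi n i - (qi n i)⁻¹ = c at *
  match_scalars <;> field_simp

theorem ZF (i j : Fin n) : Ku n i ^ 2 * Fh n j = (dw n i j ^ 2) • (Fh n j * Ku n i ^ 2) := by
  simp only [Fh, mul_smul_comm, smul_mul_assoc, pow_two, mul_assoc, Ku_Fu]
  rw [← mul_assoc (Ku n i) (Fu n j), Ku_Fu]
  simp only [smul_mul_assoc, mul_assoc]
  module
theorem EZ (i j : Fin n) : Eh n j * Ku n i ^ 2 = (dw n i j ^ 2) • (Ku n i ^ 2 * Eh n j) := by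
  simp only [Eh, mul_smul_comm, smul_mul_assoc, pow_two]
  rw [← mul_assoc (Eu n j), Eu_Ku, smul_mul_assoc, mul_assoc, Eu_Ku]
  simp only [mul_smul_comm, mul_assoc]
  module

theorem dw_pair (p : F) (i j : Fin n) (h : dw n i j = p⁻¹) : (dw n i j)^2 = p⁻¹^2 := by rw [h]

theorem Bh_rel (x y : FB n) (h : iRel n x y) : FreeAlgebra.lift F (Bh n) x = FreeAlgebra.lift F (Bh n) y := by
  have hq := q_ne
  induction h with
  | comm i j h =>
    have main : ∀ i j : Fin n, (i:ℕ) + 2 ≤ j → Bh n i * Bh n j = Bh n j * Bh n i := by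
      intro i j h
      have e1 := (Fh_qs n).comm i j h
      have e2 := (Eh_qs n).comm i j h
      have hne : i ≠ j := by rintro rfl; omega
      have e3 := hEF_off i j hne
      have e4 := hEF_off j i hne.symm
      rw [dw_far j.isLt i.isLt (by omega), one_smul] at e3
      rw [dw_far i.isLt j.isLt (by omega), one_smul] at e4
      simp only [Bh, mul_add, add_mul, e1, e2, e3, e4]; abel
    simp only [map_mul, Bgen, FreeAlgebra.lift_ι_apply]
    rcases h with h | h
    · exact main i j h
    · exact (main j i h).symm
  | serre i j hadj hexc =>
    have hi' := i.isLt
    have hj' := j.isLt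
    have hne : i ≠ j := by rintro rfl; omega
    have key : dw n i j = (qi n i)⁻¹ ∧ dw n j i = (qi n i)⁻¹ := by
      unfold qi
      rcases hadj with h | h
      · rw [← h, dw_succ (by omega), dw_pred (by omega), if_pos (by omega)]; simp
      · by_cases h2 : j.val + 2 < n
        · rw [← h, dw_succ h2, dw_pred h2, if_pos (by omega)]; simp
        · rw [← h, dw_succ' (by omega), dw_pred' (by omega), if_neg (by omega)]; simp
    have key2 : dw n i i = qi n i ^ 2 := by
      unfold qi
      by_cases h2 : i.val + 1 < n
      · rw [dw_self h2, if_pos h2]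
      · rw [dw_self' (by omega), if_neg h2]; ring
    have z1 := ZF i i
    have z2 := ZF i j
    have z3 := EZ i i
    have z4 := EZ i j
    have f1 := hEF_off i j hne
    have f2 := hEF_off j i hne.symm
    rw [key.1] at z2 z4 f1
    rw [key.2] at f2
    rw [key2, ← pow_mul] at z1 z3
    have := iserre3 (qi n i) (qi_ne i) (qi_sub_ne i) (Fh n i) (Eh n i) (Ku n i ^ 2) (Fh n j) (Eh n j)
      (hEF i) f1 f2 z1 z2 z3 z4 ((Fh_qs n).serre i j hadj hexc) ((Eh_qs n).serre i j hadj hexc)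
    simp only [map_mul, map_add, map_sub, map_smul, map_pow, Bgen, FreeAlgebra.lift_ι_apply]
    exact this
  | quartic i j hi hj =>
    have hne : i ≠ j := by rintro rfl; omega
    have h : i.val + 1 = j.val := by omega
    have hqi : qi n i = q := by unfold qi; rw [if_pos (by omega)]
    have z1 := ZF i i
    have z2 := ZF i j
    have z3 := EZ i i
    have z4 := EZ i j
    have f1 := hEF_off i j hne
    have f2 := hEF_off j i hne.symm
    rw [← h, dw_succ' hi] at z2 z4 f1
    rw [← h, dw_pred' hi] at f2
    rw [← pow_mul] at z2 z4
    rw [dw_self (by omega), ← pow_mul] at z1 z3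
    have g := hEF i
    rw [hqi] at g
    have := iserre4 q q_ne hq2 (Fh n i) (Eh n i) (Ku n i ^ 2) (Fh n j) (Eh n j)
      g f1 f2 z1 z2 z3 z4 ((Fh_qs n).quartic i j hi hj) ((Eh_qs n).quartic i j hi hj)
    simp only [map_mul, map_add, map_sub, map_smul, map_pow, Bgen, FreeAlgebra.lift_ι_apply]
    exact this

def phi (n : ℕ) : UiCI n →ₐ[F] Usp n := RingQuot.liftAlgHom F ⟨FreeAlgebra.lift F (Bh n), fun {x y} h => Bh_rel x y h⟩

theorem phi_mk (x : FB n) : phi n (RingQuot.mkAlgHom F (iRel n) x) = FreeAlgebra.lift F (Bh n) x := by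
  simp [phi]

theorem phi_B (i : Fin n) : phi n (BU n i) = (qi n i - (qi n i)⁻¹)⁻¹ • s'gen n i := by
  rw [BU, phi_mk, Bgen, FreeAlgebra.lift_ι_apply, Bh, Fh, Eh, ← smul_add]; rfl

theorem phi_range : (phi n).range = U'tw n := by
  have h1 : (phi n).range = Algebra.adjoin F (Set.range (Bh n)) := by
    rw [Algebra.adjoin_range_eq_range_freeAlgebra_lift]
    ext y; constructor
    · rintro ⟨x, rfl⟩
      obtain ⟨x, rfl⟩ := RingQuot.mkAlgHom_surjective F (iRel n) x
      exact ⟨x, (phi_mk x).symm⟩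
    · rintro ⟨x, rfl⟩
      exact ⟨_, phi_mk x⟩
  have hB : ∀ i, Bh n i = (qi n i - (qi n i)⁻¹)⁻¹ • s'gen n i := by
    intro i; rw [Bh, Fh, Eh, ← smul_add]; rfl
  rw [h1, U'tw]
  apply le_antisymm
  · apply Algebra.adjoin_le
    rintro _ ⟨i, rfl⟩
    rw [SetLike.mem_coe, hB]
    exact Subalgebra.smul_mem _ (Algebra.subset_adjoin (Set.mem_range_self i)) _
  · apply Algebra.adjoin_le
    rintro _ ⟨i, rfl⟩
    have : s'gen n i = (qi n i - (qi n i)⁻¹) • Bh n i := by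
      rw [hB, smul_smul, mul_inv_cancel₀ (qi_sub_ne i), one_smul]
    rw [SetLike.mem_coe, this]
    exact Subalgebra.smul_mem _ (Algebra.subset_adjoin (Set.mem_range_self i)) _
end

section
set_option synthInstance.maxHeartbeats 1000000
set_option maxHeartbeats 1000000
set_option linter.unusedSimpArgs false
set_option linter.unusedVariables false
local instance natAlgF5 : Algebra ℕ F := Semiring.toNatAlgebra
local instance intAlgF5 : Algebra ℤ F := Ring.toIntAlgebra _
section
variable {n : ℕ}
open Matrix Kronecker

abbrev Ix (n : ℕ) := Fin (2*n)

/-- the R-matrix with a general parameter -/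
def Rz (z : F) (n : ℕ) : Matrix (Ix n × Ix n) (Ix n × Ix n) F := fun p s =>
  (if p.1 = s.1 ∧ p.2 = s.2 then
      z ^ ((if p.1 = p.2 then (1:ℤ) else 0) - (if p.1 = pr n p.2 then (1:ℤ) else 0)) else 0)
  + (if p.1 < p.2 ∧ s.1 = p.2 ∧ s.2 = p.1 then z - z⁻¹ else 0)
  - (if p.1 < s.1 ∧ p.2 = pr n p.1 ∧ s.2 = pr n s.1 then
      (z - z⁻¹) * z ^ (bar n s.1 - bar n p.1) * eps n p.1 * eps n s.1 else 0)

theorem Rz_q : Rz q n = Rm n := rfl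

def W (a b : Ix n) : Ix n × Ix n → F := Pi.single (a,b) 1
def th (z : F) (a : Ix n) : F := z ^ (- bar n a) * eps n a
def Cv (z : F) (a : Ix n) : Ix n × Ix n → F := ∑ l, if l < a then th z l • W l (pr n l) else 0
def dg (z : F) (a b : Ix n) : F := z ^ ((if a = b then (1:ℤ) else 0) - (if a = pr n b then (1:ℤ) else 0))

theorem th_ne {z : F} (hz : z ≠ 0) (a : Ix n) : th z a ≠ 0 := by
  unfold th eps; refine mul_ne_zero (zpow_ne_zero _ hz) ?_; split_ifs <;> simp

theorem W_apply (a b x y : Ix n) : W a b (x,y) = if x = a ∧ y = b then 1 else 0 := by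
  simp [W, Pi.single_apply, Prod.ext_iff]

theorem Cv_apply (z : F) (a x y : Ix n) : Cv z a (x,y) = if x < a ∧ y = pr n x then th z x else 0 := by
  unfold Cv
  rw [Finset.sum_apply, Fintype.sum_eq_single x]
  · by_cases h : x < a
    · simp [h, W_apply]
    · simp [h]
  · intro l hl
    split_ifs
    · simp [W_apply, hl.symm]
    · rfl

theorem Rz_col {z : F} (hz : z ≠ 0) (a b : Ix n) :
    Rz z n *ᵥ W a b = dg z a b • W a b + (if b < a then z - z⁻¹ else 0) • W b a
      - (if b = pr n a then (z - z⁻¹) * (th z a)⁻¹ else 0) • Cv z a := by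
  funext ⟨x, y⟩
  rw [W, Matrix.mulVec_single_one]
  simp only [Matrix.col_apply, Pi.add_apply, Pi.sub_apply, Pi.smul_apply, W_apply, Cv_apply, Rz, smul_eq_mul]
  congr 1
  · congr 1
    · by_cases h : x = a ∧ y = b
      · obtain ⟨rfl, rfl⟩ := h; simp [dg]
      · simp [h]
    · by_cases h : x = b ∧ y = a
      · obtain ⟨rfl, rfl⟩ := h; simp
      · rw [if_neg h, if_neg (by tauto)]; simp
  · by_cases h : b = pr n a
    · subst h
      simp only [and_true, if_true]
      by_cases h : x < a ∧ y = pr n x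
      · rw [if_pos h, if_pos h, th, th, sub_eq_add_neg (bar n a), zpow_add₀ hz, _root_.zpow_neg, _root_.zpow_neg]
        have : (eps n a)⁻¹ = eps n a := inv_eq_of_mul_eq_one_right (eps_sq n a)
        rw [mul_inv, this, inv_inv]; ring
      · rw [if_neg h, if_neg h]; simp
    · simp [h]

def ph (i : Fin n) (a : Ix n) : F := if a = hi i then -1 else if a = pr n (lo i) then 1 else 0
def sg (i : Fin n) (a : Ix n) : Ix n := if a = hi i then lo i else pr n (hi i)
def zi (z : F) (i : Fin n) : F := if (i:ℕ) + 1 < n then z else z^2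
def ka (z : F) (i : Fin n) (a : Ix n) : F := if a = hi i ∨ a = pr n (lo i) then zi z i
  else if a = lo i ∨ a = pr n (hi i) then (zi z i)⁻¹ else 1

def fm (i : Fin n) : Matrix (Ix n) (Ix n) F := fun x a => if x = sg i a then ph i a else 0
def km (z : F) (i : Fin n) : Matrix (Ix n) (Ix n) F := Matrix.diagonal (ka z i)
def dl (f k : Matrix (Ix n) (Ix n) F) : Matrix (Ix n × Ix n) (Ix n × Ix n) F := f ⊗ₖ 1 + k ⊗ₖ f
def dop (f k : Matrix (Ix n) (Ix n) F) : Matrix (Ix n × Ix n) (Ix n × Ix n) F := 1 ⊗ₖ f + f ⊗ₖ k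

theorem dl_W (z : F) (i : Fin n) (a b : Ix n) : dl (fm i) (km z i) *ᵥ W a b =
    ph i a • W (sg i a) b + (ka z i a * ph i b) • W a (sg i b) := by
  funext ⟨x, y⟩
  rw [W, Matrix.mulVec_single_one]
  simp only [Matrix.col_apply, Pi.add_apply, Pi.smul_apply, W_apply, smul_eq_mul, dl, Matrix.add_apply, Matrix.kroneckerMap_apply,
    fm, km, Matrix.one_apply, Matrix.diagonal_apply]
  congr 1
  · by_cases h1 : x = sg i a <;> by_cases h2 : y = b <;> simp [h1, h2]
  · by_cases h1 : x = a <;> by_cases h2 : y = sg i b <;> simp [h1, h2]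

theorem dop_W (z : F) (i : Fin n) (a b : Ix n) : dop (fm i) (km z i) *ᵥ W a b =
    ph i b • W a (sg i b) + (ph i a * ka z i b) • W (sg i a) b := by
  funext ⟨x, y⟩
  rw [W, Matrix.mulVec_single_one]
  simp only [Matrix.col_apply, Pi.add_apply, Pi.smul_apply, W_apply, smul_eq_mul, dop, Matrix.add_apply, Matrix.kroneckerMap_apply,
    fm, km, Matrix.one_apply, Matrix.diagonal_apply]
  congr 1
  · by_cases h1 : x = a <;> by_cases h2 : y = sg i b <;> simp [h1, h2]
  · by_cases h1 : x = sg i a <;> by_cases h2 : y = b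
    · simp [h1, h2]
    · simp [h1, h2]
    · simp [h1, h2]
    · simp [h1, h2]

end
end

section
set_option synthInstance.maxHeartbeats 1000000
set_option maxHeartbeats 1000000
set_option linter.unusedSimpArgs false
set_option linter.unusedVariables false
local instance natAlgF6 : Algebra ℕ F := Semiring.toNatAlgebra
local instance intAlgF6 : Algebra ℤ F := Ring.toIntAlgebra _
section
variable {n : ℕ}
open Matrix Kronecker

theorem Cv_succ (z : F) (a b : Ix n) (h : b.val = a.val + 1) : Cv z b = Cv z a + th z a • W a (pr n a) := by
  funext ⟨x, y⟩
  simp only [Cv_apply, Pi.add_apply, Pi.smul_apply, W_apply, smul_eq_mul, Fin.lt_def]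
  by_cases hy : y = pr n x
  · by_cases hx : x = a
    · subst hx; simp [hy, h]
    · have : x.val ≠ a.val := fun h => hx (Fin.ext h)
      simp only [hy, hx, false_and, if_false, mul_zero, add_zero, and_true]
      have : x.val < b.val ↔ x.val < a.val := by omega
      simp only [this]
  · have : ¬ (x = a ∧ y = pr n a) := by rintro ⟨rfl, h⟩; exact hy h
    simp [hy, this]

theorem mulVec_ite0 {m : Type*} [Fintype m] (M : Matrix m m F) (c : Prop) [Decidable c] (v : m → F) :
   M *ᵥ (if c then v else 0) = if c then M *ᵥ v else 0 := by split_ifs <;> simp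

theorem th_step (z : F) (hz : z ≠ 0) (a b : Ix n) (h : b.val = a.val + 1) (hn : b.val ≠ n) : th z b = z * th z a := by
  unfold th bar eps
  by_cases h1 : b.val < n
  · rw [if_pos h1, if_pos h1, if_pos (by omega), if_pos (by omega), h, ← mul_assoc, ← zpow_one_add₀ hz]
    congr 2; push_cast; ring
  · rw [if_neg h1, if_neg h1, if_neg (by omega), if_neg (by omega), h, ← mul_assoc, ← zpow_one_add₀ hz]
    congr 2; push_cast; ring
theorem th_mid (z : F) (hz : z ≠ 0) (a b : Ix n) (h : b.val = a.val + 1) (hn : b.val = n) : th z b = -z^2 * th z a := by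
  unfold th bar eps
  rw [if_neg (by omega), if_neg (by omega), if_pos (by omega), if_pos (by omega), h, mul_one, ← zpow_natCast, neg_mul, ← zpow_add₀ hz, mul_neg, mul_one]
  congr 2; push_cast; ring

/-- combinatorial data for a non-last node -/
structure Nd (P S Q T : Ix n) : Prop where
  v1 : S.val = P.val + 1
  v2 : Q.val = 2*n - 1 - S.val
  v3 : T.val = 2*n - 1 - P.val
  v4 : S.val < n
  pP : pr n P = T
  pS : pr n S = Q
  pQ : pr n Q = S
  pT : pr n T = P

theorem mkNd (i : Fin n) (h : i.val + 1 < n) : Nd (lo i) (hi i) (pr n (hi i)) (pr n (lo i)) :=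
  ⟨by simp, rfl, rfl, by simpa, rfl, rfl, pr_pr _ _, pr_pr _ _⟩

section
variable {P S Q T : Ix n} (h : Nd P S Q T)
include h
theorem Nd.PS : P ≠ S := fun e => by have := congrArg Fin.val e; have := h.v1; have := h.v2; have := h.v3; have := h.v4; omega
theorem Nd.PQ : P ≠ Q := fun e => by have := congrArg Fin.val e; have := h.v1; have := h.v2; have := h.v3; have := h.v4; omega
theorem Nd.PT : P ≠ T := fun e => by have := congrArg Fin.val e; have := h.v1; have := h.v2; have := h.v3; have := h.v4; omega
theorem Nd.SQ : S ≠ Q := fun e => by have := congrArg Fin.val e; have := h.v1; have := h.v2; have := h.v3; have := h.v4; omega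
theorem Nd.ST : S ≠ T := fun e => by have := congrArg Fin.val e; have := h.v1; have := h.v2; have := h.v3; have := h.v4; omega
theorem Nd.QT : Q ≠ T := fun e => by have := congrArg Fin.val e; have := h.v1; have := h.v2; have := h.v3; have := h.v4; omega
theorem Nd.lPS : P < S := by rw [Fin.lt_def]; have := h.v1; have := h.v2; have := h.v3; have := h.v4; omega
theorem Nd.lPQ : P < Q := by rw [Fin.lt_def]; have := h.v1; have := h.v2; have := h.v3; have := h.v4; omega
theorem Nd.lPT : P < T := by rw [Fin.lt_def]; have := h.v1; have := h.v2; have := h.v3; have := h.v4; omega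
theorem Nd.lSQ : S < Q := by rw [Fin.lt_def]; have := h.v1; have := h.v2; have := h.v3; have := h.v4; omega
theorem Nd.lST : S < T := by rw [Fin.lt_def]; have := h.v1; have := h.v2; have := h.v3; have := h.v4; omega
theorem Nd.lQT : Q < T := by rw [Fin.lt_def]; have := h.v1; have := h.v2; have := h.v3; have := h.v4; omega
end

section
variable {z : F} {i : Fin n}

theorem dopC (hz : z ≠ 0) (hi' : i.val + 1 < n) {P S Q T : Ix n} (h : Nd P S Q T) 
   (eP : lo i = P) (eS : hi i = S) (m : ℕ) : ∀ (hm : m < 2*n), dop (fm i) (km z i) *ᵥ Cv z ⟨m, hm⟩ =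
   (if m = S.val then th z P else 0) • W P Q - (if m = T.val then th z Q else 0) • W Q P := by
  have v1 := h.v1; have v2 := h.v2; have v3 := h.v3; have v4 := h.v4
  have t1 := th_step z hz P S (by omega) (by omega)
  have t2 := th_step z hz Q T (by omega) (by omega)
  induction m with
  | zero => 
    intro hm
    rw [if_neg (by omega), if_neg (by omega)]
    have : Cv z (⟨0, hm⟩ : Ix n) = 0 := by
      funext ⟨x, y⟩; rw [Cv_apply, if_neg]; rfl
      rw [Fin.lt_def]; simp
    rw [this]; simp
  | succ m ih =>
    intro hm
    rw [Cv_succ z ⟨m, by omega⟩ ⟨m+1, hm⟩ rfl, mulVec_add, mulVec_smul, ih (by omega), dop_W]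
    by_cases c1 : m = P.val
    · have : (⟨m, by omega⟩ : Ix n) = P := Fin.ext c1
      rw [this, if_pos (show m+1 = S.val by omega), if_neg (by omega), if_neg (by omega), if_neg (by omega)]
      simp [ph, sg, ka, eP, eS, h.pP, h.pS, h.PS, h.PS.symm, h.ST.symm, h.PT]
    by_cases c2 : m = S.val
    · have : (⟨m, by omega⟩ : Ix n) = S := Fin.ext c2
      rw [this, if_pos c2, if_neg (by omega), if_neg (by omega), if_neg (by omega), t1]
      simp [ph, sg, ka, eP, eS, zi, hi', h.pP, h.pS, h.PS, h.PS.symm, h.SQ.symm, h.QT, smul_smul]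
      field_simp; simp
    by_cases c3 : m = Q.val
    · have : (⟨m, by omega⟩ : Ix n) = Q := Fin.ext c3
      rw [this, if_neg (by omega), if_neg (by omega), if_neg (by omega), if_pos (by omega)]
      simp [ph, sg, ka, eP, eS, zi, hi', h.pP, h.pS, h.pQ, h.PS, h.PS.symm, h.SQ.symm, h.QT, smul_smul]
    by_cases c4 : m = T.val
    · have : (⟨m, by omega⟩ : Ix n) = T := Fin.ext c4
      rw [this, if_neg (by omega), if_pos (by omega), if_neg (by omega), if_neg (by omega), t2]
      simp [ph, sg, ka, eP, eS, zi, hi', h.pP, h.pS, h.pQ, h.pT, h.PS, h.PS.symm, h.SQ.symm, h.QT, h.PT, h.ST.symm, smul_smul]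
      field_simp; simp
    · have d1 : (⟨m, by omega⟩ : Ix n) ≠ S := fun e => c2 (congrArg Fin.val e)
      have d2 : (⟨m, by omega⟩ : Ix n) ≠ T := fun e => c4 (congrArg Fin.val e)
      have d3 : pr n (⟨m, by omega⟩ : Ix n) ≠ S := fun e => c3 (by have := congrArg Fin.val e; rw [pr_val] at this; simp only at this; omega)
      have d4 : pr n (⟨m, by omega⟩ : Ix n) ≠ T := fun e => c1 (by have := congrArg Fin.val e; rw [pr_val] at this; simp only at this; omega)
      rw [if_neg (by omega), if_neg (by omega), if_neg (by omega), if_neg (by omega)]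
      simp [ph, eP, eS, h.pP, d1, d2, d3, d4]
end
end
end

section
set_option synthInstance.maxHeartbeats 1000000
set_option maxHeartbeats 4000000
set_option linter.unusedSimpArgs false
set_option linter.unusedVariables false
local instance natAlgF7 : Algebra ℕ F := Semiring.toNatAlgebra
local instance intAlgF7 : Algebra ℤ F := Ring.toIntAlgebra _
section
variable {n : ℕ}
open Matrix Kronecker

theorem col_form (z : F) (hz : z ≠ 0) (i : Fin n) 
   (H : ∀ a b : Ix n, ph i a • (Rz z n *ᵥ W (sg i a) b) + (ka z i a * ph i b) • (Rz z n *ᵥ W a (sg i b))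
     = dg z a b • (ph i b • W a (sg i b) + (ph i a * ka z i b) • W (sg i a) b)
     + (if b < a then z - z⁻¹ else 0) • (ph i a • W b (sg i a) + (ph i b * ka z i a) • W (sg i b) a)
     - (if b = pr n a then (z - z⁻¹) * (th z a)⁻¹ else 0) • (dop (fm i) (km z i) *ᵥ Cv z a)) :
   Rz z n * dl (fm i) (km z i) = dop (fm i) (km z i) * Rz z n := by
  apply Matrix.ext_of_mulVec_single
  rintro ⟨a, b⟩
  have e : (Pi.single (a,b) 1 : Ix n × Ix n → F) = W a b := rfl
  rw [e, ← mulVec_mulVec, ← mulVec_mulVec, dl_W, mulVec_add, mulVec_smul, mulVec_smul, H, Rz_col hz a b, mulVec_sub, mulVec_add, mulVec_smul, mulVec_smul, mulVec_smul, dop_W, dop_W]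

theorem inter_nl (z : F) (hz : z ≠ 0) (i : Fin n) (hi' : i.val + 1 < n) :
   Rz z n * dl (fm i) (km z i) = dop (fm i) (km z i) * Rz z n := by
  apply col_form z hz
  have h := mkNd i hi'
  have eP : lo i = lo i := rfl
  have eS : hi i = hi i := rfl
  have eQ : pr n (hi i) = pr n (hi i) := rfl
  have eT : pr n (lo i) = pr n (lo i) := rfl
  generalize hP : lo i = P at h
  generalize hS : hi i = S at h
  generalize pr n S = Q at h
  generalize pr n P = T at h
  have v1 := h.v1; have v2 := h.v2; have v3 := h.v3; have v4 := h.v4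
  have t1 := th_step z hz P S (by omega) (by omega)
  have t2 := th_step z hz Q T (by omega) (by omega)
  have n1 := th_ne hz P
  have n2 := th_ne hz Q
  have dC := fun a : Ix n => dopC hz hi' h hP hS a.val a.isLt
  have cS := Cv_succ z P S (by omega)
  have cT := Cv_succ z Q T (by omega)
  rw [h.pP] at cS
  rw [h.pQ] at cT
  have pphS : ph i S = -1 := by simp [ph, hS]
  have pphT : ph i T = 1 := by simp [ph, hS, hP, h.pP, h.ST.symm]
  have pph0 : ∀ a, a ≠ S → a ≠ T → ph i a = 0 := by intro a h1 h2; simp [ph, hS, hP, h.pP, h1, h2]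
  have sgS : sg i S = P := by simp [sg, hS, hP]
  have sgT : sg i T = Q := by simp [sg, hS, hP, h.ST.symm, h.pS]
  have zii : zi z i = z := by simp [zi, hi']
  have kS : ka z i S = z := by simp [ka, hS, zii]
  have kT : ka z i T = z := by simp [ka, hP, h.pP, zii]
  have kP : ka z i P = z⁻¹ := by simp [ka, hP, hS, h.pP, h.PS, h.PT, zii]
  have kQ : ka z i Q = z⁻¹ := by simp [ka, hP, hS, h.pP, h.pS, h.SQ.symm, h.QT, zii]
  have k0 : ∀ a, a ≠ P → a ≠ S → a ≠ Q → a ≠ T → ka z i a = 1 := by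
    intro a h1 h2 h3 h4; simp [ka, hP, hS, h.pP, h.pS, *]
  have dPP : dg z P P = z := by simp [dg, h.pP, h.PT]
  have four : ∀ a : Ix n, a = P ∨ a = S ∨ a = Q ∨ a = T ∨ (a ≠ P ∧ a ≠ S ∧ a ≠ Q ∧ a ≠ T) := by intro a; tauto
  have gen : ∀ g : Ix n, (g ≠ P ∧ g ≠ S ∧ g ≠ Q ∧ g ≠ T) → ((g < S ↔ g < P) ∧ (g < T ↔ g < Q) ∧ (S < g ↔ P < g) ∧ (T < g ↔ Q < g)) ∧
      (P ≠ g ∧ S ≠ g ∧ Q ≠ g ∧ T ≠ g) ∧ (pr n g ≠ P ∧ pr n g ≠ S ∧ pr n g ≠ Q ∧ pr n g ≠ T) ∧ (P ≠ pr n g ∧ S ≠ pr n g ∧ Q ≠ pr n g ∧ T ≠ pr n g) ∧ g.val ≠ S.val ∧ g.val ≠ T.val := by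
    rintro g ⟨g1, g2, g3, g4⟩
    have w1 : g.val ≠ P.val := fun h => g1 (Fin.ext h)
    have w2 : g.val ≠ S.val := fun h => g2 (Fin.ext h)
    have w3 : g.val ≠ Q.val := fun h => g3 (Fin.ext h)
    have w4 : g.val ≠ T.val := fun h => g4 (Fin.ext h)
    have := g.isLt
    simp only [Fin.lt_def, Fin.ext_iff, pr_val, ne_eq]
    omega
  have PS := h.PS; have PQ := h.PQ; have PT := h.PT; have SQ := h.SQ; have ST := h.ST; have QT := h.QT
  have lPS := h.lPS; have lPQ := h.lPQ; have lPT := h.lPT; have lSQ := h.lSQ; have lST := h.lST; have lQT := h.lQT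
  have vne : S.val ≠ T.val ∧ P.val ≠ S.val ∧ P.val ≠ T.val ∧ Q.val ≠ S.val ∧ Q.val ≠ T.val ∧ T.val ≠ S.val := by omega
  obtain ⟨u1,u2,u3,u4,u5, u6⟩ := vne
  have p1 := h.pP; have p2 := h.pS; have p3 := h.pQ; have p4 := h.pT
  intro a b
  simp only [Rz_col hz, dC]
  rcases four a with rfl | rfl | rfl | rfl | ha
  all_goals rcases four b with rfl | rfl | rfl | rfl | hb
  all_goals try (have GA := gen _ ha; obtain ⟨⟨_,_,_,_⟩,⟨_,_,_,_⟩,⟨_,_,_,_⟩,⟨_,_,_,_⟩,_,_⟩ := GA; obtain ⟨_,_,_,_⟩ := ha; clear gen)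
  all_goals try (have GB := gen _ hb; obtain ⟨⟨_,_,_,_⟩,⟨_,_,_,_⟩,⟨_,_,_,_⟩,⟨_,_,_,_⟩,_,_⟩ := GB; obtain ⟨_,_,_,_⟩ := hb; clear gen)
  all_goals clear four dC v1 v2 v3 v4
  all_goals simp only [dg, pphS, pphT, pph0, sgS, sgT, kS, kT, kP, kQ, k0, PS, PQ, PT, SQ, ST, QT, PS.symm, PQ.symm, PT.symm, SQ.symm, ST.symm, QT.symm,
     lPS, lPQ, lPT, lSQ, lST, lQT, lPS.not_gt, lPQ.not_gt, lPT.not_gt, lSQ.not_gt, lST.not_gt, lQT.not_gt, lt_irrefl, p1, p2, p3, p4, u1, u2, u3, u4, u5, u6,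
     cS, cT, t1, t2, *, if_true, if_false, ne_eq, not_true, not_false_iff, sub_zero, zero_sub, sub_self, zpow_zero, zpow_one, _root_.zpow_neg, zero_smul, one_smul, mul_zero, zero_mul, smul_zero, add_zero, zero_add, neg_smul, mul_one, one_mul]
  all_goals try (match_scalars <;> field_simp <;> ring)
end
end

section
set_option synthInstance.maxHeartbeats 1000000
set_option maxHeartbeats 4000000
set_option linter.unusedSimpArgs false
set_option linter.unusedVariables false
local instance natAlgF8 : Algebra ℕ F := Semiring.toNatAlgebra
local instance intAlgF8 : Algebra ℤ F := Ring.toIntAlgebra _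
section
variable {n : ℕ}
open Matrix Kronecker

theorem dopC_last {z : F} {i : Fin n} (hz : z ≠ 0) (hi' : ¬ i.val + 1 < n) {P S : Ix n} (v1 : P.val + 1 = n) (v2 : S.val = n)
   (p1 : pr n P = S) (p2 : pr n S = P)
   (eP : lo i = P) (eS : hi i = S) (m : ℕ) : ∀ (hm : m < 2*n), dop (fm i) (km z i) *ᵥ Cv z ⟨m, hm⟩ =
   - ((if m = S.val then th z P else 0) • W P P) := by
  have t1 := th_mid z hz P S (by omega) (by omega)
  have PS : P ≠ S := fun e => by have := congrArg Fin.val e; omega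
  induction m with
  | zero => 
    intro hm
    rw [if_neg (by omega)]
    have : Cv z (⟨0, hm⟩ : Ix n) = 0 := by
      funext ⟨x, y⟩; rw [Cv_apply, if_neg]; rfl
      rw [Fin.lt_def]; simp
    rw [this]; simp
  | succ m ih =>
    intro hm
    rw [Cv_succ z ⟨m, by omega⟩ ⟨m+1, hm⟩ rfl, mulVec_add, mulVec_smul, ih (by omega), dop_W]
    by_cases c1 : m = P.val
    · have : (⟨m, by omega⟩ : Ix n) = P := Fin.ext c1
      rw [this, if_pos (show m+1 = S.val by omega), if_neg (by omega)]
      simp [ph, sg, ka, eP, eS, p1, p2, PS, PS.symm]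
    by_cases c2 : m = S.val
    · have : (⟨m, by omega⟩ : Ix n) = S := Fin.ext c2
      rw [this, if_pos c2, if_neg (by omega), t1]
      simp [ph, sg, ka, eP, eS, zi, hi', p1, p2, PS, PS.symm, smul_smul]
      field_simp; simp
    · have d1 : (⟨m, by omega⟩ : Ix n) ≠ S := fun e => c2 (congrArg Fin.val e)
      have d3 : pr n (⟨m, by omega⟩ : Ix n) ≠ S := fun e => c1 (by have := congrArg Fin.val e; rw [pr_val] at this; simp only at this; omega)
      rw [if_neg (by omega), if_neg (by omega)]
      simp [ph, eP, eS, p1, d1, d3]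

theorem inter_last (z : F) (hz : z ≠ 0) (i : Fin n) (hi' : ¬ i.val + 1 < n) :
   Rz z n * dl (fm i) (km z i) = dop (fm i) (km z i) * Rz z n := by
  apply col_form z hz
  have hil := i.isLt
  have v1 : (lo i).val + 1 = n := by rw [lo_val]; omega
  have v2 : (hi i).val = n := by rw [hi_val]; omega
  have p1 : pr n (lo i) = hi i := by apply Fin.ext; rw [pr_val]; omega
  have p2 : pr n (hi i) = lo i := by apply Fin.ext; rw [pr_val]; omega
  generalize hP : lo i = P at *
  generalize hS : hi i = S at *
  have t1 := th_mid z hz P S (by omega) (by omega)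
  have n1 := th_ne hz P
  have dC := fun a : Ix n => dopC_last hz hi' v1 v2 p1 p2 hP hS a.val a.isLt
  have cS := Cv_succ z P S (by omega)
  rw [p1] at cS
  have PS : P ≠ S := fun e => by have := congrArg Fin.val e; omega
  have lPS : P < S := by rw [Fin.lt_def]; omega
  have pphS : ph i S = -1 := by simp [ph, hS]
  have pph0 : ∀ a, a ≠ S → ph i a = 0 := by intro a h1; simp [ph, hS, hP, p1, h1]
  have sgS : sg i S = P := by simp [sg, hS, hP]
  have zii : zi z i = z^2 := by simp [zi, hi']
  have kS : ka z i S = z^2 := by simp [ka, hS, zii]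
  have kP : ka z i P = (z^2)⁻¹ := by simp [ka, hP, hS, p1, PS, zii]
  have k0 : ∀ a, a ≠ P → a ≠ S → ka z i a = 1 := by
    intro a h1 h2; simp [ka, hP, hS, p1, p2, *]
  have four : ∀ a : Ix n, a = P ∨ a = S ∨ (a ≠ P ∧ a ≠ S) := by intro a; tauto
  have gen : ∀ g : Ix n, (g ≠ P ∧ g ≠ S) → ((g < S ↔ g < P) ∧ (S < g ↔ P < g)) ∧
      (P ≠ g ∧ S ≠ g) ∧ (pr n g ≠ P ∧ pr n g ≠ S) ∧ (P ≠ pr n g ∧ S ≠ pr n g) ∧ g.val ≠ S.val := by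
    rintro g ⟨g1, g2⟩
    have w1 : g.val ≠ P.val := fun h => g1 (Fin.ext h)
    have w2 : g.val ≠ S.val := fun h => g2 (Fin.ext h)
    have := g.isLt
    simp only [Fin.lt_def, Fin.ext_iff, pr_val, ne_eq]
    omega
  have u1 : P.val ≠ S.val := by omega
  intro a b
  simp only [Rz_col hz, dC]
  rcases four a with rfl | rfl | ha
  all_goals rcases four b with rfl | rfl | hb
  all_goals try (have GA := gen _ ha; obtain ⟨⟨_,_⟩,⟨_,_⟩,⟨_,_⟩,⟨_,_⟩,_⟩ := GA; obtain ⟨_,_⟩ := ha; clear gen)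
  all_goals try (have GB := gen _ hb; obtain ⟨⟨_,_⟩,⟨_,_⟩,⟨_,_⟩,⟨_,_⟩,_⟩ := GB; obtain ⟨_,_⟩ := hb; clear gen)
  all_goals clear four dC v1 v2
  all_goals simp only [dg, pphS, pph0, sgS, kS, kP, k0, PS, PS.symm,
     lPS, lPS.not_gt, lt_irrefl, p1, p2, u1,
     cS, t1, *, if_true, if_false, ne_eq, not_true, not_false_iff, sub_zero, zero_sub, sub_self, zpow_zero, zpow_one, _root_.zpow_neg, zero_smul, one_smul, mul_zero, zero_mul, smul_zero, add_zero, zero_add, neg_smul, neg_zero, mul_one, one_mul]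
  all_goals try (match_scalars <;> field_simp <;> ring)

theorem inter_f (z : F) (hz : z ≠ 0) (i : Fin n) :
   Rz z n * dl (fm i) (km z i) = dop (fm i) (km z i) * Rz z n := by
  by_cases h : i.val + 1 < n
  · exact inter_nl z hz i h
  · exact inter_last z hz i h

/-- conjugation by the flip -/
def sw : Matrix (Ix n × Ix n) (Ix n × Ix n) F → Matrix (Ix n × Ix n) (Ix n × Ix n) F := fun M => fun p s => M (p.2,p.1) (s.2,s.1)
theorem sw_mul (A B : Matrix (Ix n × Ix n) (Ix n × Ix n) F) : sw (A * B) = sw A * sw B := by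
  funext p s
  simp only [sw, Matrix.mul_apply]
  exact (Fintype.sum_equiv (Equiv.prodComm _ _) _ _ (fun _ => rfl))

theorem Rz_symm (z : F) (i a k c : Ix n) : Rz z n (i, a) (k, c) = Rz z n (c, k) (a, i) := by
  simp only [Rz]
  congr 1
  · congr 1
    · by_cases h : i = k ∧ a = c
      · obtain ⟨rfl, rfl⟩ := h
        simp only [and_self, if_true]
        congr 1
        simp only [eq_comm (a := i) (b := a), eq_pr_comm (i := i) (j := a)]
      · rw [if_neg h, if_neg (by tauto)]
    · congr 1
      simp only [eq_iff_iff]; constructor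
      · rintro ⟨h1, rfl, rfl⟩; exact ⟨h1, rfl, rfl⟩
      · rintro ⟨h1, rfl, rfl⟩; exact ⟨h1, rfl, rfl⟩
  · by_cases h : i < k ∧ a = pr n i ∧ c = pr n k
    · obtain ⟨h1, rfl, rfl⟩ := h
      rw [if_pos ⟨h1, rfl, rfl⟩, if_pos ⟨(pr_lt _ _ _).2 h1, (pr_pr _ _).symm, (pr_pr _ _).symm⟩]
      simp only [bar_pr, eps_pr]
      rw [show -bar n i - -bar n k = bar n k - bar n i by ring]; ring
    · rw [if_neg h, if_neg]
      rintro ⟨h1, h2, h3⟩; apply h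
      subst h2; subst h3
      simp only [pr_lt, pr_pr] at *; tauto

theorem sw_Rz (z : F) : sw (Rz z n)ᵀ = Rz z n := by
  funext ⟨a, b⟩ ⟨c, d⟩
  simp only [sw, Matrix.transpose_apply]
  exact Rz_symm z _ _ _ _

theorem inter_e (z : F) (hz : z ≠ 0) (i : Fin n) :
   Rz z n * dl (fm i)ᵀ (km z i) = dop (fm i)ᵀ (km z i) * Rz z n := by
  have h := congrArg (fun M => sw Mᵀ) (inter_f z hz i)
  simp only [Matrix.transpose_mul, sw_mul, sw_Rz] at h
  have e1 : sw (dl (fm i) (km z i))ᵀ = dop (fm i)ᵀ (km z i) := by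
    funext ⟨a, b⟩ ⟨c, d⟩
    simp only [sw, dl, dop, km, Matrix.one_apply, Matrix.diagonal_apply, Matrix.transpose_apply, Matrix.add_apply, Matrix.kroneckerMap_apply]
    by_cases h1 : a = c <;> by_cases h2 : b = d <;> simp [h1, h2, mul_comm, eq_comm (a := c), eq_comm (a := d)]
  have e2 : sw (dop (fm i) (km z i))ᵀ = dl (fm i)ᵀ (km z i) := by
    funext ⟨a, b⟩ ⟨c, d⟩
    simp only [sw, dl, dop, km, Matrix.one_apply, Matrix.diagonal_apply, Matrix.transpose_apply, Matrix.add_apply, Matrix.kroneckerMap_apply]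
    by_cases h1 : a = c <;> by_cases h2 : b = d <;> simp [h1, h2, mul_comm, eq_comm (a := c), eq_comm (a := d)]
  rw [e1, e2] at h
  exact h.symm
end
end

section
set_option synthInstance.maxHeartbeats 1000000
set_option maxHeartbeats 4000000
set_option linter.unusedSimpArgs false
set_option linter.unusedVariables false
local instance natAlgF9 : Algebra ℕ F := Semiring.toNatAlgebra
local instance intAlgF9 : Algebra ℤ F := Ring.toIntAlgebra _
section
variable {n : ℕ}
open Matrix Kronecker

def tp {J K : Type*} (u : J → F) (w : K → F) : J × K → F := fun p => u p.1 * w p.2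
def dt (a : Ix n) : Ix n → F := Pi.single a 1

theorem kron_tp {J K : Type*} [Fintype J] [Fintype K] (A : Matrix J J F) (B : Matrix K K F) (u : J → F) (w : K → F) :
    (A ⊗ₖ B) *ᵥ tp u w = tp (A *ᵥ u) (B *ᵥ w) := by
  funext ⟨x, y⟩
  simp only [Matrix.mulVec, dotProduct, Matrix.kroneckerMap_apply, tp, Fintype.sum_prod_type, Finset.sum_mul_sum]
  apply Finset.sum_congr rfl; intro a _
  apply Finset.sum_congr rfl; intro b _; ring

theorem tp_add_r {J K : Type*} (u : J → F) (w w' : K → F) : tp u (w + w') = tp u w + tp u w' := by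
  funext p; simp [tp, mul_add]
theorem tp_smul_r {J K : Type*} (u : J → F) (c : F) (w : K → F) : tp u (c • w) = c • tp u w := by
  funext p; simp [tp]; ring
theorem tp_smul_l {J K : Type*} (u : J → F) (c : F) (w : K → F) : tp (c • u) w = c • tp u w := by
  funext p; simp [tp]; ring
theorem tp_zero_l {J K : Type*} (w : K → F) : tp (0 : J → F) w = 0 := by
  funext p; simp [tp]
theorem dt_sum (w : Ix n → F) : w = ∑ a, w a • dt a := by
  funext x; simp [dt, Finset.sum_apply, Pi.single_apply]
theorem tp_dt (a b : Ix n) : tp (dt a) (dt b) = W a b := by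
  funext ⟨x, y⟩; simp only [tp, dt, W_apply, Pi.single_apply]
  by_cases h : x = a <;> by_cases h' : y = b <;> simp [h, h']

theorem ker_top_of {J : Type*} (N : Submodule F (Ix n × J → F)) (h : ∀ a w, tp (dt a) w ∈ N) : N = ⊤ := by
  rw [eq_top_iff]; intro v _
  have : v = ∑ a, tp (dt a) (fun j => v (a, j)) := by
    funext ⟨x, j⟩
    simp [Finset.sum_apply, tp, dt, Pi.single_apply]
  rw [this]; exact Submodule.sum_mem _ fun a _ => h a _
theorem ker_top_of' {J : Type*} (N : Submodule F (J × Ix n → F)) (h : ∀ a w, tp w (dt a) ∈ N) : N = ⊤ := by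
  rw [eq_top_iff]; intro v _
  have : v = ∑ a, tp (fun j => v (j, a)) (dt a) := by
    funext ⟨j, x⟩
    simp [Finset.sum_apply, tp, dt, Pi.single_apply]
  rw [this]; exact Submodule.sum_mem _ fun a _ => h a _

theorem fm_dt (i : Fin n) (a : Ix n) : fm i *ᵥ dt a = ph i a • dt (sg i a) := by
  funext x; rw [dt, Matrix.mulVec_single_one]; simp [fm, dt, Pi.single_apply]
theorem km_dt (z : F) (i : Fin n) (a : Ix n) : km z i *ᵥ dt a = ka z i a • dt a := by
  funext x; rw [dt, Matrix.mulVec_single_one]; simp [km, Matrix.diagonal_apply, Pi.single_apply]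
  by_cases h : x = a <;> simp [h]
theorem ka_ne {z : F} (hz : z ≠ 0) (i : Fin n) (a : Ix n) : ka z i a ≠ 0 := by
  have : zi z i ≠ 0 := by unfold zi; split_ifs; exact hz; exact pow_ne_zero _ hz
  unfold ka; split_ifs
  · exact this
  · exact inv_ne_zero this
  · exact one_ne_zero

theorem down_ex (a b : Ix n) (h : a.val = b.val + 1) : ∃ i : Fin n, ph i a ≠ 0 ∧ sg i a = b := by
  have ha := a.isLt
  by_cases h1 : a.val ≤ n
  · refine ⟨⟨b.val, by omega⟩, ?_, ?_⟩
    · rw [ph, if_pos (Fin.ext h)]; simp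
    · rw [sg, if_pos (Fin.ext h)]; rfl
  · have e1 : a ≠ hi (⟨2*n-1-a.val, by omega⟩ : Fin n) := fun e => by have := congrArg Fin.val e; simp only [hi_val] at this; omega
    refine ⟨⟨2*n-1-a.val, by omega⟩, ?_, ?_⟩
    · rw [ph, if_neg e1, if_pos]
      · simp
      · apply Fin.ext; simp only [pr_val, lo_val]; omega
    · rw [sg, if_neg e1]; apply Fin.ext; simp only [pr_val, hi_val]; omega

theorem fmT_dt (i : Fin n) (a b : Ix n) (hab : b.val = a.val + 1) (h1 : ph i b ≠ 0) (h2 : sg i b = a) : (fm i)ᵀ *ᵥ dt a = ph i b • dt b := by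
  funext x; rw [dt, Matrix.mulVec_single_one]; simp [fm, dt, Pi.single_apply]
  by_cases hx : x = b
  · subst hx; simp [h2]
  · simp only [hx, if_false, ite_eq_right_iff]
    intro e
    by_contra h3
    have hil := i.isLt
    unfold ph at h3 h1
    unfold sg at e h2
    have vx : x.val ≠ b.val := fun h => hx (Fin.ext h)
    clear hx
    split_ifs at h3 e h1 h2
    all_goals simp only [not_true_eq_false, ne_eq] at h3 h1
    all_goals simp only [Fin.ext_iff, pr_val, lo_val, hi_val] at *
    all_goals omega

theorem ph_zero (i : Fin n) (a : Ix n) (h : a.val = 0) : ph i a = 0 := by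
  have := i.isLt
  have h1 : a ≠ hi i := fun e => by have := congrArg Fin.val e; simp only [hi_val] at this; omega
  have h2 : a ≠ pr n (lo i) := fun e => by have := congrArg Fin.val e; simp only [pr_val, lo_val] at this; omega
  rw [ph, if_neg h1, if_neg h2]

theorem gen_up {J : Type*} [Fintype J] [DecidableEq J] (z : F) (N : Submodule F (Ix n × J → F)) (y : Fin n → Matrix J J F)
    (hN : ∀ i, ∀ v ∈ N, ((fm i)ᵀ ⊗ₖ (1 : Matrix J J F) + km z i ⊗ₖ y i) *ᵥ v ∈ N) (h0 : ∀ a : Ix n, a.val = 0 → ∀ w, tp (dt a) w ∈ N) : N = ⊤ := by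
  apply ker_top_of
  have : ∀ m : ℕ, ∀ a : Ix n, a.val = m → ∀ w, tp (dt a) w ∈ N := by
    intro m
    induction m with
    | zero => exact h0
    | succ m ih =>
      intro b hb w
      have := b.isLt
      let a : Ix n := ⟨m, by omega⟩
      obtain ⟨i, h1, h2⟩ := down_ex b a hb
      have h3 := hN i _ (ih a rfl w)
      rw [add_mulVec, kron_tp, kron_tp, one_mulVec, fmT_dt i a b hb h1 h2, km_dt, tp_smul_l, tp_smul_l] at h3
      have h4 := (Submodule.add_mem_iff_left N (N.smul_mem (ka z i a) (ih a rfl (y i *ᵥ w)))).1 h3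
      exact (Submodule.smul_mem_iff _ h1).1 h4
  exact fun a w => this _ a rfl w

theorem gen_down {J : Type*} [Fintype J] [DecidableEq J] (N : Submodule F (J × Ix n → F)) (y : Fin n → Matrix J J F) (d : Fin n → J → F)
    (hd : ∀ i j, d i j ≠ 0)
    (hN : ∀ i, ∀ v ∈ N, (y i ⊗ₖ (1 : Matrix (Ix n) (Ix n) F) + Matrix.diagonal (d i) ⊗ₖ fm i) *ᵥ v ∈ N) (h0 : ∀ a : Ix n, a.val + 1 = 2*n → ∀ w, tp w (dt a) ∈ N) : N = ⊤ := by
  apply ker_top_of'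
  have : ∀ m : ℕ, ∀ a : Ix n, a.val + 1 + m = 2*n → ∀ w, tp w (dt a) ∈ N := by
    intro m
    induction m with
    | zero => exact h0
    | succ m ih =>
      intro b hb w
      let a : Ix n := ⟨b.val+1, by omega⟩
      obtain ⟨i, h1, h2⟩ := down_ex a b rfl
      have ha : a.val + 1 + m = 2*n := by simp only [a]; omega
      have h3 := hN i _ (ih a ha (fun j => (d i j)⁻¹ * w j))
      rw [add_mulVec, kron_tp, kron_tp, one_mulVec, fm_dt, h2] at h3
      have h4 := (Submodule.add_mem_iff_right N (ih a ha _)).1 h3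
      rw [tp_smul_r] at h4
      have h5 := (Submodule.smul_mem_iff _ h1).1 h4
      convert h5 using 2
      funext j; rw [Matrix.mulVec_diagonal, ← mul_assoc, mul_inv_cancel₀ (hd i j), one_mul]
  exact fun a w => this (2*n - 1 - a.val) a (by have := a.isLt; omega) w

theorem gen2 (z : F) (hz : z ≠ 0) (N : Submodule F (Ix n × Ix n → F))
    (hf : ∀ i, ∀ v ∈ N, dl (fm i) (km z i) *ᵥ v ∈ N) (he : ∀ i, ∀ v ∈ N, dl (fm i)ᵀ (km z i) *ᵥ v ∈ N)
    (h0 : ∀ a b : Ix n, a.val = 0 → b.val + 1 = 2*n → W a b ∈ N) : N = ⊤ := by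
  apply gen_up z N (fun i => (fm i)ᵀ) he
  intro a ha
  have : ∀ m : ℕ, ∀ b : Ix n, b.val + 1 + m = 2*n → W a b ∈ N := by
    intro m
    induction m with
    | zero => exact fun b => h0 a b ha
    | succ m ih =>
      intro b hb
      let c : Ix n := ⟨b.val+1, by omega⟩
      obtain ⟨i, h1, h2⟩ := down_ex c b rfl
      have hc : c.val + 1 + m = 2*n := by simp only [c]; omega
      have h3 := hf i _ (ih c hc)
      rw [dl_W, ph_zero i a ha, zero_smul, zero_add, h2] at h3
      exact (Submodule.smul_mem_iff _ (mul_ne_zero (ka_ne hz i a) h1)).1 h3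
  intro w
  have e : tp (dt a) w = ∑ b, w b • W a b := by
    funext ⟨x, y⟩
    simp only [tp, dt, Finset.sum_apply, Pi.smul_apply, W_apply, smul_eq_mul, Pi.single_apply]
    by_cases h : x = a <;> simp [h]
  rw [e]
  exact Submodule.sum_mem _ fun b _ => N.smul_mem _ (this (2*n-1-b.val) b (by have := b.isLt; omega))

theorem gen3 (z : F) (hz : z ≠ 0) (N : Submodule F (Ix n × (Ix n × Ix n) → F))
    (hf : ∀ i, ∀ v ∈ N, (fm i ⊗ₖ 1 + km z i ⊗ₖ dl (fm i) (km z i)) *ᵥ v ∈ N)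
    (he : ∀ i, ∀ v ∈ N, ((fm i)ᵀ ⊗ₖ 1 + km z i ⊗ₖ dl (fm i)ᵀ (km z i)) *ᵥ v ∈ N)
    (h0 : ∀ a b c : Ix n, a.val = 0 → c.val + 1 = 2*n → tp (dt a) (W b c) ∈ N) : N = ⊤ := by
  apply gen_up z N _ he
  intro a ha
  let N' : Submodule F (Ix n × Ix n → F) :=
    { carrier := {w | tp (dt a) w ∈ N}
      add_mem' := fun {u v} hu hv => by
        show tp (dt a) (u + v) ∈ N
        rw [tp_add_r]; exact N.add_mem hu hv
      zero_mem' := by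
        show tp (dt a) 0 ∈ N
        have : tp (dt a) (0 : Ix n × Ix n → F) = 0 := by funext p; simp [tp]
        rw [this]; exact N.zero_mem
      smul_mem' := fun c v hv => by
        show tp (dt a) (c • v) ∈ N
        rw [tp_smul_r]; exact N.smul_mem _ hv }
  have : N' = ⊤ := by
    apply gen_down N' (fun i => fm i) (fun i => ka z i) (fun i j => ka_ne hz i j)
    · intro i v hv
      have h3 := hf i _ hv
      rw [add_mulVec, kron_tp, kron_tp, one_mulVec, fm_dt, km_dt, ph_zero i a ha, zero_smul, tp_zero_l, zero_add, tp_smul_l] at h3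
      show tp (dt a) (dl (fm i) (km z i) *ᵥ v) ∈ N
      exact (Submodule.smul_mem_iff N (ka_ne hz i a)).1 h3
    · intro c hc w
      show tp (dt a) (tp w (dt c)) ∈ N
      have e : tp w (dt c) = ∑ b, w b • W b c := by
        funext ⟨x, y⟩
        simp only [tp, dt, Finset.sum_apply, Pi.smul_apply, W_apply, smul_eq_mul, Pi.single_apply]
        by_cases h : y = c <;> simp [h]
      have : tp w (dt c) ∈ N' := by
        rw [e]; exact Submodule.sum_mem _ fun b _ => N'.smul_mem _ (h0 a b c ha hc)
      exact this
  intro w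
  have : w ∈ N' := by rw [this]; trivial
  exact this
end
end

section
set_option synthInstance.maxHeartbeats 1000000
set_option maxHeartbeats 4000000
set_option linter.unusedSimpArgs false
set_option linter.unusedVariables false
local instance natAlgF10 : Algebra ℕ F := Semiring.toNatAlgebra
local instance intAlgF10 : Algebra ℤ F := Ring.toIntAlgebra _
section
variable {n : ℕ}
open Matrix Kronecker

theorem zi_ne {z : F} (hz : z ≠ 0) (i : Fin n) : zi z i ≠ 0 := by unfold zi; split_ifs; exact hz; exact pow_ne_zero _ hz

theorem ka_pr {z : F} (hz : z ≠ 0) (i : Fin n) (a : Ix n) : ka z i a * ka z i (pr n a) = 1 := by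
  have hil := i.isLt
  have hw := zi_ne hz i
  have hal := a.isLt
  unfold ka
  simp only [Fin.ext_iff, pr_val, lo_val, hi_val]
  split_ifs <;> first | (exfalso; omega) | (field_simp)

theorem Rz_kk (z : F) {w : F} (hw : w ≠ 0) (i : Fin n) :
    Rz z n * (km w i ⊗ₖ km w i) = (km w i ⊗ₖ km w i) * Rz z n := by
  have e : (km w i ⊗ₖ km w i : Matrix (Ix n × Ix n) (Ix n × Ix n) F) = Matrix.diagonal (fun p => ka w i p.1 * ka w i p.2) := by
    rw [km, Matrix.diagonal_kronecker_diagonal]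
  rw [e]
  funext ⟨x, y⟩ ⟨a, b⟩
  rw [Matrix.mul_diagonal, Matrix.diagonal_mul]
  simp only [Rz]
  by_cases h1 : x = a ∧ y = b
  · obtain ⟨rfl, rfl⟩ := h1; ring
  by_cases h2 : y = pr n x ∧ b = pr n a
  · obtain ⟨rfl, rfl⟩ := h2; rw [ka_pr hw, ka_pr hw]; ring
  by_cases h3 : a = y ∧ b = x
  · obtain ⟨rfl, rfl⟩ := h3; ring
  · rw [if_neg h1, if_neg (by tauto), if_neg (by tauto)]; simp

theorem flip_inter (R : Matrix (Ix n × Ix n) (Ix n × Ix n) F) (f k k' : Matrix (Ix n) (Ix n) F) (c : F) (hc : c ≠ 0)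
    (hk : k * k' = 1) (hf : f * k' = c • f) (hR : R * (k' ⊗ₖ k') = (k' ⊗ₖ k') * R)
    (hk' : k' * k = 1)
    (h : R * dl f k' = dop f k' * R) : R * dop f k = dl f k * R := by
  have e1 : dop f k * (k' ⊗ₖ k') = c • dl f k' := by
    rw [dop, dl, add_mul, ← Matrix.mul_kronecker_mul, ← Matrix.mul_kronecker_mul, hk, hf, one_mul, Matrix.smul_kronecker, Matrix.kronecker_smul, smul_add, add_comm]
  have e2 : dl f k * (k' ⊗ₖ k') = c • dop f k' := by
    rw [dop, dl, add_mul, ← Matrix.mul_kronecker_mul, ← Matrix.mul_kronecker_mul, hk, hf, one_mul, Matrix.smul_kronecker, Matrix.kronecker_smul, smul_add, add_comm]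
  have e3 : (k' ⊗ₖ k') * (k ⊗ₖ k) = (1 : Matrix (Ix n × Ix n) (Ix n × Ix n) F) := by
    rw [← Matrix.mul_kronecker_mul, hk', Matrix.one_kronecker_one]
  have e4 : R * dop f k * (k' ⊗ₖ k') = dl f k * R * (k' ⊗ₖ k') := by
    rw [mul_assoc, e1, mul_assoc, hR, ← mul_assoc (dl f k), e2, mul_smul_comm, smul_mul_assoc, h]
  have e5 := congrArg (· * (k ⊗ₖ k)) e4
  simp only [mul_assoc, e3] at e5
  simpa only [mul_one] using e5

theorem ka_inv {z : F} (hz : z ≠ 0) (i : Fin n) (a : Ix n) : ka z⁻¹ i a = (ka z i a)⁻¹ := by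
  unfold ka zi; split_ifs <;> simp

theorem kk_inv {z : F} (hz : z ≠ 0) (i : Fin n) : km z i * km z⁻¹ i = 1 := by
  rw [km, km, Matrix.diagonal_mul_diagonal, ← Matrix.diagonal_one]
  congr 1; funext a; rw [ka_inv hz, mul_inv_cancel₀ (ka_ne hz i a)]

theorem fm_k (z : F) (i : Fin n) : fm i * km z i = zi z i • fm i := by
  funext x a
  rw [km, Matrix.mul_diagonal, Matrix.smul_apply, fm]
  by_cases h : x = sg i a ∧ ph i a ≠ 0
  · rw [if_pos h.1, smul_eq_mul, mul_comm]; congr 1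
    have := h.2
    unfold ph at this
    rw [ka, if_pos]; by_contra hh; apply this; rw [if_neg (by tauto), if_neg (by tauto)]
  · by_cases h1 : x = sg i a
    · have : ph i a = 0 := by by_contra h2; exact h ⟨h1, h2⟩
      simp [this]
    · simp [h1]

theorem fmT_k {z : F} (hz : z ≠ 0) (i : Fin n) : (fm i)ᵀ * km z i = (zi z i)⁻¹ • (fm i)ᵀ := by
  funext x a
  rw [km, Matrix.mul_diagonal, Matrix.smul_apply, Matrix.transpose_apply, fm]
  by_cases h : a = sg i x ∧ ph i x ≠ 0
  · rw [if_pos h.1, smul_eq_mul, mul_comm]; congr 1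
    have h2 := h.2
    have h1 := h.1
    have hil := i.isLt
    unfold ph at h2
    rw [ka, if_neg, if_pos]
    · rw [h1, sg]; split_ifs <;> tauto
    · rw [h1, sg]
      split_ifs
      · simp only [Fin.ext_iff, pr_val, lo_val, hi_val]; omega
      · have : x = pr n (lo i) := by by_contra h3; apply h2; rw [if_neg (by assumption), if_neg h3]
        rename_i h4
        subst this
        simp only [Fin.ext_iff, pr_val, lo_val, hi_val] at *; omega
  · by_cases h1 : a = sg i x
    · have : ph i x = 0 := by by_contra h2; exact h ⟨h1, h2⟩
      simp [this]
    · simp [h1]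

theorem Cv_zero (z : F) (a : Ix n) (h : a.val = 0) : Cv z a = 0 := by
  funext ⟨x, y⟩; rw [Cv_apply, if_neg]; rfl
  rw [Fin.lt_def]; omega

theorem Rz_first {z : F} (hz : z ≠ 0) (a b : Ix n) (h : a.val = 0) : Rz z n *ᵥ W a b = dg z a b • W a b := by
  rw [Rz_col hz, if_neg (by rw [Fin.lt_def]; omega), Cv_zero z a h]; simp
theorem Rz_last {z : F} (hz : z ≠ 0) (a b : Ix n) (h : b.val + 1 = 2*n) : Rz z n *ᵥ W a b = dg z a b • W a b := by
  have := a.isLt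
  by_cases h0 : a.val = 0
  · exact Rz_first hz a b h0
  rw [Rz_col hz, if_neg (by rw [Fin.lt_def]; omega), if_neg]
  · simp
  · intro e; have := congrArg Fin.val e; rw [pr_val] at this; omega

theorem Rz_inv {z : F} (hz : z ≠ 0) : Rz z⁻¹ n * Rz z n = 1 := by
  have hz' := inv_ne_zero hz
  have k1 := fun i : Fin n => kk_inv hz i
  have k2 := fun i : Fin n => kk_inv hz' i
  simp only [inv_inv] at k2
  have hf : ∀ i : Fin n, (Rz z⁻¹ n * Rz z n) * dl (fm i) (km z i) = dl (fm i) (km z i) * (Rz z⁻¹ n * Rz z n) := by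
    intro i
    have := flip_inter (Rz z⁻¹ n) (fm i) (km z i) (km z⁻¹ i) (zi z⁻¹ i) (zi_ne hz' i) (k1 i) (fm_k _ i) (Rz_kk _ hz' i) (k2 i) (inter_f _ hz' i)
    rw [mul_assoc, inter_f z hz, ← mul_assoc, this, mul_assoc]
  have he : ∀ i : Fin n, (Rz z⁻¹ n * Rz z n) * dl (fm i)ᵀ (km z i) = dl (fm i)ᵀ (km z i) * (Rz z⁻¹ n * Rz z n) := by
    intro i
    have := flip_inter (Rz z⁻¹ n) (fm i)ᵀ (km z i) (km z⁻¹ i) _ (inv_ne_zero (zi_ne hz' i)) (k1 i) (fmT_k hz' i) (Rz_kk _ hz' i) (k2 i) (inter_e _ hz' i)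
    rw [mul_assoc, inter_e z hz, ← mul_assoc, this, mul_assoc]
  have top := gen2 z hz (LinearMap.ker (Matrix.mulVecLin (Rz z⁻¹ n * Rz z n - 1))) 
    (by
      intro i v hv
      rw [LinearMap.mem_ker, Matrix.mulVecLin_apply] at *
      rw [Matrix.mulVec_mulVec, sub_mul, hf i, one_mul, ← mul_one (dl (fm i) (km z i)), mul_assoc, one_mul, ← mul_sub, ← Matrix.mulVec_mulVec, hv, mulVec_zero])
    (by
      intro i v hv
      rw [LinearMap.mem_ker, Matrix.mulVecLin_apply] at *
      rw [Matrix.mulVec_mulVec, sub_mul, he i, one_mul, ← mul_one (dl (fm i)ᵀ (km z i)), mul_assoc, one_mul, ← mul_sub, ← Matrix.mulVec_mulVec, hv, mulVec_zero])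
    (by
      intro a b ha hb
      rw [LinearMap.mem_ker, Matrix.mulVecLin_apply, sub_mulVec, ← mulVec_mulVec, Rz_first hz a b ha, mulVec_smul, Rz_first hz' a b ha, one_mulVec, smul_smul]
      have : dg z a b * dg z⁻¹ a b = 1 := by
        unfold dg; rw [_root_.inv_zpow, mul_inv_cancel₀ (zpow_ne_zero _ hz)]
      rw [this, one_smul, sub_self])
  rw [← sub_eq_zero]
  apply Matrix.ext_of_mulVec_single
  intro p
  have : (Pi.single p 1 : Ix n × Ix n → F) ∈ LinearMap.ker (Matrix.mulVecLin (Rz z⁻¹ n * Rz z n - 1)) := by rw [top]; trivial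
  rw [LinearMap.mem_ker, Matrix.mulVecLin_apply] at this
  rw [this, zero_mulVec]
end
end

section
set_option synthInstance.maxHeartbeats 1000000
set_option maxHeartbeats 4000000
set_option linter.unusedSimpArgs false
set_option linter.unusedVariables false
section
variable {n : ℕ}
open Matrix Kronecker

abbrev I3 (n : ℕ) := Ix n × (Ix n × Ix n)

def p12 (M : Matrix (Ix n × Ix n) (Ix n × Ix n) F) : Matrix (I3 n) (I3 n) F :=
  Matrix.reindexAlgEquiv F F (Equiv.prodAssoc (Ix n) (Ix n) (Ix n)) (M ⊗ₖ (1 : Matrix (Ix n) (Ix n) F))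
def p23 (M : Matrix (Ix n × Ix n) (Ix n × Ix n) F) : Matrix (I3 n) (I3 n) F := (1 : Matrix (Ix n) (Ix n) F) ⊗ₖ M
def e13 (n : ℕ) : I3 n ≃ I3 n where
  toFun x := (x.2.1, (x.1, x.2.2))
  invFun x := (x.2.1, (x.1, x.2.2))
  left_inv _ := rfl
  right_inv _ := rfl
def p13 (M : Matrix (Ix n × Ix n) (Ix n × Ix n) F) : Matrix (I3 n) (I3 n) F :=
  Matrix.reindexAlgEquiv F F (e13 n) (p23 M)

theorem p12_apply (M : Matrix (Ix n × Ix n) (Ix n × Ix n) F) (x y z a b c : Ix n) :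
    p12 M (x,(y,z)) (a,(b,c)) = M (x,y) (a,b) * if z = c then 1 else 0 := by
  simp [p12, Matrix.coe_reindexAlgEquiv, Matrix.one_apply]
theorem p23_apply (M : Matrix (Ix n × Ix n) (Ix n × Ix n) F) (x y z a b c : Ix n) :
    p23 M (x,(y,z)) (a,(b,c)) = M (y,z) (b,c) * if x = a then 1 else 0 := by
  simp [p23, Matrix.one_apply]
theorem p13_apply (M : Matrix (Ix n × Ix n) (Ix n × Ix n) F) (x y z a b c : Ix n) :
    p13 M (x,(y,z)) (a,(b,c)) = M (x,z) (a,c) * if y = b then 1 else 0 := by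
  simp [p13, Matrix.coe_reindexAlgEquiv, p23_apply, e13]

theorem p23_mul (M N : Matrix (Ix n × Ix n) (Ix n × Ix n) F) : p23 (M * N) = p23 M * p23 N := by
  simp only [p23]; rw [← Matrix.mul_kronecker_mul, one_mul]
theorem p12_mul (M N : Matrix (Ix n × Ix n) (Ix n × Ix n) F) : p12 (M * N) = p12 M * p12 N := by
  simp only [p12]; rw [← map_mul, ← Matrix.mul_kronecker_mul, one_mul]
theorem p13_mul (M N : Matrix (Ix n × Ix n) (Ix n × Ix n) F) : p13 (M * N) = p13 M * p13 N := by
  simp only [p13]; rw [← map_mul, p23_mul]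
theorem p23_add (M N : Matrix (Ix n × Ix n) (Ix n × Ix n) F) : p23 (M + N) = p23 M + p23 N := by
  simp only [p23, Matrix.kronecker_add]
theorem p12_add (M N : Matrix (Ix n × Ix n) (Ix n × Ix n) F) : p12 (M + N) = p12 M + p12 N := by
  simp only [p12, Matrix.add_kronecker, map_add]
theorem p13_add (M N : Matrix (Ix n × Ix n) (Ix n × Ix n) F) : p13 (M + N) = p13 M + p13 N := by
  simp only [p13, p23_add, map_add]
theorem p23_one : p23 (1 : Matrix (Ix n × Ix n) (Ix n × Ix n) F) = 1 := by
  simp [p23]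
theorem p12_one : p12 (1 : Matrix (Ix n × Ix n) (Ix n × Ix n) F) = 1 := by
  simp [p12]
theorem p13_one : p13 (1 : Matrix (Ix n × Ix n) (Ix n × Ix n) F) = 1 := by
  simp [p13, p23_one]

def s1 (A : Matrix (Ix n) (Ix n) F) : Matrix (I3 n) (I3 n) F := A ⊗ₖ (1 : Matrix (Ix n × Ix n) (Ix n × Ix n) F)
def s2 (A : Matrix (Ix n) (Ix n) F) : Matrix (I3 n) (I3 n) F := (1 : Matrix (Ix n) (Ix n) F) ⊗ₖ (A ⊗ₖ (1 : Matrix (Ix n) (Ix n) F))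
def s3 (A : Matrix (Ix n) (Ix n) F) : Matrix (I3 n) (I3 n) F := (1 : Matrix (Ix n) (Ix n) F) ⊗ₖ ((1 : Matrix (Ix n) (Ix n) F) ⊗ₖ A)

theorem s12 (A B : Matrix (Ix n) (Ix n) F) : s1 A * s2 B = p12 (A ⊗ₖ B) := by
  simp only [s1, s2, ← Matrix.mul_kronecker_mul, one_mul, mul_one]
  ext ⟨x,y,z⟩ ⟨a,b,c⟩; rw [p12_apply]; simp [Matrix.one_apply]
theorem s13 (A B : Matrix (Ix n) (Ix n) F) : s1 A * s3 B = p13 (A ⊗ₖ B) := by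
  simp only [s1, s3, ← Matrix.mul_kronecker_mul, one_mul, mul_one]
  ext ⟨x,y,z⟩ ⟨a,b,c⟩; rw [p13_apply]; simp [Matrix.one_apply]
theorem s23 (A B : Matrix (Ix n) (Ix n) F) : s2 A * s3 B = p23 (A ⊗ₖ B) := by
  simp only [s2, s3, p23, ← Matrix.mul_kronecker_mul, one_mul, mul_one]
theorem s2_1 (A B : Matrix (Ix n) (Ix n) F) : s2 B * s1 A = s1 A * s2 B := by
  simp only [s1, s2, ← Matrix.mul_kronecker_mul, one_mul, mul_one]
theorem s3_1 (A B : Matrix (Ix n) (Ix n) F) : s3 B * s1 A = s1 A * s3 B := by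
  simp only [s1, s3, ← Matrix.mul_kronecker_mul, one_mul, mul_one]
theorem s3_2 (A B : Matrix (Ix n) (Ix n) F) : s3 B * s2 A = s2 A * s3 B := by
  simp only [s2, s3, ← Matrix.mul_kronecker_mul, one_mul, mul_one]
theorem s1_one : s1 (1 : Matrix (Ix n) (Ix n) F) = 1 := by simp [s1]
theorem s2_one : s2 (1 : Matrix (Ix n) (Ix n) F) = 1 := by simp [s2]
theorem s3_one : s3 (1 : Matrix (Ix n) (Ix n) F) = 1 := by simp [s3]

theorem p23_s1 (M : Matrix (Ix n × Ix n) (Ix n × Ix n) F) (A : Matrix (Ix n) (Ix n) F) : p23 M * s1 A = s1 A * p23 M := by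
  simp only [s1, p23, ← Matrix.mul_kronecker_mul, one_mul, mul_one]
theorem p13_s2 (M : Matrix (Ix n × Ix n) (Ix n × Ix n) F) (A : Matrix (Ix n) (Ix n) F) : p13 M * s2 A = s2 A * p13 M := by
  have : s2 A = Matrix.reindexAlgEquiv F F (e13 n) (s1 A) := by
    ext ⟨x,y,z⟩ ⟨a,b,c⟩
    simp [s2, s1, Matrix.coe_reindexAlgEquiv, e13, Matrix.one_apply, Prod.ext_iff]
    split_ifs <;> simp_all
  rw [this, p13, ← map_mul, ← map_mul, p23_s1]
theorem p12_s3 (M : Matrix (Ix n × Ix n) (Ix n × Ix n) F) (A : Matrix (Ix n) (Ix n) F) : p12 M * s3 A = s3 A * p12 M := by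
  have : s3 A = Matrix.reindexAlgEquiv F F (Equiv.prodAssoc (Ix n) (Ix n) (Ix n)) ((1 : Matrix (Ix n × Ix n) (Ix n × Ix n) F) ⊗ₖ A) := by
    ext ⟨x,y,z⟩ ⟨a,b,c⟩
    simp [s3, Matrix.coe_reindexAlgEquiv, Matrix.one_apply, Prod.ext_iff]
    split_ifs <;> simp_all
  rw [this, p12, ← map_mul, ← map_mul, ← Matrix.mul_kronecker_mul, ← Matrix.mul_kronecker_mul, one_mul, one_mul, mul_one, mul_one]

theorem ybe_ring {A : Type*} [Ring A] (R12 R13 R23 f1 f2 f3 k1 k2 k3 : A)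
    (h12 : R12 * (f1 + k1 * f2) = (f2 + f1 * k2) * R12)
    (h13 : R13 * (f1 + k1 * f3) = (f3 + f1 * k3) * R13)
    (h23 : R23 * (f2 + k2 * f3) = (f3 + f2 * k3) * R23)
    (k12 : R12 * (k1 * k2) = (k1 * k2) * R12)
    (k13 : R13 * (k1 * k3) = (k1 * k3) * R13)
    (k23 : R23 * (k2 * k3) = (k2 * k3) * R23)
    (a1 : R12 * f3 = f3 * R12) (a2 : R12 * k3 = k3 * R12)
    (a3 : R13 * f2 = f2 * R13) (a4 : R13 * k2 = k2 * R13)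
    (a5 : R23 * f1 = f1 * R23) (a6 : R23 * k1 = k1 * R23)
    (c1 : k1 * k3 = k3 * k1) (c2 : f1 * k3 = k3 * f1) (c3 : f2 * k3 = k3 * f2) (c4 : f1 * k2 = k2 * f1)
    (c5 : k1 * k2 = k2 * k1) (c6 : k2 * k3 = k3 * k2) :
    (R12 * R13 * R23 - R23 * R13 * R12) * (f1 + k1 * (f2 + k2 * f3)) =
      (f3 + k3 * (f2 + f1 * k2)) * (R12 * R13 * R23 - R23 * R13 * R12) := by
  have e1 : R23 * (f1 + k1 * (f2 + k2 * f3)) = (f1 + k1 * (f3 + f2 * k3)) * R23 := by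
    rw [mul_add, a5, ← mul_assoc, a6, mul_assoc, h23]; noncomm_ring
  have e2 : R13 * (f1 + k1 * (f3 + f2 * k3)) = (f3 + k3 * (f1 + k1 * f2)) * R13 := by
    have : f1 + k1 * (f3 + f2 * k3) = (f1 + k1 * f3) + k1 * k3 * f2 := by
      rw [c3]; noncomm_ring
    rw [this, mul_add, h13, ← mul_assoc, k13, mul_assoc, a3, c2, c1]; noncomm_ring
  have e3 : R12 * (f3 + k3 * (f1 + k1 * f2)) = (f3 + k3 * (f2 + f1 * k2)) * R12 := by
    rw [mul_add, a1, ← mul_assoc, a2, mul_assoc, h12]; noncomm_ring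
  have g1 : R12 * (f1 + k1 * (f2 + k2 * f3)) = (f2 + k2 * (f1 + k1 * f3)) * R12 := by
    have : f1 + k1 * (f2 + k2 * f3) = (f1 + k1 * f2) + k1 * k2 * f3 := by noncomm_ring
    rw [this, mul_add, h12, ← mul_assoc, k12, mul_assoc, a1, c4, c5]; noncomm_ring
  have g2 : R13 * (f2 + k2 * (f1 + k1 * f3)) = (f2 + k2 * (f3 + f1 * k3)) * R13 := by
    rw [mul_add, a3, ← mul_assoc, a4, mul_assoc, h13]; noncomm_ring
  have g3 : R23 * (f2 + k2 * (f3 + f1 * k3)) = (f3 + k3 * (f2 + f1 * k2)) * R23 := by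
    have : f2 + k2 * (f3 + f1 * k3) = (f2 + k2 * f3) + k2 * k3 * f1 := by
      rw [c2]; noncomm_ring
    rw [this, mul_add, h23, ← mul_assoc, k23, mul_assoc, a5, c3, c6, c4]; noncomm_ring
  rw [sub_mul, mul_assoc, e1, ← mul_assoc, mul_assoc R12, e2, ← mul_assoc, e3, mul_assoc (R23 * R13), g1, ← mul_assoc, mul_assoc R23, g2, ← mul_assoc, g3]
  noncomm_ring

theorem tp_dtW (a b c : Ix n) : tp (dt a) (W b c) = Pi.single (a,(b,c)) 1 := by
  funext ⟨x,y,z⟩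
  simp only [tp, dt, W, Pi.single_apply, Prod.ext_iff]
  by_cases h1 : x = a <;> by_cases h2 : y = b <;> by_cases h3 : z = c <;> simp [h1, h2, h3]

theorem p12_W {M : Matrix (Ix n × Ix n) (Ix n × Ix n) F} {a b : Ix n} {l : F} (h : M *ᵥ W a b = l • W a b) (c : Ix n) :
    p12 M *ᵥ tp (dt a) (W b c) = l • tp (dt a) (W b c) := by
  funext ⟨x,y,z⟩
  have := congr_fun h (x,y)
  rw [W, Matrix.mulVec_single_one, Matrix.col_apply, Pi.smul_apply] at this
  rw [tp_dtW, Matrix.mulVec_single_one, Matrix.col_apply, Pi.smul_apply, p12_apply, this]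
  simp only [Pi.single_apply, Prod.ext_iff]
  by_cases h1 : x = a <;> by_cases h2 : y = b <;> by_cases h3 : z = c <;> simp [h1, h2, h3]
theorem p13_W {M : Matrix (Ix n × Ix n) (Ix n × Ix n) F} {a c : Ix n} {l : F} (h : M *ᵥ W a c = l • W a c) (b : Ix n) :
    p13 M *ᵥ tp (dt a) (W b c) = l • tp (dt a) (W b c) := by
  funext ⟨x,y,z⟩
  have := congr_fun h (x,z)
  rw [W, Matrix.mulVec_single_one, Matrix.col_apply, Pi.smul_apply] at this
  rw [tp_dtW, Matrix.mulVec_single_one, Matrix.col_apply, Pi.smul_apply, p13_apply, this]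
  simp only [Pi.single_apply, Prod.ext_iff]
  by_cases h1 : x = a <;> by_cases h2 : y = b <;> by_cases h3 : z = c <;> simp [h1, h2, h3]
theorem p23_W {M : Matrix (Ix n × Ix n) (Ix n × Ix n) F} {b c : Ix n} {l : F} (h : M *ᵥ W b c = l • W b c) (a : Ix n) :
    p23 M *ᵥ tp (dt a) (W b c) = l • tp (dt a) (W b c) := by
  rw [p23, kron_tp, h, one_mulVec, tp_smul_r]

theorem ybe_step (z : F) (hz : z ≠ 0) (f k : Matrix (Ix n) (Ix n) F) (h : Rz z n * dl f k = dop f k * Rz z n)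
    (hk : Rz z n * (k ⊗ₖ k) = (k ⊗ₖ k) * Rz z n) :
    (p12 (Rz z n) * p13 (Rz z n) * p23 (Rz z n) - p23 (Rz z n) * p13 (Rz z n) * p12 (Rz z n)) *
      (f ⊗ₖ (1 : Matrix (Ix n × Ix n) (Ix n × Ix n) F) + k ⊗ₖ dl f k) =
    (s3 f + s3 k * (s2 f + s1 f * s2 k)) *
    (p12 (Rz z n) * p13 (Rz z n) * p23 (Rz z n) - p23 (Rz z n) * p13 (Rz z n) * p12 (Rz z n)) := by
  have e : f ⊗ₖ (1 : Matrix (Ix n × Ix n) (Ix n × Ix n) F) + k ⊗ₖ dl f k = s1 f + s1 k * (s2 f + s2 k * s3 f) := by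
    simp only [s1, s2, s3, dl, ← Matrix.mul_kronecker_mul, one_mul, mul_one, ← Matrix.kronecker_add]
  rw [e]
  have d1 : p12 (dl f k) = s1 f + s1 k * s2 f := by
    rw [s12, dl, p12_add, ← s12 f, s2_one, mul_one]
  have d2 : p12 (dop f k) = s2 f + s1 f * s2 k := by
    rw [s12, dop, p12_add, ← s12 1, s1_one, one_mul]
  have d3 : p13 (dl f k) = s1 f + s1 k * s3 f := by
    rw [s13, dl, p13_add, ← s13 f, s3_one, mul_one]
  have d4 : p13 (dop f k) = s3 f + s1 f * s3 k := by
    rw [s13, dop, p13_add, ← s13 1, s1_one, one_mul]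
  have d5 : p23 (dl f k) = s2 f + s2 k * s3 f := by
    rw [s23, dl, p23_add, ← s23 f, s3_one, mul_one]
  have d6 : p23 (dop f k) = s3 f + s2 f * s3 k := by
    rw [s23, dop, p23_add, ← s23 1, s2_one, one_mul]
  apply ybe_ring
  · rw [← d1, ← d2, ← p12_mul, ← p12_mul, h]
  · rw [← d3, ← d4, ← p13_mul, ← p13_mul, h]
  · rw [← d5, ← d6, ← p23_mul, ← p23_mul, h]
  · rw [s12, ← p12_mul, ← p12_mul, hk]
  · rw [s13, ← p13_mul, ← p13_mul, hk]
  · rw [s23, ← p23_mul, ← p23_mul, hk]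
  · exact p12_s3 _ _
  · exact p12_s3 _ _
  · exact p13_s2 _ _
  · exact p13_s2 _ _
  · exact p23_s1 _ _
  · exact p23_s1 _ _
  · exact (s3_1 _ _).symm
  · exact (s3_1 _ _).symm
  · exact (s3_2 _ _).symm
  · exact (s2_1 _ _).symm
  · exact (s2_1 _ _).symm
  · exact (s3_2 _ _).symm

theorem ybe {z : F} (hz : z ≠ 0) : p12 (Rz z n) * p13 (Rz z n) * p23 (Rz z n) = p23 (Rz z n) * p13 (Rz z n) * p12 (Rz z n) := by
  rw [← sub_eq_zero]
  have top := gen3 z hz (LinearMap.ker (Matrix.mulVecLin (p12 (Rz z n) * p13 (Rz z n) * p23 (Rz z n) - p23 (Rz z n) * p13 (Rz z n) * p12 (Rz z n))))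
    (by
      intro i v hv
      rw [LinearMap.mem_ker, Matrix.mulVecLin_apply] at *
      rw [Matrix.mulVec_mulVec, ybe_step z hz _ _ (inter_f z hz i) (Rz_kk z hz i), ← Matrix.mulVec_mulVec, hv, mulVec_zero])
    (by
      intro i v hv
      rw [LinearMap.mem_ker, Matrix.mulVecLin_apply] at *
      rw [Matrix.mulVec_mulVec, ybe_step z hz _ _ (inter_e z hz i) (Rz_kk z hz i), ← Matrix.mulVec_mulVec, hv, mulVec_zero])
    (by
      intro a b c ha hc
      rw [LinearMap.mem_ker, Matrix.mulVecLin_apply]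
      have h1 := p12_W (Rz_first hz a b ha) c
      have h2 := p13_W (Rz_first hz a c ha) b
      have h3 := p23_W (Rz_last hz b c hc) a
      simp only [sub_mulVec, ← mulVec_mulVec, h1, h2, h3, mulVec_smul, smul_smul]
      rw [sub_eq_zero]; congr 1; ring)
  apply Matrix.ext_of_mulVec_single
  intro p
  have : (Pi.single p 1 : I3 n → F) ∈ LinearMap.ker (Matrix.mulVecLin (p12 (Rz z n) * p13 (Rz z n) * p23 (Rz z n) - p23 (Rz z n) * p13 (Rz z n) * p12 (Rz z n))) := by rw [top]; trivial
  rw [LinearMap.mem_ker, Matrix.mulVecLin_apply] at this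
  rw [this, zero_mulVec]
end
end

section
set_option synthInstance.maxHeartbeats 1000000
set_option maxHeartbeats 4000000
set_option linter.unusedSimpArgs false
set_option linter.unusedVariables false
set_option linter.unusedSectionVars false
section
variable {n : ℕ}
open Matrix Kronecker

def crc (n : ℕ) (k j : Ix n) : F := dd n k * (dd n j)⁻¹ * eps n (pr n k) * eps n (pr n j)

def cr {A : Type*} [Ring A] [Algebra F A] (T : Matrix (Ix n) (Ix n) A) : Matrix (Ix n) (Ix n) A :=
  fun k j => crc n k j • T (pr n j) (pr n k)

structure Sol (n : ℕ) (A : Type*) [Ring A] [Algebra F A] where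
  T : Matrix (Ix n) (Ix n) A
  Tb : Matrix (Ix n) (Ix n) A
  tu : ∀ i j, i < j → T i j = 0
  bl : ∀ i j, j < i → Tb i j = 0
  td : ∀ i, T i i * Tb i i = 1
  dt : ∀ i, Tb i i * T i i = 1
  tt : RTT n T T
  bb : RTT n Tb Tb
  bt : RTT n Tb T
  c1 : T * cr T = 1
  c2 : cr T * T = 1
  c3 : Tb * cr Tb = 1
  c4 : cr Tb * Tb = 1

def Sol.gen {A : Type*} [Ring A] [Algebra F A] (S : Sol n A) : Gen n → A
  | Gen.t i j => S.T i j
  | Gen.tb i j => S.Tb i j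

theorem Sol.rel {A : Type*} [Ring A] [Algebra F A] (S : Sol n A) {x y : FA n} (h : rel n x y) :
    FreeAlgebra.lift F S.gen x = FreeAlgebra.lift F S.gen y := by
  have et : ∀ i j, FreeAlgebra.lift F S.gen (tF n i j) = S.T i j := by intros; simp [tF, Sol.gen]
  have eb : ∀ i j, FreeAlgebra.lift F S.gen (tbF n i j) = S.Tb i j := by intros; simp [tbF, Sol.gen]
  cases h with
  | t_upper i j h => rw [et, map_zero, S.tu i j h]
  | tb_lower i j h => rw [eb, map_zero, S.bl i j h]
  | t_tb_diag i => rw [map_mul, et, eb, map_one, S.td]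
  | tb_t_diag i => rw [map_mul, et, eb, map_one, S.dt]
  | rtt_tt i a j b => simp only [map_sum, map_smul, map_mul, et, eb]; exact S.tt i a j b
  | rtt_bb i a j b => simp only [map_sum, map_smul, map_mul, et, eb]; exact S.bb i a j b
  | rtt_bt i a j b => simp only [map_sum, map_smul, map_mul, et, eb]; exact S.bt i a j b
  | cent_t1 i j =>
    have := congr_fun (congr_fun S.c1 i) j
    simp only [map_sum, map_smul, map_mul, et, eb]
    rw [Matrix.mul_apply, Matrix.one_apply] at this
    simp only [cr, mul_smul_comm] at this
    rw [show (∑ k, (dd n k * (dd n j)⁻¹ * eps n (pr n k) * eps n (pr n j)) • (S.T i k * S.T (pr n j) (pr n k))) = _ from this]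
    split_ifs <;> simp
  | cent_tb1 i j =>
    have := congr_fun (congr_fun S.c3 i) j
    simp only [map_sum, map_smul, map_mul, et, eb]
    rw [Matrix.mul_apply, Matrix.one_apply] at this
    simp only [cr, mul_smul_comm] at this
    rw [show (∑ k, (dd n k * (dd n j)⁻¹ * eps n (pr n k) * eps n (pr n j)) • (S.Tb i k * S.Tb (pr n j) (pr n k))) = _ from this]
    split_ifs <;> simp
  | cent_t2 i j =>
    have := congr_fun (congr_fun S.c2 i) j
    simp only [map_sum, map_smul, map_mul, et, eb]
    rw [Matrix.mul_apply, Matrix.one_apply] at this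
    simp only [cr, smul_mul_assoc] at this
    rw [show (∑ k, (dd n i * (dd n k)⁻¹ * eps n (pr n i) * eps n (pr n k)) • (S.T (pr n k) (pr n i) * S.T k j)) = _ from this]
    split_ifs <;> simp
  | cent_tb2 i j =>
    have := congr_fun (congr_fun S.c4 i) j
    simp only [map_sum, map_smul, map_mul, et, eb]
    rw [Matrix.mul_apply, Matrix.one_apply] at this
    simp only [cr, smul_mul_assoc] at this
    rw [show (∑ k, (dd n i * (dd n k)⁻¹ * eps n (pr n i) * eps n (pr n k)) • (S.Tb (pr n k) (pr n i) * S.Tb k j)) = _ from this]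
    split_ifs <;> simp

def Sol.hom {A : Type*} [Ring A] [Algebra F A] (S : Sol n A) : Usp n →ₐ[F] A :=
  RingQuot.liftAlgHom F ⟨FreeAlgebra.lift F S.gen, fun {x y} h => S.rel h⟩
theorem Sol.hom_t {A : Type*} [Ring A] [Algebra F A] (S : Sol n A) (i j : Ix n) : S.hom (tU n i j) = S.T i j := by
  simp [Sol.hom, tU, tF, Sol.gen]
theorem Sol.hom_tb {A : Type*} [Ring A] [Algebra F A] (S : Sol n A) (i j : Ix n) : S.hom (tbU n i j) = S.Tb i j := by
  simp [Sol.hom, tbU, tbF, Sol.gen]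

/-- tautological solution -/
def tautSol (n : ℕ) : Sol n (Usp n) where
  T := Matrix.of (tU n)
  Tb := Matrix.of (tbU n)
  tu := tU_upper n
  bl := tbU_lower n
  td := fun i => t_tb n i
  dt := fun i => tb_t n i
  tt := RTT_tt n
  bb := RTT_bb n
  bt := RTT_bt n
  c1 := by
    ext i j
    have := RingQuot.mkAlgHom_rel F (rel.cent_t1 (n := n) i j)
    rw [Matrix.mul_apply, Matrix.one_apply]
    simp only [cr, Matrix.of_apply, mul_smul_comm]
    simp only [map_sum, map_smul, map_mul] at this
    refine Eq.trans this ?_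
    split_ifs <;> simp
  c2 := by
    ext i j
    have := RingQuot.mkAlgHom_rel F (rel.cent_t2 (n := n) i j)
    rw [Matrix.mul_apply, Matrix.one_apply]
    simp only [cr, Matrix.of_apply, smul_mul_assoc]
    simp only [map_sum, map_smul, map_mul] at this
    refine Eq.trans this ?_
    split_ifs <;> simp
  c3 := by
    ext i j
    have := RingQuot.mkAlgHom_rel F (rel.cent_tb1 (n := n) i j)
    rw [Matrix.mul_apply, Matrix.one_apply]
    simp only [cr, Matrix.of_apply, mul_smul_comm]
    simp only [map_sum, map_smul, map_mul] at this
    refine Eq.trans this ?_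
    split_ifs <;> simp
  c4 := by
    ext i j
    have := RingQuot.mkAlgHom_rel F (rel.cent_tb2 (n := n) i j)
    rw [Matrix.mul_apply, Matrix.one_apply]
    simp only [cr, Matrix.of_apply, smul_mul_assoc]
    simp only [map_sum, map_smul, map_mul] at this
    refine Eq.trans this ?_
    split_ifs <;> simp

theorem RTT.map {A B : Type*} [Ring A] [Algebra F A] [Ring B] [Algebra F B] (f : A →ₐ[F] B) {X Y : Ix n → Ix n → A}
    (h : RTT n X Y) : RTT n (fun i j => f (X i j)) (fun i j => f (Y i j)) := by
  intro i a j b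
  have := congr_arg f (h i a j b)
  simpa only [map_sum, map_smul, map_mul] using this

theorem cr_map {A B : Type*} [Ring A] [Algebra F A] [Ring B] [Algebra F B] (f : A →ₐ[F] B) (T : Matrix (Ix n) (Ix n) A) :
    cr (T.map f) = (cr T).map f := by
  ext i j; simp [cr]

def Sol.map {A B : Type*} [Ring A] [Algebra F A] [Ring B] [Algebra F B] (f : A →ₐ[F] B) (S : Sol n A) : Sol n B where
  T := S.T.map f
  Tb := S.Tb.map f
  tu := fun i j h => by simp [S.tu i j h]
  bl := fun i j h => by simp [S.bl i j h]
  td := fun i => by simp only [Matrix.map_apply]; rw [← map_mul, S.td, map_one]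
  dt := fun i => by simp only [Matrix.map_apply]; rw [← map_mul, S.dt, map_one]
  tt := S.tt.map f
  bb := S.bb.map f
  bt := S.bt.map f
  c1 := by rw [cr_map, ← Matrix.map_mul, S.c1]; simp
  c2 := by rw [cr_map, ← Matrix.map_mul, S.c2]; simp
  c3 := by rw [cr_map, ← Matrix.map_mul, S.c3]; simp
  c4 := by rw [cr_map, ← Matrix.map_mul, S.c4]; simp

section prod
variable {A : Type*} [Ring A] [Algebra F A]
def j1 (X : Matrix (Ix n) (Ix n) A) : Matrix (Ix n × Ix n) (Ix n × Ix n) A := fun p s => if p.2 = s.2 then X p.1 s.1 else 0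
def j2 (X : Matrix (Ix n) (Ix n) A) : Matrix (Ix n × Ix n) (Ix n × Ix n) A := fun p s => if p.1 = s.1 then X p.2 s.2 else 0

theorem j1_mul (X Y : Matrix (Ix n) (Ix n) A) : j1 (X * Y) = j1 X * j1 Y := by
  ext ⟨i,a⟩ ⟨j,b⟩
  simp only [j1, Matrix.mul_apply, Fintype.sum_prod_type]
  by_cases h : a = b
  · subst h; simp
  · simp [h]
theorem j2_mul (X Y : Matrix (Ix n) (Ix n) A) : j2 (X * Y) = j2 X * j2 Y := by
  ext ⟨i,a⟩ ⟨j,b⟩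
  simp only [j2, Matrix.mul_apply, Fintype.sum_prod_type_right]
  by_cases h : i = j
  · subst h; simp
  · simp [h]
theorem j12_apply (X Y : Matrix (Ix n) (Ix n) A) (i a j b : Ix n) : (j1 X * j2 Y) (i,a) (j,b) = X i j * Y a b := by
  simp only [j1, j2, Matrix.mul_apply, Fintype.sum_prod_type]
  simp
theorem j21_apply (X Y : Matrix (Ix n) (Ix n) A) (i a j b : Ix n) : (j2 Y * j1 X) (i,a) (j,b) = Y a b * X i j := by
  simp only [j1, j2, Matrix.mul_apply, Fintype.sum_prod_type]
  simp
theorem j_comm (X Y : Matrix (Ix n) (Ix n) A) (h : ∀ i j a b, X i j * Y a b = Y a b * X i j) : j1 X * j2 Y = j2 Y * j1 X := by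
  ext ⟨i,a⟩ ⟨j,b⟩
  rw [j12_apply, j21_apply, h]

def RA (n : ℕ) (A : Type*) [Ring A] [Algebra F A] : Matrix (Ix n × Ix n) (Ix n × Ix n) A := fun p s => algebraMap F A (Rm n p s)

theorem RTT_iff (X Y : Matrix (Ix n) (Ix n) A) : RTT n X Y ↔ RA n A * (j1 X * j2 Y) = (j2 Y * j1 X) * RA n A := by
  constructor
  · intro h
    ext ⟨i,a⟩ ⟨j,b⟩
    rw [Matrix.mul_apply, Matrix.mul_apply, Fintype.sum_prod_type, Fintype.sum_prod_type_right]
    simp only [j12_apply, j21_apply, RA]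
    have := h i a j b
    simp only [Algebra.smul_def] at this
    rw [this]
    simp only [Algebra.commutes]
  · intro h i a j b
    have := congr_fun (congr_fun h (i,a)) (j,b)
    rw [Matrix.mul_apply, Matrix.mul_apply, Fintype.sum_prod_type, Fintype.sum_prod_type_right] at this
    simp only [j12_apply, j21_apply, RA] at this
    simp only [Algebra.smul_def]
    rw [this]
    simp only [Algebra.commutes]

theorem RTT.prod {X Y X' Y' : Matrix (Ix n) (Ix n) A} (h : RTT n X Y) (h' : RTT n X' Y')
    (c1 : ∀ i j a b, X' i j * Y a b = Y a b * X' i j) (c2 : ∀ i j a b, X i j * Y' a b = Y' a b * X i j) : RTT n (X * X') (Y * Y') := by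
  rw [RTT_iff] at *
  have e1 := j_comm _ _ c1
  have e2 := j_comm _ _ c2
  rw [j1_mul, j2_mul]
  calc RA n A * (j1 X * j1 X' * (j2 Y * j2 Y')) = RA n A * (j1 X * (j1 X' * j2 Y) * j2 Y') := by simp only [mul_assoc]
    _ = (RA n A * (j1 X * j2 Y)) * (j1 X' * j2 Y') := by rw [e1]; simp only [mul_assoc]
    _ = (j2 Y * j1 X) * (RA n A * (j1 X' * j2 Y')) := by rw [h]; simp only [mul_assoc]
    _ = j2 Y * (j1 X * j2 Y') * j1 X' * RA n A := by rw [h']; simp only [mul_assoc]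
    _ = _ := by rw [e2]; simp only [mul_assoc]

theorem crc_mul (k p j : Ix n) : crc n k p * crc n p j = crc n k j := by
  have h : dd n p ≠ 0 := zpow_ne_zero _ q_ne
  have h' : dd n j ≠ 0 := zpow_ne_zero _ q_ne
  have e := eps_sq n (pr n p)
  unfold crc
  field_simp
  linear_combination (dd n k * eps n (pr n k) * eps n (pr n j)) * e

theorem cr_prod (X Y : Matrix (Ix n) (Ix n) A) (c : ∀ i j a b, X i j * Y a b = Y a b * X i j) : cr (X * Y) = cr Y * cr X := by
  ext k j
  simp only [cr, Matrix.mul_apply, Finset.smul_sum]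
  rw [← Equiv.sum_comp (⟨pr n, pr n, pr_pr n, pr_pr n⟩ : Ix n ≃ Ix n)]
  refine Finset.sum_congr rfl fun p _ => ?_
  rw [smul_mul_smul_comm, crc_mul, c]; rfl

def Sol.prod (S S' : Sol n A) (h1 : ∀ i j a b, S.T i j * S'.T a b = S'.T a b * S.T i j)
    (h2 : ∀ i j a b, S.T i j * S'.Tb a b = S'.Tb a b * S.T i j)
    (h3 : ∀ i j a b, S.Tb i j * S'.T a b = S'.T a b * S.Tb i j)
    (h4 : ∀ i j a b, S.Tb i j * S'.Tb a b = S'.Tb a b * S.Tb i j) : Sol n A where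
  T := S.T * S'.T
  Tb := S.Tb * S'.Tb
  tu := fun i j h => by
    rw [Matrix.mul_apply]; refine Finset.sum_eq_zero fun k _ => ?_
    rcases lt_or_ge i k with hk | hk
    · rw [S.tu _ _ hk, zero_mul]
    · rw [S'.tu _ _ (lt_of_le_of_lt hk h), mul_zero]
  bl := fun i j h => by
    rw [Matrix.mul_apply]; refine Finset.sum_eq_zero fun k _ => ?_
    rcases lt_or_ge k i with hk | hk
    · rw [S.bl _ _ hk, zero_mul]
    · rw [S'.bl _ _ (lt_of_lt_of_le h hk), mul_zero]
  td := fun i => by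
    rw [Matrix.mul_apply, Matrix.mul_apply, Fintype.sum_eq_single i, Fintype.sum_eq_single i, mul_assoc, ← mul_assoc (S'.T i i), ← h3, mul_assoc (S.Tb i i), S'.td, mul_one, S.td]
    · intro k hk
      rcases lt_or_gt_of_ne hk with hk | hk
      · rw [S.bl _ _ hk, zero_mul]
      · rw [S'.bl _ _ hk, mul_zero]
    · intro k hk
      rcases lt_or_gt_of_ne hk with hk | hk
      · rw [S'.tu _ _ hk, mul_zero]
      · rw [S.tu _ _ hk, zero_mul]
  dt := fun i => by
    rw [Matrix.mul_apply, Matrix.mul_apply, Fintype.sum_eq_single i, Fintype.sum_eq_single i, mul_assoc, ← mul_assoc (S'.Tb i i), ← h2, mul_assoc (S.T i i), S'.dt, mul_one, S.dt]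
    · intro k hk
      rcases lt_or_gt_of_ne hk with hk | hk
      · rw [S'.tu _ _ hk, mul_zero]
      · rw [S.tu _ _ hk, zero_mul]
    · intro k hk
      rcases lt_or_gt_of_ne hk with hk | hk
      · rw [S.bl _ _ hk, zero_mul]
      · rw [S'.bl _ _ hk, mul_zero]
  tt := S.tt.prod S'.tt (fun i j a b => (h1 a b i j).symm) h1
  bb := S.bb.prod S'.bb (fun i j a b => (h4 a b i j).symm) h4
  bt := S.bt.prod S'.bt (fun i j a b => (h2 a b i j).symm) h3
  c1 := by rw [cr_prod _ _ h1, mul_assoc, ← mul_assoc S'.T, S'.c1, one_mul, S.c1]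
  c2 := by rw [cr_prod _ _ h1, mul_assoc, ← mul_assoc (cr S.T), S.c2, one_mul, S'.c2]
  c3 := by rw [cr_prod _ _ h4, mul_assoc, ← mul_assoc S'.Tb, S'.c3, one_mul, S.c3]
  c4 := by rw [cr_prod _ _ h4, mul_assoc, ← mul_assoc (cr S.Tb), S.c4, one_mul, S'.c4]
end prod
end
end

section
set_option synthInstance.maxHeartbeats 1000000
set_option maxHeartbeats 4000000
set_option linter.unusedSimpArgs false
set_option linter.unusedVariables false
set_option linter.unusedSectionVars false
section
variable {n : ℕ}
open Matrix Kronecker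

def blk (M : Matrix (Ix n × Ix n) (Ix n × Ix n) F) : Matrix (Ix n) (Ix n) (Matrix (Ix n) (Ix n) F) :=
  fun i j => fun x y => M (i,x) (j,y)
theorem blk_mul (M N : Matrix (Ix n × Ix n) (Ix n × Ix n) F) : blk (M * N) = blk M * blk N := by
  ext i j x y
  simp only [blk, Matrix.mul_apply, Matrix.sum_apply, Fintype.sum_prod_type]
theorem blk_one : blk (1 : Matrix (Ix n × Ix n) (Ix n × Ix n) F) = 1 := by
  ext i j x y
  simp only [blk, Matrix.one_apply, Prod.ext_iff]
  by_cases h : i = j <;> simp [h, Matrix.one_apply]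

theorem p1323_apply (M N : Matrix (Ix n × Ix n) (Ix n × Ix n) F) (k c z j b y : Ix n) :
    (p13 M * p23 N) (k,(c,z)) (j,(b,y)) = ∑ w, M (k,z) (j,w) * N (c,w) (b,y) := by
  rw [Matrix.mul_apply, Fintype.sum_prod_type, Fintype.sum_eq_single j, Fintype.sum_prod_type, Fintype.sum_eq_single c]
  · refine Finset.sum_congr rfl fun w _ => ?_
    rw [p13_apply, p23_apply]; simp
  · intro c' hc; refine Finset.sum_eq_zero fun w _ => ?_
    rw [p13_apply, if_neg hc.symm]; simp
  · intro j' hj; refine Finset.sum_eq_zero fun w _ => ?_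
    obtain ⟨w1, w2⟩ := w
    rw [p23_apply, if_neg hj]; simp
theorem p2313_apply (M N : Matrix (Ix n × Ix n) (Ix n × Ix n) F) (k c z j b y : Ix n) :
    (p23 N * p13 M) (k,(c,z)) (j,(b,y)) = ∑ w, N (c,z) (b,w) * M (k,w) (j,y) := by
  rw [Matrix.mul_apply, Fintype.sum_prod_type, Fintype.sum_eq_single k, Fintype.sum_prod_type, Fintype.sum_eq_single b]
  · refine Finset.sum_congr rfl fun w _ => ?_
    rw [p13_apply, p23_apply]; simp
  · intro c' hc; refine Finset.sum_eq_zero fun w _ => ?_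
    rw [p13_apply, if_neg hc]; simp
  · intro j' hj; refine Finset.sum_eq_zero fun w _ => ?_
    obtain ⟨w1, w2⟩ := w
    rw [p23_apply, if_neg hj.symm]; simp

theorem blk_RTT (M N : Matrix (Ix n × Ix n) (Ix n × Ix n) F)
    (h : p12 (Rz q n) * p13 M * p23 N = p23 N * p13 M * p12 (Rz q n)) : RTT n (blk M) (blk N) := by
  intro i a j b
  ext x y
  have := congr_fun (congr_fun h (i,a,x)) (j,b,y)
  rw [mul_assoc, Matrix.mul_apply, Matrix.mul_apply, Fintype.sum_prod_type, Fintype.sum_prod_type] at this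
  simp only [Matrix.sum_apply, Matrix.smul_apply, Matrix.mul_apply (M := blk _ _ _), smul_eq_mul]
  simp only [blk]
  have e1 : ∀ k : Ix n, ∑ c : Ix n × Ix n, p12 (Rz q n) (i,a,x) (k,c) * (p13 M * p23 N) (k,c) (j,b,y) =
      ∑ c, Rm n (i,a) (k,c) * ∑ w, M (k,x) (j,w) * N (c,w) (b,y) := by
    intro k
    rw [Fintype.sum_prod_type]
    refine Finset.sum_congr rfl fun c _ => ?_
    rw [Fintype.sum_eq_single x]
    · rw [p1323_apply, p12_apply, Rz_q]; simp
    · intro z hz; rw [p12_apply, if_neg hz.symm]; simp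
  have e2 : ∀ k : Ix n, ∑ c : Ix n × Ix n, (p23 N * p13 M) (i,a,x) (k,c) * p12 (Rz q n) (k,c) (j,b,y)  =
      ∑ c, Rm n (k,c) (j,b) * ∑ w, N (a,x) (c,w) * M (i,w) (k,y) := by
    intro k
    rw [Fintype.sum_prod_type]
    refine Finset.sum_congr rfl fun c _ => ?_
    rw [Fintype.sum_eq_single y]
    · rw [p2313_apply, p12_apply, Rz_q, mul_comm]; simp
    · intro z hz; rw [p12_apply, if_neg hz]; simp
  simp only [e1, e2] at this
  rw [this, Finset.sum_comm]

theorem p12_i (M N : Matrix (Ix n × Ix n) (Ix n × Ix n) F) (h : M * N = 1) : p12 M * p12 N = 1 := by rw [← p12_mul, h, p12_one]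
theorem p13_i (M N : Matrix (Ix n × Ix n) (Ix n × Ix n) F) (h : M * N = 1) : p13 M * p13 N = 1 := by rw [← p13_mul, h, p13_one]
theorem p23_i (M N : Matrix (Ix n × Ix n) (Ix n × Ix n) F) (h : M * N = 1) : p23 M * p23 N = 1 := by rw [← p23_mul, h, p23_one]

theorem sw_one : sw (1 : Matrix (Ix n × Ix n) (Ix n × Ix n) F) = 1 := by
  ext ⟨a,b⟩ ⟨c,d⟩; simp only [sw, Matrix.one_apply, Prod.ext_iff]; simp only [and_comm]
theorem sw_sw (M : Matrix (Ix n × Ix n) (Ix n × Ix n) F) : sw (sw M) = M := rfl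

/-- permutation (1,2,3) → (3,1,2) -/
def eA (n : ℕ) : I3 n ≃ I3 n where
  toFun x := (x.2.1, (x.2.2, x.1))
  invFun x := (x.2.2, (x.1, x.2.1))
  left_inv _ := rfl
  right_inv _ := rfl
/-- permutation swapping 2,3 -/
def eB (n : ℕ) : I3 n ≃ I3 n where
  toFun x := (x.1, (x.2.2, x.2.1))
  invFun x := (x.1, (x.2.2, x.2.1))
  left_inv _ := rfl
  right_inv _ := rfl

theorem ybeA {z : F} (hz : z ≠ 0) : p13 (sw (Rz z n)) * p23 (sw (Rz z n)) * p12 (Rz z n) = p12 (Rz z n) * p23 (sw (Rz z n)) * p13 (sw (Rz z n)) := by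
  have := congr_arg (Matrix.reindexAlgEquiv F F (eA n)) (ybe (n := n) hz)
  simp only [map_mul] at this
  have e1 : Matrix.reindexAlgEquiv F F (eA n) (p12 (Rz z n)) = p13 (sw (Rz z n)) := by
    ext ⟨x,y,w⟩ ⟨a,b,c⟩
    rw [p13_apply, Matrix.coe_reindexAlgEquiv, Matrix.reindex_apply, Matrix.submatrix_apply]
    exact p12_apply _ _ _ _ _ _ _
  have e2 : Matrix.reindexAlgEquiv F F (eA n) (p13 (Rz z n)) = p23 (sw (Rz z n)) := by
    ext ⟨x,y,w⟩ ⟨a,b,c⟩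
    rw [p23_apply, Matrix.coe_reindexAlgEquiv, Matrix.reindex_apply, Matrix.submatrix_apply]
    exact p13_apply _ _ _ _ _ _ _
  have e3 : Matrix.reindexAlgEquiv F F (eA n) (p23 (Rz z n)) = p12 (Rz z n) := by
    ext ⟨x,y,w⟩ ⟨a,b,c⟩
    rw [p12_apply, Matrix.coe_reindexAlgEquiv, Matrix.reindex_apply, Matrix.submatrix_apply]
    exact p23_apply _ _ _ _ _ _ _
  rw [e1, e2, e3] at this
  exact this
theorem ybeB {z : F} (hz : z ≠ 0) : p13 (Rz z n) * p12 (Rz z n) * p23 (sw (Rz z n)) = p23 (sw (Rz z n)) * p12 (Rz z n) * p13 (Rz z n) := by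
  have := congr_arg (Matrix.reindexAlgEquiv F F (eB n)) (ybe (n := n) hz)
  simp only [map_mul] at this
  have e1 : Matrix.reindexAlgEquiv F F (eB n) (p12 (Rz z n)) = p13 (Rz z n) := by
    ext ⟨x,y,w⟩ ⟨a,b,c⟩
    rw [p13_apply, Matrix.coe_reindexAlgEquiv, Matrix.reindex_apply, Matrix.submatrix_apply]
    exact p12_apply _ _ _ _ _ _ _
  have e2 : Matrix.reindexAlgEquiv F F (eB n) (p13 (Rz z n)) = p12 (Rz z n) := by
    ext ⟨x,y,w⟩ ⟨a,b,c⟩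
    rw [p12_apply, Matrix.coe_reindexAlgEquiv, Matrix.reindex_apply, Matrix.submatrix_apply]
    exact p13_apply _ _ _ _ _ _ _
  have e3 : Matrix.reindexAlgEquiv F F (eB n) (p23 (Rz z n)) = p23 (sw (Rz z n)) := by
    ext ⟨x,y,w⟩ ⟨a,b,c⟩
    rw [p23_apply, Matrix.coe_reindexAlgEquiv, Matrix.reindex_apply, Matrix.submatrix_apply]
    exact p23_apply _ _ _ _ _ _ _
  rw [e1, e2, e3] at this
  exact this

theorem Rq_i : Rz q n * Rz q⁻¹ n = 1 := by
  have := Rz_inv (n := n) (inv_ne_zero q_ne)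
  rwa [inv_inv] at this
theorem Rq_i' : Rz q⁻¹ n * Rz q n = 1 := Rz_inv q_ne

theorem inv_step {A : Type*} [Ring A] {x y z x' : A} (h : x * y * z = z * y * x) (h1 : x' * x = 1) (h2 : x * x' = 1) : y * z * x' = x' * z * y := by
  calc y * z * x' = (x' * x) * y * z * x' := by rw [h1, one_mul]
    _ = x' * (x * y * z) * x' := by simp only [mul_assoc]
    _ = x' * z * y * (x * x') := by rw [h]; simp only [mul_assoc]
    _ = _ := by rw [h2, mul_one]

theorem vec_tt : RTT n (blk (sw (Rz q⁻¹ n))) (blk (sw (Rz q⁻¹ n))) := by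
  apply blk_RTT
  have s1 : sw (Rz q⁻¹ n) * sw (Rz q n) = 1 := by rw [← sw_mul, Rq_i', sw_one]
  have s2 : sw (Rz q n) * sw (Rz q⁻¹ n) = 1 := by rw [← sw_mul, Rq_i, sw_one]
  have h := ybeA (n := n) q_ne
  have h1 := inv_step h (p13_i _ _ s1) (p13_i _ _ s2)
  have h2 := inv_step h1 (p23_i _ _ s1) (p23_i _ _ s2)
  exact h2
theorem vec_bt : RTT n (blk (Rz q n)) (blk (sw (Rz q⁻¹ n))) := by
  apply blk_RTT
  have s1 : sw (Rz q⁻¹ n) * sw (Rz q n) = 1 := by rw [← sw_mul, Rq_i', sw_one]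
  have s2 : sw (Rz q n) * sw (Rz q⁻¹ n) = 1 := by rw [← sw_mul, Rq_i, sw_one]
  have h := ybeB (n := n) q_ne
  exact inv_step h.symm (p23_i _ _ s1) (p23_i _ _ s2)
theorem vec_bb : RTT n (blk (Rz q n)) (blk (Rz q n)) := blk_RTT _ _ (ybe q_ne)

theorem bar_pr' (i : Ix n) : bar n (pr n i) = - bar n i := by
  have := i.isLt
  unfold bar; rw [pr_val]; split_ifs <;> omega
theorem crc_eq (k j : Ix n) : crc n k j = q ^ (bar n k - bar n j) * eps n k * eps n j := by
  unfold crc dd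
  rw [← div_eq_mul_inv, ← zpow_sub₀ q_ne]
  have : ∀ i, eps n (pr n i) = - eps n i := by
    intro i; have := i.isLt; unfold eps; rw [pr_val]; split_ifs <;> first | omega | simp
  rw [this, this]; ring

theorem crc_self (k : Ix n) : crc n k k = 1 := by
  rw [crc_eq, sub_self, zpow_zero, one_mul, eps_sq]

theorem cross_b (k j x y : Ix n) : crc n k j * Rz q n (pr n j, x) (pr n k, y) = Rz q⁻¹ n (k,x) (j,y) := by
  simp only [Rz, inv_inv]
  have e : ∀ a b : Ix n, pr n a = b ↔ a = pr n b := fun a b => ⟨fun h => by rw [← h, pr_pr], fun h => by rw [h, pr_pr]⟩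
  have l : ∀ a b : Ix n, pr n a < pr n b ↔ b < a := fun a b => by
    have := a.isLt; have := b.isLt
    rw [Fin.lt_def, Fin.lt_def, pr_val, pr_val]; omega
  have hc := crc_eq k j
  have t1 : crc n k j * (if pr n j = pr n k ∧ x = y then
      q ^ ((if pr n j = x then (1:ℤ) else 0) - (if pr n j = pr n x then (1:ℤ) else 0)) else 0) =
      (if k = j ∧ x = y then q⁻¹ ^ ((if k = x then (1:ℤ) else 0) - (if k = pr n x then (1:ℤ) else 0)) else 0) := by
    by_cases h : k = j ∧ x = y
    · obtain ⟨rfl, rfl⟩ := h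
      rw [crc_self, one_mul, if_pos (And.intro rfl rfl), if_pos (And.intro rfl rfl), _root_.inv_zpow', neg_sub]
      simp only [e, pr_pr]
    · rw [if_neg, if_neg h, mul_zero]
      rintro ⟨h1, h2⟩; rw [e, pr_pr] at h1; exact h ⟨h1.symm, h2⟩
  have t2 : crc n k j * (if pr n j < pr n k ∧ x = pr n (pr n j) ∧ y = pr n (pr n k) then
      (q - q⁻¹) * q ^ (bar n (pr n k) - bar n (pr n j)) * eps n (pr n j) * eps n (pr n k) else 0) =
      - (if k < x ∧ j = x ∧ y = k then q⁻¹ - q else 0) := by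
    by_cases h : k < x ∧ j = x ∧ y = k
    · obtain ⟨h1, rfl, rfl⟩ := h
      rw [if_pos (And.intro h1 (And.intro rfl rfl)), if_pos (And.intro ((l _ _).2 h1) (And.intro (pr_pr n _).symm (pr_pr n _).symm)), hc, bar_pr', bar_pr', eps_pr, eps_pr]
      have := eps_sq n j; have h3 := eps_sq n y
      rw [show -bar n y - -bar n j = -(bar n y - bar n j) by ring, _root_.zpow_neg]
      have h4 : q ^ (bar n y - bar n j) ≠ 0 := zpow_ne_zero _ q_ne
      generalize q ^ (bar n y - bar n j) = Q at *
      have h5 : Q * Q⁻¹ = 1 := mul_inv_cancel₀ h4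
      linear_combination (q - q⁻¹) * (Q * Q⁻¹ * eps n y^2 * this + Q * Q⁻¹ * h3 + h5)
    · rw [if_neg h, if_neg, mul_zero, neg_zero]
      rintro ⟨h1, h2, h3⟩
      rw [pr_pr] at h2 h3; rw [l] at h1
      exact h ⟨by rw [h2]; exact h1, h2.symm, h3⟩
  have t3 : crc n k j * (if pr n j < x ∧ pr n k = x ∧ y = pr n j then q - q⁻¹ else 0) =
      - (if k < j ∧ x = pr n k ∧ y = pr n j then (q⁻¹ - q) * q⁻¹ ^ (bar n j - bar n k) * eps n k * eps n j else 0) := by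
    by_cases h : k < j ∧ x = pr n k ∧ y = pr n j
    · obtain ⟨h1, rfl, rfl⟩ := h
      rw [if_pos (And.intro h1 (And.intro rfl rfl)), if_pos (And.intro ((l _ _).2 h1) (And.intro rfl rfl)), hc, _root_.inv_zpow', neg_sub]
      ring
    · rw [if_neg h, if_neg, mul_zero, neg_zero]
      rintro ⟨h1, h2, h3⟩
      rw [← h2, l] at h1
      exact h ⟨h1, h2.symm, h3⟩
  linear_combination t1 - t2 + t3

theorem crc_pr (k j : Ix n) : crc n k j * crc n (pr n k) (pr n j) = 1 := by
  rw [crc_eq, crc_eq, bar_pr', bar_pr', eps_pr, eps_pr]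
  have := eps_sq n j; have h3 := eps_sq n k
  rw [show -bar n k - -bar n j = -(bar n k - bar n j) by ring, _root_.zpow_neg]
  have h4 : q ^ (bar n k - bar n j) ≠ 0 := zpow_ne_zero _ q_ne
  generalize q ^ (bar n k - bar n j) = Q at *
  have h5 : Q * Q⁻¹ = 1 := mul_inv_cancel₀ h4
  linear_combination (Q * Q⁻¹ * eps n k^2 * this + Q * Q⁻¹ * h3 + h5)

theorem cross_t (k j x y : Ix n) : crc n k j * Rz q⁻¹ n (x, pr n j) (y, pr n k) = Rz q n (x,k) (y,j) := by
  rw [Rz_symm, ← cross_b, ← mul_assoc, crc_pr, one_mul, pr_pr, pr_pr, Rz_symm]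

theorem cr_b : cr (blk (Rz q n)) = blk (Rz q⁻¹ n) := by
  ext k j x y
  exact cross_b k j x y
theorem cr_t : cr (blk (sw (Rz q⁻¹ n))) = blk (sw (Rz q n)) := by
  ext k j x y
  exact cross_t k j x y

theorem Rz_diag1 (z : F) (i : Ix n) : blk (Rz z n) i i = Matrix.diagonal (dg z i) := by
  ext x y
  simp only [blk, Rz, Matrix.diagonal_apply, dg]
  rw [if_neg (c := i < x ∧ i = x ∧ y = i) (by rintro ⟨h, rfl, _⟩; exact lt_irrefl _ h), if_neg (c := i < i ∧ _) (by rintro ⟨h, _⟩; exact lt_irrefl _ h)]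
  simp
theorem dg_comm (z : F) (a b : Ix n) : dg z a b = dg z b a := by
  unfold dg
  have h1 : (if a = b then (1:ℤ) else 0) = if b = a then 1 else 0 := if_congr eq_comm rfl rfl
  have h2 : (if a = pr n b then (1:ℤ) else 0) = if b = pr n a then 1 else 0 :=
    if_congr ⟨fun h => by rw [h, pr_pr], fun h => by rw [h, pr_pr]⟩ rfl rfl
  rw [h1, h2]
theorem pr_inj {a b : Ix n} (h : pr n a = pr n b) : a = b := by rw [← pr_pr n a, h, pr_pr]
theorem Rz_diag2 (z : F) (i : Ix n) : blk (sw (Rz z n)) i i = Matrix.diagonal (dg z i) := by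
  ext x y
  simp only [blk, sw, Rz, Matrix.diagonal_apply, dg]
  rw [if_neg (c := x < i ∧ y = i ∧ i = x) (by rintro ⟨h, _, rfl⟩; exact lt_irrefl _ h), if_neg (c := x < y ∧ _) (by rintro ⟨h, h1, h2⟩; rw [h1] at h2; rw [pr_inj h2] at h; exact lt_irrefl _ h)]
  have := dg_comm z x i
  unfold dg at this
  by_cases h : x = y
  · subst h; simp only [and_self, if_true, add_zero, sub_zero]; exact this
  · simp [h]
theorem dg_inv {z : F} (hz : z ≠ 0) (a b : Ix n) : dg z⁻¹ a b * dg z a b = 1 := by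
  unfold dg; rw [_root_.inv_zpow, inv_mul_cancel₀ (zpow_ne_zero _ hz)]

def vecSol (n : ℕ) : Sol n (Matrix (Ix n) (Ix n) F) where
  T := blk (sw (Rz q⁻¹ n))
  Tb := blk (Rz q n)
  tu := by
    intro i j h
    ext x y
    simp only [blk, sw, Rz, Matrix.zero_apply]
    rw [if_neg, if_neg, if_neg]
    · simp
    · rintro ⟨h1, h2, h3⟩
      subst h2; subst h3
      rw [Fin.lt_def, pr_val, pr_val] at h
      rw [Fin.lt_def] at h1
      omega
    · rintro ⟨h1, h2, h3⟩; rw [← h3] at h1; exact lt_asymm h h1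
    · rintro ⟨h1, h2⟩; exact h.ne h2
  bl := by
    intro i j h
    ext x y
    simp only [blk, Rz, Matrix.zero_apply]
    rw [if_neg, if_neg, if_neg]
    · simp
    · rintro ⟨h1, h2, h3⟩; exact lt_asymm h h1
    · rintro ⟨h1, h2, h3⟩; rw [← h2] at h1; exact lt_asymm h h1
    · rintro ⟨h1, h2⟩; exact h.ne h1.symm
  td := by
    intro i
    rw [Rz_diag1, Rz_diag2, Matrix.diagonal_mul_diagonal]
    simp only [dg_inv q_ne]; rfl
  dt := by
    intro i
    rw [Rz_diag1, Rz_diag2, Matrix.diagonal_mul_diagonal]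
    simp only [mul_comm (dg q _ _), dg_inv q_ne]; rfl
  tt := vec_tt
  bb := vec_bb
  bt := vec_bt
  c1 := by rw [cr_t, ← blk_mul, ← sw_mul, Rq_i', sw_one, blk_one]
  c2 := by rw [cr_t, ← blk_mul, ← sw_mul, Rq_i, sw_one, blk_one]
  c3 := by rw [cr_b, ← blk_mul, Rq_i, blk_one]
  c4 := by rw [cr_b, ← blk_mul, Rq_i', blk_one]

theorem cr_one : cr (1 : Matrix (Ix n) (Ix n) F) = 1 := by
  ext k j
  simp only [cr, Matrix.one_apply]
  by_cases h : k = j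
  · subst h; simp [crc_self]
  · rw [if_neg h, if_neg]; simp
    exact fun h' => h (pr_inj h').symm
theorem cmap (M : Matrix (Ix n) (Ix n) F) (u : Usp n) : AlgHom.mapMatrix (Algebra.ofId F (Usp n)) M * Matrix.scalarAlgHom (Ix n) F u =
    Matrix.scalarAlgHom (Ix n) F u * AlgHom.mapMatrix (Algebra.ofId F (Usp n)) M := by
  ext x y
  simp [Algebra.ofId_apply, Algebra.commutes]

def cuSol (n : ℕ) : Sol n F where
  T := 1
  Tb := 1
  tu := fun i j h => Matrix.one_apply_ne h.ne
  bl := fun i j h => Matrix.one_apply_ne h.ne'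
  td := fun i => by simp
  dt := fun i => by simp
  tt := by
    rw [RTT_iff]
    have e1 : j1 (1 : Matrix (Ix n) (Ix n) F) = 1 := by
      ext ⟨a,b⟩ ⟨c,d⟩; simp only [j1, Matrix.one_apply, Prod.ext_iff]; by_cases h : b = d <;> simp [h]
    have e2 : j2 (1 : Matrix (Ix n) (Ix n) F) = 1 := by
      ext ⟨a,b⟩ ⟨c,d⟩; simp only [j2, Matrix.one_apply, Prod.ext_iff]; by_cases h : a = c <;> simp [h]
    rw [e1, e2]; simp
  bb := by
    rw [RTT_iff]
    have e1 : j1 (1 : Matrix (Ix n) (Ix n) F) = 1 := by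
      ext ⟨a,b⟩ ⟨c,d⟩; simp only [j1, Matrix.one_apply, Prod.ext_iff]; by_cases h : b = d <;> simp [h]
    have e2 : j2 (1 : Matrix (Ix n) (Ix n) F) = 1 := by
      ext ⟨a,b⟩ ⟨c,d⟩; simp only [j2, Matrix.one_apply, Prod.ext_iff]; by_cases h : a = c <;> simp [h]
    rw [e1, e2]; simp
  bt := by
    rw [RTT_iff]
    have e1 : j1 (1 : Matrix (Ix n) (Ix n) F) = 1 := by
      ext ⟨a,b⟩ ⟨c,d⟩; simp only [j1, Matrix.one_apply, Prod.ext_iff]; by_cases h : b = d <;> simp [h]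
    have e2 : j2 (1 : Matrix (Ix n) (Ix n) F) = 1 := by
      ext ⟨a,b⟩ ⟨c,d⟩; simp only [j2, Matrix.one_apply, Prod.ext_iff]; by_cases h : a = c <;> simp [h]
    rw [e1, e2]; simp
  c1 := by rw [cr_one, one_mul]
  c2 := by rw [cr_one, one_mul]
  c3 := by rw [cr_one, one_mul]
  c4 := by rw [cr_one, one_mul]

def dSol (n : ℕ) : Sol n (Matrix (Ix n) (Ix n) (Usp n)) :=
  Sol.prod ((vecSol n).map (AlgHom.mapMatrix (Algebra.ofId F (Usp n)))) ((tautSol n).map (Matrix.scalarAlgHom (Ix n) F))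
   (fun i j a b => cmap _ _) (fun i j a b => cmap _ _) (fun i j a b => cmap _ _) (fun i j a b => cmap _ _)
end
end

section
set_option synthInstance.maxHeartbeats 1000000
set_option maxHeartbeats 4000000
set_option linter.unusedSimpArgs false
set_option linter.unusedVariables false
set_option linter.unusedSectionVars false
section
variable {n : ℕ}
open Matrix Kronecker

theorem vec_K (i : Fin n) : (vecSol n).hom (Ku n i) = km q⁻¹ i := by
  rw [Ku, map_mul, Sol.hom_t, Sol.hom_tb]
  simp only [vecSol]
  rw [Rz_diag1, Rz_diag2, Matrix.diagonal_mul_diagonal, km]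
  congr 1
  funext a
  have v1 := lo_val i; have v2 := hi_val i; have := i.isLt; have := a.isLt
  unfold ka dg zi
  simp only [Fin.ext_iff, pr_val, v1, v2]
  have hq := q_ne
  split_ifs <;> first | omega | (simp only [sub_zero, zero_sub, sub_self, zpow_zero, zpow_one, mul_one, one_mul, _root_.zpow_neg_one, inv_inv, _root_.zpow_neg]; try field_simp)

theorem vec_F (i : Fin n) : (vecSol n).hom (Fh n i) = fm i := by
  rw [Fh, map_smul, Fu, map_mul, Sol.hom_t, Sol.hom_tb]
  simp only [vecSol]
  rw [Rz_diag1]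
  ext x a
  rw [Matrix.smul_apply, Matrix.mul_diagonal, smul_eq_mul, inv_mul_eq_div, div_eq_iff (qi_sub_ne i)]
  have e0 : blk (sw (Rz q⁻¹ n)) (hi i) (lo i) x a = Rz q⁻¹ n (x, hi i) (a, lo i) := rfl
  rw [e0]
  have v1 := lo_val i; have v2 := hi_val i; have hi' := i.isLt; have ha := a.isLt; have hx := x.isLt
  have hq := q_ne
  have e1 : Rz q⁻¹ n (x, hi i) (a, lo i) = (if x = lo i ∧ a = hi i then q⁻¹ - q else 0)
      - (if x = pr n (hi i) ∧ a = pr n (lo i) then (q⁻¹ - q) * q⁻¹ ^ (bar n a - bar n x) * eps n x * eps n a else 0) := by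
    have c1 : ¬ (x = a ∧ hi i = lo i) := fun h => (lo_lt_hi i).ne' h.2
    have c2 : (x < hi i ∧ a = hi i ∧ lo i = x) ↔ (x = lo i ∧ a = hi i) :=
      ⟨fun h => ⟨h.2.2.symm, h.2.1⟩, fun h => ⟨h.1 ▸ lo_lt_hi i, h.2, h.1.symm⟩⟩
    have c3 : (x < a ∧ hi i = pr n x ∧ lo i = pr n a) ↔ (x = pr n (hi i) ∧ a = pr n (lo i)) := by
      constructor
      · rintro ⟨_, h1, h2⟩; exact ⟨by rw [h1, pr_pr], by rw [h2, pr_pr]⟩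
      · rintro ⟨h1, h2⟩; subst h1; subst h2
        refine ⟨?_, (pr_pr n _).symm, (pr_pr n _).symm⟩
        rw [Fin.lt_def, pr_val, pr_val]; omega
    simp only [Rz, if_neg c1, c2, c3, inv_inv, zero_add]
  rw [e1, fm, dg, qi]
  by_cases h1 : a = hi i
  · have hp : ph i a = -1 := by rw [ph, if_pos h1]
    have hs : sg i a = lo i := by rw [sg, if_pos h1]
    rw [hp, hs]
    have h0 : ¬ lo i = a := by rw [h1]; exact (lo_lt_hi i).ne
    rw [if_neg h0]
    by_cases h2 : x = lo i
    · rw [if_pos (And.intro h2 h1), if_pos h2]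
      by_cases h3 : (i:ℕ) + 1 < n
      · rw [if_neg (c := x = pr n (hi i) ∧ a = pr n (lo i)), if_neg (c := lo i = pr n a), if_pos h3]
        · simp
        · rw [h1, Fin.ext_iff, pr_val]; omega
        · rw [h2, Fin.ext_iff, pr_val]; omega
      · have h4 : i.val + 1 = n := by omega
        rw [if_pos (c := x = pr n (hi i) ∧ a = pr n (lo i)), if_pos (c := lo i = pr n a), if_neg h3]
        · have b1 : bar n a - bar n x = -2 := by
            unfold bar; rw [h1, h2, v1, v2, if_neg (by omega), if_pos (by omega)]; push_cast; ring
          have b2 : eps n x = 1 := by unfold eps; rw [h2, v1, if_pos (by omega)]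
          have b3 : eps n a = -1 := by unfold eps; rw [h1, v2, if_neg (by omega)]
          rw [b1, b2, b3]
          rw [show (q⁻¹ : F) ^ (-2:ℤ) = q^2 by rw [_root_.zpow_neg, _root_.inv_zpow, inv_inv]; rfl, show (0:ℤ) - 1 = -1 by rfl, _root_.zpow_neg_one]
          field_simp
          ring
        · rw [h1, Fin.ext_iff, pr_val]; omega
        · rw [h1, h2, Fin.ext_iff, Fin.ext_iff, pr_val, pr_val]; omega
    · rw [if_neg (c := x = lo i ∧ a = hi i) (fun h => h2 h.1), if_neg h2, if_neg]
      · simp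
      · rintro ⟨h3, h4⟩
        apply h2; rw [h1] at h4
        rw [Fin.ext_iff, pr_val] at *; omega
  · have hs : sg i a = pr n (hi i) := by rw [sg, if_neg h1]
    rw [hs, if_neg (c := x = lo i ∧ a = hi i) (fun h => h1 h.2)]
    by_cases h2 : a = pr n (lo i)
    · have hp : ph i a = 1 := by rw [ph, if_neg h1, if_pos h2]
      have h5 : (i:ℕ) + 1 < n := by
        rw [h2, Fin.ext_iff, pr_val] at h1; omega
      rw [hp, if_pos h5]
      by_cases h3 : x = pr n (hi i)
      · rw [if_pos (And.intro h3 h2), if_pos h3, if_neg (c := lo i = a), if_pos (c := lo i = pr n a)]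
        · have b1 : bar n a - bar n x = -1 := by
            unfold bar; rw [h2, h3, pr_val, pr_val, v1, v2, if_neg (by omega), if_neg (by omega)]; omega
          have b2 : eps n x = -1 := by unfold eps; rw [h3, pr_val, v2, if_neg (by omega)]
          have b3 : eps n a = -1 := by unfold eps; rw [h2, pr_val, v1, if_neg (by omega)]
          rw [b1, b2, b3, show (0:ℤ) - 1 = -1 by rfl, _root_.zpow_neg_one, _root_.zpow_neg_one]
          field_simp
          ring
        · rw [h2, pr_pr]
        · rw [h2, Fin.ext_iff, pr_val]; omega
      · rw [if_neg (fun h => h3 h.1), if_neg h3]; simp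
    · have hp : ph i a = 0 := by rw [ph, if_neg h1, if_neg h2]
      rw [hp, if_neg (fun h => h2 h.2)]; simp

theorem dSol_T (i j : Ix n) : (dSol n).T i j = ∑ k, (AlgHom.mapMatrix (Algebra.ofId F (Usp n)) ((vecSol n).T i k)) * Matrix.scalarAlgHom (Ix n) F (tU n k j) := by
  simp only [dSol, Sol.prod, Sol.map, tautSol]
  rw [Matrix.mul_apply]; rfl
theorem dSol_Tb (i j : Ix n) : (dSol n).Tb i j = ∑ k, (AlgHom.mapMatrix (Algebra.ofId F (Usp n)) ((vecSol n).Tb i k)) * Matrix.scalarAlgHom (Ix n) F (tbU n k j) := by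
  simp only [dSol, Sol.prod, Sol.map, tautSol]
  rw [Matrix.mul_apply]; rfl

theorem dSol_F (i : Fin n) : (dSol n).hom (Fh n i) = AlgHom.mapMatrix (Algebra.ofId F (Usp n)) (fm i) +
    AlgHom.mapMatrix (Algebra.ofId F (Usp n)) (km q⁻¹ i) * Matrix.scalarAlgHom (Ix n) F (Fh n i) := by
  rw [← vec_F, ← vec_K, Fh, map_smul, Fu, map_mul, map_smul, Ku, map_mul (vecSol n).hom, map_mul (vecSol n).hom, map_smul, map_smul]
  simp only [Sol.hom_t, Sol.hom_tb, dSol_T, dSol_Tb]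
  have e1 : ∑ k, (AlgHom.mapMatrix (Algebra.ofId F (Usp n)) ((vecSol n).T (hi i) k)) * Matrix.scalarAlgHom (Ix n) F (tU n k (lo i)) =
     (AlgHom.mapMatrix (Algebra.ofId F (Usp n)) ((vecSol n).T (hi i) (lo i))) * Matrix.scalarAlgHom (Ix n) F (tU n (lo i) (lo i)) +
     (AlgHom.mapMatrix (Algebra.ofId F (Usp n)) ((vecSol n).T (hi i) (hi i))) * Matrix.scalarAlgHom (Ix n) F (tU n (hi i) (lo i)) := by
    have hne : lo i ≠ hi i := (lo_lt_hi i).ne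
    apply Fintype.sum_eq_add _ _ hne
    rintro k ⟨h1, h2⟩
    rcases lt_or_gt_of_ne h1 with h | h
    · rw [tU_upper n _ _ h, map_zero, mul_zero]
    · have : hi i < k := by
        rw [Fin.lt_def, hi_val]; rw [Fin.lt_def, lo_val] at h
        have : k.val ≠ i.val + 1 := fun h' => h2 (Fin.ext h')
        omega
      rw [(vecSol n).tu _ _ this, map_zero, zero_mul]
  have e2 : ∑ k, (AlgHom.mapMatrix (Algebra.ofId F (Usp n)) ((vecSol n).Tb (lo i) k)) * Matrix.scalarAlgHom (Ix n) F (tbU n k (lo i)) =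
     (AlgHom.mapMatrix (Algebra.ofId F (Usp n)) ((vecSol n).Tb (lo i) (lo i))) * Matrix.scalarAlgHom (Ix n) F (tbU n (lo i) (lo i)) := by
    apply Fintype.sum_eq_single
    intro k hk
    rcases lt_or_gt_of_ne hk with h | h
    · rw [(vecSol n).bl _ _ h, map_zero, zero_mul]
    · rw [tbU_lower n _ _ h, map_zero, mul_zero]
  rw [e1, e2]
  have e3 : Matrix.scalarAlgHom (Ix n) F (tU n (lo i) (lo i)) * Matrix.scalarAlgHom (Ix n) F (tbU n (lo i) (lo i)) = 1 := by
    rw [← map_mul, t_tb, map_one]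
  have c := cmap (n := n)
  simp only [map_mul]
  rw [add_mul, smul_add]
  congr 1
  · rw [mul_assoc, ← mul_assoc (Matrix.scalarAlgHom (Ix n) F (tU n (lo i) (lo i))), ← c, mul_assoc _ _ (Matrix.scalarAlgHom (Ix n) F (tbU n (lo i) (lo i))), e3, mul_one]
  · rw [mul_assoc, ← mul_assoc (Matrix.scalarAlgHom (Ix n) F (tU n (hi i) (lo i))), ← c, mul_smul_comm]
    simp only [mul_assoc]

theorem cu_F (i : Fin n) : (cuSol n).hom (Fh n i) = 0 := by
  rw [Fh, map_smul, Fu, map_mul, Sol.hom_t, (show (cuSol n).T (hi i) (lo i) = 0 from Matrix.one_apply_ne (lo_lt_hi i).ne'), zero_mul, smul_zero]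

/-- quantum coproduct on the free algebra -/
def Dq (n : ℕ) : FB n →ₐ[F] Matrix (Ix n) (Ix n) (FB n) :=
  FreeAlgebra.lift F fun i => AlgHom.mapMatrix (Algebra.ofId F (FB n)) (fm i) +
    AlgHom.mapMatrix (Algebra.ofId F (FB n)) (km q⁻¹ i) * Matrix.scalarAlgHom (Ix n) F (FreeAlgebra.ι F i)

def evF (n : ℕ) : FB n →ₐ[F] Usp n := FreeAlgebra.lift F (Fh n)

theorem evF_Dq (u : FB n) : (AlgHom.mapMatrix (evF n)) (Dq n u) = (dSol n).hom (evF n u) := by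
  have : (AlgHom.mapMatrix (evF n)).comp (Dq n) = ((dSol n).hom).comp (evF n) := by
    apply FreeAlgebra.hom_ext
    funext i
    simp only [Function.comp, AlgHom.comp_apply, Dq, FreeAlgebra.lift_ι_apply, map_add, map_mul]
    rw [evF, FreeAlgebra.lift_ι_apply, dSol_F]
    have e1 : ∀ M : Matrix (Ix n) (Ix n) F, (FreeAlgebra.lift F (Fh n)).mapMatrix (AlgHom.mapMatrix (Algebra.ofId F (FB n)) M) = AlgHom.mapMatrix (Algebra.ofId F (Usp n)) M := by
      intro M; ext x y; simp [Algebra.ofId_apply]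
    rw [e1, e1]
    congr 2
    ext x y
    by_cases h : x = y <;> simp [h, Matrix.scalarAlgHom_apply, Matrix.scalar_apply]
  exact DFunLike.congr_fun this u

theorem ker_Dq (u : FB n) (h : evF n u = 0) (x y : Ix n) : evF n (Dq n u x y) = 0 := by
  have := evF_Dq u
  rw [h, map_zero] at this
  exact congr_fun (congr_fun this x) y

theorem ker_const (u : FB n) (h : evF n u = 0) : FreeAlgebra.lift F (fun _ : Fin n => (0:F)) u = 0 := by
  have : ((cuSol n).hom).comp (evF n) = FreeAlgebra.lift F (fun _ : Fin n => (0:F)) := by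
    apply FreeAlgebra.hom_ext
    funext i
    simp [evF, cu_F]
  rw [← this, AlgHom.comp_apply, h, map_zero]
end
end

section
set_option linter.unusedSimpArgs false
set_option linter.unusedVariables false
set_option linter.unusedSectionVars false
section
attribute [local instance] LieRing.ofAssociativeRing LieAlgebra.ofAssociativeAlgebra
variable {A : Type*} [Ring A] [Algebra ℂ A]

/-- Classical Serre relations of type C (in Lie form). -/
structure CS (n : ℕ) (f : ℕ → A) : Prop where
  comm : ∀ i j, i + 2 ≤ j → ⁅f i, f j⁆ = 0
  serre : ∀ i j, (i + 1 = j ∨ j + 1 = i) → ¬ (i + 2 = n ∧ j + 1 = n) → ⁅f i, ⁅f i, f j⁆⁆ = 0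
  quartic : ∀ i j, i + 2 = n → j + 1 = n → ⁅f i, ⁅f i, ⁅f i, f j⁆⁆⁆ = 0

def rho (n i : ℕ) : ℕ := if i ≤ n then i - 1 else 2 * n - 1 - i

/-- Root vectors. -/
def rv (n : ℕ) (f : ℕ → A) (j : ℕ) : ℕ → A
  | 0 => f j
  | m + 1 => ⁅f (rho n (j + m + 2)), rv n f j m⁆

variable {n : ℕ} {f : ℕ → A}

theorem CS.comm' (h : CS n f) {i j : ℕ} (hij : i + 2 ≤ j ∨ j + 2 ≤ i) : ⁅f i, f j⁆ = 0 := by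
  rcases hij with hij | hij
  · exact h.comm i j hij
  · rw [← lie_skew, h.comm j i hij, neg_zero]

theorem lie_pass {x p r : A} (h1 : ⁅x, p⁆ = 0) (h2 : ⁅x, r⁆ = 0) : ⁅x, ⁅p, r⁆⁆ = 0 := by
  rw [leibniz_lie, h1, h2, zero_lie, lie_zero, add_zero]

theorem two_zero {x : A} (h : x = -x) : x = 0 := by
  have h2 : (2:ℂ) • x = 0 := by rw [two_smul]; nth_rewrite 1 [h]; simp
  exact (smul_eq_zero_iff_right (two_ne_zero)).1 h2

theorem lie_trick {Q P R : A} (h1 : ⁅P, R⁆ = 0) (h2 : ⁅Q, ⁅Q, R⁆⁆ = 0) (h3 : ⁅Q, ⁅Q, P⁆⁆ = 0) :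
    ⁅Q, ⁅P, ⁅Q, R⁆⁆⁆ = 0 := by
  apply two_zero
  have e1 : ⁅Q, ⁅P, ⁅Q, R⁆⁆⁆ = ⁅⁅Q, P⁆, ⁅Q, R⁆⁆ := by rw [leibniz_lie Q P, h2, lie_zero, add_zero]
  have e2 : ⁅⁅Q, P⁆, R⁆ = - ⁅P, ⁅Q, R⁆⁆ := by rw [lie_lie, h1, lie_zero, zero_sub]
  have e3 : ⁅⁅Q, P⁆, Q⁆ = 0 := by rw [← lie_skew, h3, neg_zero]
  have e4 : ⁅⁅Q, P⁆, ⁅Q, R⁆⁆ = - ⁅Q, ⁅P, ⁅Q, R⁆⁆⁆ := by rw [leibniz_lie, e3, zero_lie, zero_add, e2, lie_neg]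
  exact e1.trans e4

theorem lie_pp {Q P R : A} (h1 : ⁅P, R⁆ = 0) (h3 : ⁅P, ⁅P, Q⁆⁆ = 0) :
    ⁅P, ⁅P, ⁅Q, R⁆⁆⁆ = 0 := by
  rw [leibniz_lie P Q R, h1, lie_zero, add_zero, leibniz_lie, h3, h1, zero_lie, lie_zero, add_zero]

theorem lie_ppp {Q P R : A} (h1 : ⁅P, ⁅P, R⁆⁆ = 0) (h2 : ⁅Q, R⁆ = 0) (h3 : ⁅P, ⁅P, ⁅P, Q⁆⁆⁆ = 0) :
    ⁅P, ⁅P, ⁅Q, ⁅P, R⁆⁆⁆⁆ = 0 := by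
  have e1 : ⁅Q, ⁅P, R⁆⁆ = - ⁅⁅P, Q⁆, R⁆ := by rw [lie_lie, h2, lie_zero, zero_sub, neg_neg]
  have e2 : ⁅P, ⁅P, ⁅Q, ⁅P, R⁆⁆⁆⁆ = ⁅⁅P, ⁅P, Q⁆⁆, ⁅P, R⁆⁆ := by
    rw [leibniz_lie P Q, h1, lie_zero, add_zero, leibniz_lie, h1, lie_zero, add_zero]
  have e3 : ⁅P, ⁅P, ⁅⁅P, Q⁆, R⁆⁆⁆ = (2:ℂ) • ⁅⁅P, ⁅P, Q⁆⁆, ⁅P, R⁆⁆ := by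
    rw [leibniz_lie P ⁅P, Q⁆, lie_add, leibniz_lie P ⁅P, ⁅P, Q⁆⁆, leibniz_lie P ⁅P, Q⁆, h3, h1, zero_lie, lie_zero, zero_add, add_zero, two_smul]
  rw [e1, lie_neg, lie_neg, e3] at e2
  have : (3:ℂ) • ⁅⁅P, ⁅P, Q⁆⁆, ⁅P, R⁆⁆ = 0 := by
    rw [show (3:ℂ) = 2 + 1 by norm_num, add_smul, one_smul]
    nth_rewrite 2 [← e2]
    simp
  rw [e1, lie_neg, lie_neg, e3, (smul_eq_zero_iff_right (by norm_num : (3:ℂ) ≠ 0)).1 this]; simp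

theorem rv_low (h : CS n f) (j k : ℕ) (hk : k + 2 ≤ j) : ∀ m, 2 * j + m + 2 ≤ 2 * n → ⁅f k, rv n f j m⁆ = 0
  | 0, _ => h.comm k j hk
  | m + 1, hm => by
    rw [rv]
    refine lie_pass (h.comm k _ ?_) (rv_low h j k hk m (by omega))
    unfold rho; split_ifs <;> omega

theorem rv_zero (h : CS n f) (j : ℕ) : ∀ m k, 2 * j + m + 2 ≤ 2 * n → j ≤ k → k < n →
    (k ≠ rho n (j + m + 2) ∨ 2 * j + m + 2 = 2 * n) → ⁅f k, rv n f j m⁆ = 0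
  | 0, k, hm, hjk, hkn, hk => by
    rw [rv]
    rcases hjk.eq_or_lt with e | e
    · rw [e, lie_self]
    by_cases e2 : k = j + 1
    · exfalso
      unfold rho at hk
      rw [if_pos (by omega)] at hk; omega
    · exact h.comm' (by omega)
  | 1, k, hm, hjk, hkn, hk => by
    have r1 : rho n (j + 0 + 2) = j + 1 := by unfold rho; rw [if_pos (by omega)]; omega
    rw [rv, rv, r1]
    by_cases e : k = j
    · subst e
      have : k + 2 ≠ n := by
        intro e; unfold rho at hk; rw [if_neg (by omega)] at hk; omega
      rw [← lie_skew (f (k+1)), lie_neg, h.serre _ _ (Or.inl rfl) (by omega), neg_zero]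
    by_cases e : k = j + 1
    · subst e
      exact h.serre _ _ (Or.inr rfl) (by omega)
    by_cases e : k = j + 2
    · exfalso
      unfold rho at hk; rw [if_pos (by omega)] at hk; omega
    · exact lie_pass (h.comm' (by omega)) (h.comm' (by omega))
  | m + 2, k, hm, hjk, hkn, hk => by
    have ih1 := rv_zero h j (m+1)
    have ih0 := rv_zero h j m
    have hE : rv n f j (m+1) = ⁅f (rho n (j + m + 2)), rv n f j m⁆ := rfl
    have hE2 : rv n f j (m+2) = ⁅f (rho n (j + (m + 1) + 2)), rv n f j (m+1)⁆ := rfl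
    by_cases hi : j + m + 3 ≤ n
    · have r0 : rho n (j + m + 2) = j + m + 1 := by unfold rho; rw [if_pos (by omega)]; omega
      have r1 : rho n (j + (m + 1) + 2) = j + m + 2 := by unfold rho; rw [if_pos (by omega)]; omega
      have hr : rho n (j + (m + 2) + 2) = if j + m + 4 ≤ n then j + m + 3 else 2 * n - 1 - (j + m + 4) := by
        unfold rho; rfl
      rw [hr] at hk
      have hPR : ⁅f (j + m + 2), rv n f j m⁆ = 0 := ih0 _ (by omega) (by omega) (by omega) (by rw [r0]; omega)
      by_cases e : k = j + m + 2
      · rw [hE2, hE, r1, r0, e]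
        exact lie_pp hPR (h.serre _ _ (Or.inr rfl) (by omega))
      by_cases e : k = j + m + 1
      · have : j + m + 4 ≤ n := by
          by_contra hc; rw [if_neg hc] at hk; omega
        have := ih1 (j + m + 1) (by omega) (by omega) (by omega) (by rw [r1]; omega)
        rw [hE2, hE, r1, r0, e]
        rw [hE, r0] at this
        exact lie_trick hPR this (h.serre _ _ (Or.inl rfl) (by omega))
      have : k ≠ j + m + 3 := by
        intro e; rw [if_pos (by omega)] at hk; omega
      rw [hE2, r1]
      exact lie_pass (h.comm' (by omega)) (ih1 k (by omega) hjk hkn (by rw [r1]; omega))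
    · obtain ⟨b, hb⟩ : ∃ b, j + m + 3 + b + 1 = 2 * n := ⟨2 * n - (j + m + 4), by omega⟩
      have r0 : rho n (j + m + 2) = b + 1 := by unfold rho; split_ifs <;> omega
      have r1 : rho n (j + (m + 1) + 2) = b := by unfold rho; rw [if_neg (by omega)]; omega
      have r2 : rho n (j + (m + 2) + 2) = b - 1 := by unfold rho; rw [if_neg (by omega)]; omega
      rw [r2] at hk
      have hPR : ⁅f b, rv n f j m⁆ = 0 := ih0 _ (by omega) (by omega) (by omega) (by rw [r0]; omega)
      by_cases e : k = b
      · rw [hE2, hE, r1, r0, e]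
        by_cases hbn : b + 2 = n
        · cases m with
          | zero =>
            have : b = j := by omega
            subst this
            rw [rv, ← lie_skew (f (b+1)), lie_neg, lie_neg, h.quartic _ _ hbn (by omega), neg_zero]
          | succ m =>
            have r3 : rho n (j + m + 2) = b := by unfold rho; rw [if_pos (by omega)]; omega
            have h4 := rv_zero h j m (b + 1) (by omega) (by omega) (by omega) (by rw [r3]; omega)
            rw [rv, r3] at hPR ⊢
            exact lie_ppp hPR h4 (h.quartic _ _ hbn (by omega))
        · exact lie_pp hPR (h.serre _ _ (Or.inl rfl) (by omega))
      by_cases e : k = b + 1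
      · have := ih1 (b + 1) (by omega) (by omega) (by omega) (by rw [r1]; omega)
        rw [hE2, hE, r1, r0, e]
        rw [hE, r0] at this
        exact lie_trick hPR this (h.serre _ _ (Or.inr rfl) (by omega))
      · rw [hE2, r1]
        exact lie_pass (h.comm' (by omega)) (ih1 k (by omega) hjk hkn (by rw [r1]; omega))

theorem rv_raise1 (h : CS n f) (j : ℕ) : ∀ m, (2 * j + m + 4 < 2 * n ∨ (m = 0 ∧ j + 2 ≤ n)) →
    ⁅f j, rv n f (j + 1) m⁆ = - rv n f j (m + 1)
  | 0, hm => by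
    have r1 : rho n (j + 0 + 2) = j + 1 := by unfold rho; rw [if_pos (by omega)]; omega
    rw [rv, rv, rv, r1, lie_skew]
  | m + 1, hm => by
    have ih := rv_raise1 h j m (by omega)
    have hE : rv n f j (m+2) = ⁅f (rho n (j + (m + 1) + 2)), rv n f j (m+1)⁆ := rfl
    have r : j + 1 + m + 2 = j + (m + 1) + 2 := by omega
    rw [hE, rv, leibniz_lie, h.comm' (Or.inl _), zero_lie, zero_add, ih, lie_neg, r]
    unfold rho; split_ifs <;> omega

theorem rv_raise2 (h : CS n f) : ∀ j m, 2 * j + m + 4 = 2 * n →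
    ∃ c : ℂ, c ≠ 0 ∧ ⁅f j, rv n f (j + 1) m⁆ = c • rv n f j (m + 1)
  | j, 0, hm => ⟨-1, by norm_num, by rw [rv_raise1 h j 0 (by omega)]; simp⟩
  | j, 1, hm => by omega
  | j, m + 2, hm => by
    obtain ⟨c, hc, ih⟩ := rv_raise2 h (j+1) m (by omega)
    refine ⟨-2, by norm_num, ?_⟩
    have r : rho n (j + 1 + (m + 1) + 2) = j + 1 := by unfold rho; rw [if_neg (by omega)]; omega
    have r' : rho n (j + (m + 2) + 2) = j + 1 := by unfold rho; rw [if_neg (by omega)]; omega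
    have hz : rv n f (j+1) (m+2) = ⁅f (j+1), rv n f (j+1) (m+1)⁆ := by rw [rv, r]
    have hy : rv n f j (m+3) = ⁅f (j+1), rv n f j (m+2)⁆ := by rw [rv, r']
    have h1 : ⁅f j, rv n f (j+1) (m+1)⁆ = - rv n f j (m+2) := rv_raise1 h j (m+1) (by omega)
    have hl : ⁅f j, rv n f (j+2) m⁆ = 0 := rv_low h (j+2) j le_rfl m (by omega)
    have hg : ⁅⁅f j, f (j+1)⁆, f (j+1)⁆ = 0 := by
      rw [← lie_skew, ← lie_skew (f j), lie_neg, h.serre _ _ (Or.inr rfl) (by omega)]; simp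
    have hgl : ⁅⁅f j, f (j+1)⁆, rv n f (j+2) m⁆ = -(c • rv n f j (m+2)) := by
      rw [lie_lie, hl, lie_zero, sub_zero, ih, lie_smul, h1, smul_neg]
    have hgz : c • ⁅⁅f j, f (j+1)⁆, rv n f (j+1) (m+1)⁆ = c • (- rv n f j (m+3)) := by
      rw [← lie_smul, ← ih, leibniz_lie, hg, zero_lie, zero_add, hgl, lie_neg, lie_smul, ← hy, smul_neg]
    have hgz' := (smul_right_injective A hc) hgz
    rw [hz, leibniz_lie, hgz', h1, lie_neg, ← hy, neg_smul, two_smul, neg_add]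

/-- span of root vectors -/
def rvs (n : ℕ) (f : ℕ → A) : Submodule ℂ A := Submodule.span ℂ {x | ∃ j m, 2 * j + m + 2 ≤ 2 * n ∧ x = rv n f j m}

theorem rv_mem {j m : ℕ} (h : 2 * j + m + 2 ≤ 2 * n) : rv n f j m ∈ rvs n f :=
  Submodule.subset_span ⟨j, m, h, rfl⟩

theorem rvs_f (h : CS n f) (k : ℕ) (hk : k < n) (v : A) (hv : v ∈ rvs n f) : ⁅f k, v⁆ ∈ rvs n f := by
  refine Submodule.span_induction ?_ ?_ ?_ ?_ hv
  · rintro _ ⟨j, m, hm, rfl⟩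
    by_cases h1 : k + 2 ≤ j
    · rw [rv_low h j k h1 m hm]; exact zero_mem _
    by_cases h2 : k + 1 = j
    · subst h2
      by_cases h3 : 2 * k + m + 4 = 2 * n
      · obtain ⟨c, _, e⟩ := rv_raise2 h k m h3
        rw [e]; exact Submodule.smul_mem _ _ (rv_mem (by omega))
      · rw [rv_raise1 h k m (by omega)]; exact neg_mem (rv_mem (by omega))
    by_cases h3 : k = rho n (j + m + 2) ∧ 2 * j + m + 2 ≠ 2 * n
    · have : ⁅f k, rv n f j m⁆ = rv n f j (m+1) := by rw [rv, h3.1]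
      rw [this]; exact rv_mem (by omega)
    · rw [rv_zero h j m k hm (by omega) hk (by omega)]; exact zero_mem _
  · rw [lie_zero]; exact zero_mem _
  · intro x y _ _ hx hy; rw [lie_add]; exact add_mem hx hy
  · intro c x _ hx; rw [lie_smul]; exact Submodule.smul_mem _ _ hx

theorem rvs_rv (h : CS n f) (j : ℕ) : ∀ m, 2 * j + m + 2 ≤ 2 * n → ∀ v ∈ rvs n f, ⁅rv n f j m, v⁆ ∈ rvs n f
  | 0, hm, v, hv => rvs_f h j (by omega) v hv
  | m + 1, hm, v, hv => by
    have hr : rho n (j + m + 2) < n := by unfold rho; split_ifs <;> omega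
    rw [rv, lie_lie]
    exact sub_mem (rvs_f h _ hr _ (rvs_rv h j m (by omega) v hv)) (rvs_rv h j m (by omega) _ (rvs_f h _ hr _ hv))
end
end

section
set_option linter.unusedSimpArgs false
set_option linter.unusedVariables false
set_option linter.unusedSectionVars false
section
attribute [local instance] LieRing.ofAssociativeRing LieAlgebra.ofAssociativeAlgebra

/-- matrix units indexed by natural numbers -/
def EU (N a b : ℕ) : Matrix (Fin N) (Fin N) ℂ := fun x y => if x.val = a ∧ y.val = b then 1 else 0

theorem EU_mul {N a b d : ℕ} (h : b < N) : EU N a b * EU N b d = EU N a d := by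
  ext x y
  rw [Matrix.mul_apply, Finset.sum_eq_single ⟨b, h⟩]
  · simp [EU, ite_and]; split_ifs <;> rfl
  · intro z _ hz
    have : z.val ≠ b := fun e => hz (Fin.ext e)
    simp [EU, this]
  · simp

theorem EU_mul0 {N a b c d : ℕ} (h : b ≠ c) : EU N a b * EU N c d = 0 := by
  ext x y
  rw [Matrix.mul_apply]
  apply Finset.sum_eq_zero
  intro z _
  by_cases e : z.val = b
  · simp [EU, e, h]
  · simp [EU, e]

theorem EU_lie1 {N a b d : ℕ} (h : b < N) (h2 : d ≠ a) : ⁅EU N a b, EU N b d⁆ = EU N a d := by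
  rw [Ring.lie_def, EU_mul h, EU_mul0 h2, sub_zero]
theorem EU_lie2 {N a b d : ℕ} (h : b < N) (h2 : d ≠ a) : ⁅EU N b d, EU N a b⁆ = - EU N a d := by
  rw [Ring.lie_def, EU_mul h, EU_mul0 h2, zero_sub]
theorem EU_lie0 {N a b c d : ℕ} (h : b ≠ c) (h2 : d ≠ a) : ⁅EU N a b, EU N c d⁆ = 0 := by
  rw [Ring.lie_def, EU_mul0 h, EU_mul0 h2, sub_zero]

/-- Classical Chevalley generators in the vector representation. -/
def XM (n k : ℕ) : Matrix (Fin (2*n)) (Fin (2*n)) ℂ :=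
  - EU (2*n) k (k+1) + if k + 1 < n then EU (2*n) (2*n-2-k) (2*n-1-k) else 0

theorem rvX1 (n j : ℕ) : ∀ m, j + m + 2 ≤ n → rv n (XM n) j m = - EU (2*n) j (j+1+m) + EU (2*n) (2*n-2-j-m) (2*n-1-j)
  | 0, hm => by rw [rv, XM, if_pos (by omega)]; rfl
  | m + 1, hm => by
    have r : rho n (j + m + 2) = j + m + 1 := by unfold rho; rw [if_pos (by omega)]; omega
    rw [rv, rvX1 n j m (by omega), r, XM, if_pos (by omega)]
    have e1 : j + m + 1 + 1 = j + 1 + (m + 1) := by omega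
    have e2 : j + m + 1 = j + 1 + m := by omega
    have e3 : 2*n-2-(j+1+m) = 2*n-2-j-(m+1) := by omega
    have e4 : 2*n-1-(j+1+m) = 2*n-2-j-m := by omega
    rw [e1, e2, e3, e4]
    rw [add_lie, lie_add, lie_add, neg_lie, neg_lie, lie_neg, lie_neg, neg_neg, EU_lie2 (by omega) (by omega),
      EU_lie0 (by omega) (by omega), EU_lie0 (by omega) (by omega), EU_lie1 (by omega) (by omega)]
    simp

theorem rvX2 (n j : ℕ) (hj : j + 2 ≤ n) : ∀ m, n ≤ j + 1 + m → 2*j+m+2 ≤ 2*n → ∃ c : ℂ, c ≠ 0 ∧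
    rv n (XM n) j m = c • (EU (2*n) j (j+1+m) + EU (2*n) (2*n-2-j-m) (2*n-1-j))
  | 0, h1, h2 => by omega
  | m + 1, h1, h2 => by
    by_cases h : n ≤ j + 1 + m
    · obtain ⟨c, hc, ih⟩ := rvX2 n j hj m h (by omega)
      refine ⟨-c, neg_ne_zero.2 hc, ?_⟩
      have r : rho n (j + m + 2) = 2*n-2-j-(m+1) := by unfold rho; rw [if_neg (by omega)]; omega
      rw [rv, ih, r, XM, if_pos (by omega), lie_smul, neg_smul, ← smul_neg]
      congr 1
      have e1 : 2*n-2-j-(m+1) + 1 = 2*n-2-j-m := by omega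
      have e3 : 2*n-2-(2*n-2-j-(m+1)) = j+1+m := by omega
      have e4 : 2*n-1-(2*n-2-j-(m+1)) = j+1+(m+1) := by omega
      rw [e1, e3, e4]
      rw [add_lie, lie_add, lie_add, neg_lie, neg_lie, EU_lie0 (by omega) (by omega), EU_lie1 (by omega) (by omega),
        EU_lie2 (by omega) (by omega), EU_lie0 (by omega) (by omega)]
      abel
    · have e : j + m + 2 = n := by omega
      refine ⟨-1, by norm_num, ?_⟩
      have r : rho n (j + m + 2) = j + 1 + m := by unfold rho; rw [if_pos (by omega)]; omega
      rw [rv, rvX1 n j m (by omega), r, XM, if_neg (by omega), add_zero]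
      have e1 : 2*n-2-j-m = j+1+(m+1) := by omega
      have e3 : 2*n-2-j-(m+1) = j+1+m := by omega
      rw [e1, e3, show j+1+m+1 = j+1+(m+1) by omega]
      rw [lie_add, neg_lie, neg_lie, lie_neg, neg_neg, EU_lie2 (by omega) (by omega), EU_lie1 (by omega) (by omega)]
      rw [neg_one_smul, neg_add]

theorem rvX_diag (n j m : ℕ) (h : 2*j+m+2 ≤ 2*n) (x y : Fin (2*n)) (hx : x.val = j) (hy : y.val = j+1+m) :
    rv n (XM n) j m x y ≠ 0 := by
  by_cases h1 : j + 2 ≤ n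
  · by_cases h2 : n ≤ j + 1 + m
    · obtain ⟨c, hc, e⟩ := rvX2 n j h1 m h2 h
      rw [e, Matrix.smul_apply, Matrix.add_apply]
      simp only [EU, hx, hy, and_self, if_true, smul_eq_mul]
      refine mul_ne_zero hc ?_
      split_ifs <;> norm_num
    · rw [rvX1 n j m (by omega), Matrix.add_apply, Matrix.neg_apply]
      simp only [EU, hx, hy, and_self, if_true]
      rw [if_neg (by omega)]; norm_num
  · have : m = 0 := by omega
    subst this
    rw [rv, XM, if_neg (by omega), add_zero, Matrix.neg_apply]
    simp [EU, hx, hy]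

theorem rvX_off (n j m : ℕ) (h : 2*j+m+2 ≤ 2*n) (j' m' : ℕ) (h' : 2*j'+m'+2 ≤ 2*n) (hne : ¬ (j = j' ∧ m = m'))
    (x y : Fin (2*n)) (hx : x.val = j') (hy : y.val = j'+1+m') :
    rv n (XM n) j m x y = 0 := by
  by_cases h1 : j + 2 ≤ n
  · by_cases h2 : n ≤ j + 1 + m
    · obtain ⟨c, hc, e⟩ := rvX2 n j h1 m h2 h
      rw [e, Matrix.smul_apply, Matrix.add_apply]
      simp only [EU, hx, hy]
      rw [if_neg (by omega), if_neg (by omega)]; simp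
    · rw [rvX1 n j m (by omega), Matrix.add_apply, Matrix.neg_apply]
      simp only [EU, hx, hy]
      rw [if_neg (by omega), if_neg (by omega)]; simp
  · have : m = 0 := by omega
    subst this
    rw [rv, XM, if_neg (by omega), add_zero, Matrix.neg_apply]
    simp only [EU, hx, hy]
    rw [if_neg (by omega)]; simp
end
end

section
set_option linter.unusedSimpArgs false
set_option linter.unusedVariables false
set_option linter.unusedSectionVars false
section
variable {R : Type*} [CommRing R] {X : Type*}

def wd (R : Type*) [CommRing R] {X : Type*} (w : List X) : FreeAlgebra R X := (w.map (FreeAlgebra.ι R)).prod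

@[simp] theorem wd_nil : wd R ([] : List X) = 1 := rfl
theorem wd_cons (a : X) (w : List X) : wd R (a :: w) = FreeAlgebra.ι R a * wd R w := by simp [wd]
theorem wd_append (v w : List X) : wd R (v ++ w) = wd R v * wd R w := by simp [wd]

theorem lift_wd {A : Type*} [Semiring A] [Algebra R A] (f : X → A) (w : List X) :
    FreeAlgebra.lift R f (wd R w) = (w.map f).prod := by
  simp [wd, map_list_prod, Function.comp_def]

/-- homogeneous part -/
def Hm (R : Type*) [CommRing R] (X : Type*) (d : ℕ) : Submodule R (FreeAlgebra R X) :=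
  Submodule.span R {x | ∃ w : List X, w.length = d ∧ wd R w = x}
/-- filtration part: words of length `< d` -/
def Fl (R : Type*) [CommRing R] (X : Type*) (d : ℕ) : Submodule R (FreeAlgebra R X) :=
  Submodule.span R {x | ∃ w : List X, w.length < d ∧ wd R w = x}

theorem wd_Hm {d : ℕ} {w : List X} (h : w.length = d) : wd R w ∈ Hm R X d := Submodule.subset_span ⟨w, h, rfl⟩
theorem wd_Fl {d : ℕ} {w : List X} (h : w.length < d) : wd R w ∈ Fl R X d := Submodule.subset_span ⟨w, h, rfl⟩

theorem Hm_Fl {d e : ℕ} (h : d < e) : Hm R X d ≤ Fl R X e := by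
  refine Submodule.span_le.2 ?_
  rintro _ ⟨w, hw, rfl⟩; exact wd_Fl (by omega)
theorem Fl_mono {d e : ℕ} (h : d ≤ e) : Fl R X d ≤ Fl R X e := by
  refine Submodule.span_le.2 ?_
  rintro _ ⟨w, hw, rfl⟩; exact wd_Fl (by omega)

theorem Hm_ind {d : ℕ} {P : FreeAlgebra R X → Prop} {u : FreeAlgebra R X} (hu : u ∈ Hm R X d)
    (h1 : ∀ w : List X, w.length = d → P (wd R w)) (h0 : P 0) (ha : ∀ x y, P x → P y → P (x + y))
    (hs : ∀ (c : R) x, P x → P (c • x)) : P u := by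
  refine Submodule.span_induction ?_ h0 (fun x y _ _ => ha x y) (fun c x _ => hs c x) hu
  rintro _ ⟨w, hw, rfl⟩; exact h1 w hw
theorem Fl_ind {d : ℕ} {P : FreeAlgebra R X → Prop} {u : FreeAlgebra R X} (hu : u ∈ Fl R X d)
    (h1 : ∀ w : List X, w.length < d → P (wd R w)) (h0 : P 0) (ha : ∀ x y, P x → P y → P (x + y))
    (hs : ∀ (c : R) x, P x → P (c • x)) : P u := by
  refine Submodule.span_induction ?_ h0 (fun x y _ _ => ha x y) (fun c x _ => hs c x) hu
  rintro _ ⟨w, hw, rfl⟩; exact h1 w hw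

theorem Fl_zero {u : FreeAlgebra R X} (hu : u ∈ Fl R X 0) : u = 0 := by
  refine Fl_ind (P := fun u => u = 0) hu (fun w hw => by omega) rfl ?_ ?_
  · rintro x y rfl rfl; simp
  · rintro c x rfl; simp

theorem Fl_one {u : FreeAlgebra R X} (hu : u ∈ Fl R X 1) : ∃ c : R, u = algebraMap R _ c := by
  refine Fl_ind (P := fun u => ∃ c : R, u = algebraMap R _ c) hu ?_ ⟨0, by simp⟩ ?_ ?_
  · intro w hw
    have : w = [] := List.length_eq_zero_iff.1 (by omega)
    exact ⟨1, by simp [this]⟩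
  · rintro x y ⟨c, rfl⟩ ⟨d, rfl⟩; exact ⟨c + d, by simp⟩
  · rintro c x ⟨d, rfl⟩; exact ⟨c * d, by rw [map_mul, Algebra.smul_def]⟩

theorem Fl_split {d : ℕ} {u : FreeAlgebra R X} (hu : u ∈ Fl R X (d+1)) :
    ∃ v ∈ Hm R X d, ∃ w ∈ Fl R X d, u = v + w := by
  refine Fl_ind (P := fun u => ∃ v ∈ Hm R X d, ∃ w ∈ Fl R X d, u = v + w) hu ?_ ⟨0, zero_mem _, 0, zero_mem _, by simp⟩ ?_ ?_
  · intro w hw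
    by_cases h : w.length = d
    · exact ⟨_, wd_Hm h, 0, zero_mem _, by simp⟩
    · exact ⟨0, zero_mem _, wd R w, wd_Fl (by omega), by simp⟩
  · rintro x y ⟨a, ha, b, hb, rfl⟩ ⟨a', ha', b', hb', rfl⟩
    exact ⟨_, add_mem ha ha', _, add_mem hb hb', by abel⟩
  · rintro c x ⟨a, ha, b, hb, rfl⟩
    exact ⟨_, Submodule.smul_mem _ c ha, _, Submodule.smul_mem _ c hb, by simp⟩

theorem Fl_mul {d e k : ℕ} (hk : d + e ≤ k + 1) {u v : FreeAlgebra R X} (hu : u ∈ Fl R X d) (hv : v ∈ Fl R X e) :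
    u * v ∈ Fl R X k := by
  refine Fl_ind (P := fun u => u * v ∈ Fl R X k) hu ?_ (by simp) ?_ ?_
  · intro w hw
    refine Fl_ind (P := fun v => wd R w * v ∈ Fl R X k) hv ?_ (by simp) ?_ ?_
    · intro w' hw'
      rw [← wd_append]; exact wd_Fl (by rw [List.length_append]; omega)
    · intro x y hx hy; rw [mul_add]; exact add_mem hx hy
    · intro c x hx; rw [mul_smul_comm]; exact Submodule.smul_mem _ _ hx
  · intro x y hx hy; rw [add_mul]; exact add_mem hx hy
  · intro c x hx; rw [smul_mul_assoc]; exact Submodule.smul_mem _ _ hx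

theorem ι_Fl (a : X) {d : ℕ} (h : 2 ≤ d) : FreeAlgebra.ι R a ∈ Fl R X d := by
  have : FreeAlgebra.ι R a = wd R [a] := by simp [wd]
  rw [this]; exact wd_Fl (by simp; omega)

theorem exists_Fl (u : FreeAlgebra R X) : ∃ d, u ∈ Fl R X d := by
  induction u using FreeAlgebra.induction with
  | grade0 r => exact ⟨1, by rw [Algebra.algebraMap_eq_smul_one]; exact Submodule.smul_mem _ _ (wd_Fl (w := []) (by simp))⟩
  | grade1 x => exact ⟨2, ι_Fl x le_rfl⟩
  | mul a b ha hb =>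
    obtain ⟨d, hd⟩ := ha; obtain ⟨e, he⟩ := hb
    exact ⟨d + e, Fl_mul (by omega) hd he⟩
  | add a b ha hb =>
    obtain ⟨d, hd⟩ := ha; obtain ⟨e, he⟩ := hb
    exact ⟨d + e, add_mem (Fl_mono (by omega) hd) (Fl_mono (by omega) he)⟩

theorem hom_Hm_ext {d : ℕ} {M : Type*} [AddCommMonoid M] [Module R M] {f g : FreeAlgebra R X →ₗ[R] M} {u : FreeAlgebra R X}
    (hu : u ∈ Hm R X d) (h : ∀ w : List X, w.length = d → f (wd R w) = g (wd R w)) : f u = g u := by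
  refine Hm_ind (P := fun u => f u = g u) hu h (by simp) ?_ ?_
  · intro x y hx hy; rw [map_add, map_add, hx, hy]
  · intro c x hx; rw [map_smul, map_smul, hx]
theorem hom_Fl_ext {d : ℕ} {M : Type*} [AddCommMonoid M] [Module R M] {f g : FreeAlgebra R X →ₗ[R] M} {u : FreeAlgebra R X}
    (hu : u ∈ Fl R X d) (h : ∀ w : List X, w.length < d → f (wd R w) = g (wd R w)) : f u = g u := by
  refine Fl_ind (P := fun u => f u = g u) hu h (by simp) ?_ ?_
  · intro x y hx hy; rw [map_add, map_add, hx, hy]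
  · intro c x hx; rw [map_smul, map_smul, hx]
end
end

section
set_option linter.unusedSimpArgs false
set_option linter.unusedVariables false
set_option linter.unusedSectionVars false
set_option maxHeartbeats 1000000
section
variable {Φ : Type*} [Fintype Φ] [DecidableEq Φ]

/-- abelianization -/
def sym (Φ : Type*) : FreeAlgebra ℂ Φ →ₐ[ℂ] MvPolynomial Φ ℂ := FreeAlgebra.lift ℂ MvPolynomial.X

def SG (Φ : Type*) (d : ℕ) : Submodule ℂ (MvPolynomial Φ ℂ) := (Fl ℂ Φ d).map (sym Φ).toLinearMap

theorem sym_wd_nil : sym Φ (wd ℂ []) = 1 := by rw [wd_nil, map_one]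
theorem sym_wd_cons (a : Φ) (w : List Φ) : sym Φ (wd ℂ (a :: w)) = MvPolynomial.X a * sym Φ (wd ℂ w) := by
  rw [wd_cons, map_mul, sym, FreeAlgebra.lift_ι_apply]

theorem sym_wd_SG {w : List Φ} {d : ℕ} (h : w.length < d) : sym Φ (wd ℂ w) ∈ SG Φ d := ⟨_, wd_Fl h, rfl⟩

theorem SG_mono {d e : ℕ} (h : d ≤ e) : SG Φ d ≤ SG Φ e := Submodule.map_mono (Fl_mono h)

theorem SG_X (a : Φ) {d : ℕ} {p : MvPolynomial Φ ℂ} (hp : p ∈ SG Φ d) : MvPolynomial.X a * p ∈ SG Φ (d+1) := by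
  obtain ⟨u, hu, rfl⟩ := hp
  refine ⟨FreeAlgebra.ι ℂ a * u, Fl_mul (d := 2) (by omega) (ι_Fl a le_rfl) hu, ?_⟩
  simp [sym]

theorem SG_zero {p : MvPolynomial Φ ℂ} (hp : p ∈ SG Φ 0) : p = 0 := by
  obtain ⟨u, hu, rfl⟩ := hp
  have := Fl_zero hu
  simp [this]

theorem sym_wd_hom (w : List Φ) : (sym Φ (wd ℂ w)).IsHomogeneous w.length := by
  induction w with
  | nil => rw [sym_wd_nil]; exact MvPolynomial.isHomogeneous_one _ _
  | cons a w ih =>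
    rw [sym_wd_cons, List.length_cons, add_comm]; exact (MvPolynomial.isHomogeneous_X _ _).mul ih

theorem comp_wd (w : List Φ) (d : ℕ) : MvPolynomial.homogeneousComponent d (sym Φ (wd ℂ w)) =
    if w.length = d then sym Φ (wd ℂ w) else 0 := by
  rw [MvPolynomial.homogeneousComponent_of_mem (sym_wd_hom w)]
  simp only [eq_comm]

theorem comp_SG {d : ℕ} {p : MvPolynomial Φ ℂ} (hp : p ∈ SG Φ d) : MvPolynomial.homogeneousComponent d p = 0 := by
  obtain ⟨u, hu, rfl⟩ := hp
  have := hom_Fl_ext (f := (MvPolynomial.homogeneousComponent d).comp (sym Φ).toLinearMap) (g := 0) hu ?_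
  · exact this
  · intro w hw
    simp only [LinearMap.comp_apply, AlgHom.toLinearMap_apply, LinearMap.zero_apply]
    rw [comp_wd, if_neg (by omega)]

theorem pd_SG (c : Φ) (w : List Φ) : MvPolynomial.pderiv c (sym Φ (wd ℂ w)) ∈ SG Φ w.length := by
  induction w with
  | nil => rw [sym_wd_nil, MvPolynomial.pderiv_one]; exact zero_mem _
  | cons a w ih =>
    rw [sym_wd_cons, MvPolynomial.pderiv_mul, List.length_cons]
    refine add_mem ?_ (SG_X a ih)
    rw [MvPolynomial.pderiv_X]
    by_cases h : a = c
    · subst h; rw [Pi.single_eq_same, one_mul]; exact sym_wd_SG (by omega)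
    · rw [Pi.single_eq_of_ne h, zero_mul]; exact zero_mem _

variable {I : Type*} [Fintype I] [DecidableEq I] (Xm : Φ → Matrix I I ℂ)

/-- coaction on the free algebra of root vectors -/
def DP : FreeAlgebra ℂ Φ →ₐ[ℂ] Matrix I I (FreeAlgebra ℂ Φ) :=
  FreeAlgebra.lift ℂ fun a => Matrix.scalarAlgHom I ℂ (FreeAlgebra.ι ℂ a) + AlgHom.mapMatrix (Algebra.ofId ℂ _) (Xm a)

theorem DP_nil (x y : I) : DP Xm (wd ℂ []) x y = if x = y then 1 else 0 := by
  rw [wd_nil, map_one, Matrix.one_apply]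
theorem DP_cons (a : Φ) (w : List Φ) (x y : I) : DP Xm (wd ℂ (a :: w)) x y =
    FreeAlgebra.ι ℂ a * DP Xm (wd ℂ w) x y + ∑ z, Xm a x z • DP Xm (wd ℂ w) z y := by
  rw [wd_cons, map_mul]
  nth_rewrite 1 [DP]
  rw [FreeAlgebra.lift_ι_apply, add_mul, Matrix.add_apply]
  congr 1
  · simp [Matrix.scalarAlgHom_apply, Matrix.scalar_apply, Matrix.diagonal_mul]

theorem DP_Fl (w : List Φ) : ∀ (x y : I), DP Xm (wd ℂ w) x y - (if x = y then wd ℂ w else 0) ∈ Fl ℂ Φ w.length := by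
  induction w with
  | nil => intro x y; rw [DP_nil, wd_nil, sub_self]; exact zero_mem _
  | cons a w ih =>
    intro x y
    have e : DP Xm (wd ℂ (a :: w)) x y - (if x = y then wd ℂ (a::w) else 0) =
        FreeAlgebra.ι ℂ a * (DP Xm (wd ℂ w) x y - (if x = y then wd ℂ w else 0)) + ∑ z, Xm a x z • DP Xm (wd ℂ w) z y := by
      rw [DP_cons, wd_cons, mul_sub, mul_ite, mul_zero]; abel
    rw [e, List.length_cons]
    refine add_mem (Fl_mul (d := 2) (by omega) (ι_Fl a le_rfl) (ih x y)) (sum_mem fun z _ => Submodule.smul_mem _ _ ?_)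
    have := add_mem (Fl_mono (Nat.le_succ _) (ih z y)) (show (if z = y then wd ℂ w else 0) ∈ Fl ℂ Φ (w.length+1) from ?_)
    · rwa [sub_add_cancel] at this
    · split_ifs
      · exact wd_Fl (by omega)
      · exact zero_mem _

theorem DP_sym (w : List Φ) : ∀ (x y : I), sym Φ (DP Xm (wd ℂ w) x y) - (if x = y then sym Φ (wd ℂ w) else 0)
    - ∑ c, Xm c x y • MvPolynomial.pderiv c (sym Φ (wd ℂ w)) ∈ SG Φ (w.length - 1) := by
  induction w with
  | nil =>
    intro x y
    have : sym Φ (DP Xm (wd ℂ []) x y) - (if x = y then sym Φ (wd ℂ []) else 0)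
      - ∑ c, Xm c x y • MvPolynomial.pderiv c (sym Φ (wd ℂ [])) = 0 := by
      rw [DP_nil, sym_wd_nil]
      simp only [MvPolynomial.pderiv_one]
      split_ifs <;> simp
    rw [this]; exact zero_mem _
  | cons a w ih =>
    intro x y
    have e0 : ∑ c, Xm c x y • MvPolynomial.pderiv c (sym Φ (wd ℂ (a::w))) = Xm a x y • sym Φ (wd ℂ w) +
        MvPolynomial.X a * ∑ c, Xm c x y • MvPolynomial.pderiv c (sym Φ (wd ℂ w)) := by
      simp only [sym_wd_cons, MvPolynomial.pderiv_mul, MvPolynomial.pderiv_X, smul_add, Finset.sum_add_distrib]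
      congr 1
      · rw [Finset.sum_eq_single a]
        · rw [Pi.single_eq_same, one_mul]
        · intro b _ hb; rw [Pi.single_eq_of_ne (Ne.symm hb), zero_mul, smul_zero]
        · simp
      · rw [Finset.mul_sum]; simp only [mul_smul_comm]
    have e1 : sym Φ (DP Xm (wd ℂ (a :: w)) x y) = MvPolynomial.X a * sym Φ (DP Xm (wd ℂ w) x y)
        + ∑ z, Xm a x z • sym Φ (DP Xm (wd ℂ w) z y) := by
      rw [DP_cons, map_add, map_mul, map_sum]
      simp only [map_smul]
      rw [sym, FreeAlgebra.lift_ι_apply]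
    have e2 : Xm a x y • sym Φ (wd ℂ w) = ∑ z, Xm a x z • (if z = y then sym Φ (wd ℂ w) else 0) := by
      simp
    have e : sym Φ (DP Xm (wd ℂ (a :: w)) x y) - (if x = y then sym Φ (wd ℂ (a::w)) else 0)
        - ∑ c, Xm c x y • MvPolynomial.pderiv c (sym Φ (wd ℂ (a::w))) =
        MvPolynomial.X a * (sym Φ (DP Xm (wd ℂ w) x y) - (if x = y then sym Φ (wd ℂ w) else 0)
           - ∑ c, Xm c x y • MvPolynomial.pderiv c (sym Φ (wd ℂ w))) +
        ∑ z, Xm a x z • (sym Φ (DP Xm (wd ℂ w) z y) - (if z = y then sym Φ (wd ℂ w) else 0)) := by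
      rw [e0, e1, e2, sym_wd_cons, mul_sub, mul_sub, mul_ite, mul_zero]
      simp only [smul_sub, Finset.sum_sub_distrib]
      abel
    rw [e, List.length_cons, Nat.add_sub_cancel]
    refine add_mem ?_ (sum_mem fun z _ => Submodule.smul_mem _ _ ?_)
    · rcases Nat.eq_zero_or_pos w.length with h | h
      · have := ih x y
        rw [h] at this
        rw [SG_zero this, mul_zero]; exact zero_mem _
      · have := SG_X a (ih x y)
        rwa [Nat.sub_add_cancel h] at this
    · have := add_mem (SG_mono (Nat.sub_le _ 1) (ih z y)) (sum_mem (t := Finset.univ) (f := fun c => Xm c z y • MvPolynomial.pderiv c (sym Φ (wd ℂ w))) fun c _ => Submodule.smul_mem _ _ (pd_SG c w))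
      rwa [sub_add_cancel] at this

theorem DP_comp {d : ℕ} {p : FreeAlgebra ℂ Φ} (hp : p ∈ Fl ℂ Φ (d+2)) {x y : I} (hxy : x ≠ y) :
    DP Xm p x y ∈ Fl ℂ Φ (d+1) ∧ MvPolynomial.homogeneousComponent d (sym Φ (DP Xm p x y)) =
      ∑ c, Xm c x y • MvPolynomial.pderiv c (MvPolynomial.homogeneousComponent (d+1) (sym Φ p)) := by
  refine Fl_ind (P := fun p => DP Xm p x y ∈ Fl ℂ Φ (d+1) ∧ MvPolynomial.homogeneousComponent d (sym Φ (DP Xm p x y)) =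
      ∑ c, Xm c x y • MvPolynomial.pderiv c (MvPolynomial.homogeneousComponent (d+1) (sym Φ p))) hp ?_ ?_ ?_ ?_
  · intro w hw
    constructor
    · have := DP_Fl Xm w x y
      rw [if_neg hxy, sub_zero] at this
      exact Fl_mono (by omega) this
    · have := comp_SG (SG_mono (by omega) (DP_sym Xm w x y) : _ ∈ SG Φ d)
      rw [if_neg hxy, sub_zero, map_sub, sub_eq_zero] at this
      rw [this, comp_wd, map_sum]
      apply Finset.sum_congr rfl
      intro c _
      rw [map_smul]
      congr 1
      split_ifs with h
      · have h2 := (sym_wd_hom w).pderiv (i := c)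
        rw [h, Nat.add_sub_cancel] at h2
        rw [MvPolynomial.homogeneousComponent_of_mem h2, if_pos rfl]
      · rw [map_zero]
        exact comp_SG (SG_mono (by omega) (pd_SG c w))
  · simp
  · rintro p p' ⟨h1, h2⟩ ⟨h3, h4⟩
    simp only [map_add, Matrix.add_apply, h2, h4, smul_add, Finset.sum_add_distrib]
    exact ⟨add_mem h1 h3, trivial⟩
  · rintro k p ⟨h1, h2⟩
    simp only [map_smul, Matrix.smul_apply, h2, Finset.smul_sum, smul_comm k]
    refine ⟨Submodule.smul_mem _ _ h1, ?_⟩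
    apply Finset.sum_congr rfl
    intro c _
    rw [Derivation.map_smul]

section
variable {B : Type*} [Ring B] [Algebra ℂ B] (y : Φ → B)

def LM (d : ℕ) : Submodule ℂ B := (Fl ℂ Φ d).map (FreeAlgebra.lift ℂ y).toLinearMap

theorem LM_mul (a : Φ) {d : ℕ} {b : B} (hb : b ∈ LM y d) : y a * b ∈ LM y (d+1) := by
  obtain ⟨u, hu, rfl⟩ := hb
  refine ⟨FreeAlgebra.ι ℂ a * u, Fl_mul (d := 2) (by omega) (ι_Fl a le_rfl) hu, ?_⟩
  simp

theorem LM_perm (hb : ∀ a b, y a * y b - y b * y a ∈ Submodule.span ℂ (Set.range y)) {w w' : List Φ} (h : w.Perm w') :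
    ∀ d, w.length ≤ d → FreeAlgebra.lift ℂ y (wd ℂ w) - FreeAlgebra.lift ℂ y (wd ℂ w') ∈ LM y d := by
  induction h with
  | nil => intro d _; rw [sub_self]; exact zero_mem _
  | cons a h ih =>
    intro d hd
    rw [List.length_cons] at hd
    obtain ⟨e, rfl⟩ : ∃ e, d = e + 1 := ⟨d - 1, by omega⟩
    rw [wd_cons, wd_cons, map_mul, map_mul, FreeAlgebra.lift_ι_apply, ← mul_sub]
    exact LM_mul y a (ih e (by omega))
  | swap a b l =>
    intro d hd
    rw [List.length_cons, List.length_cons] at hd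
    simp only [wd_cons, map_mul, FreeAlgebra.lift_ι_apply]
    rw [← mul_assoc, ← mul_assoc, ← sub_mul]
    refine Submodule.span_induction (p := fun x _ => x * FreeAlgebra.lift ℂ y (wd ℂ l) ∈ LM y d) ?_ ?_ ?_ ?_ (hb b a)
    · rintro _ ⟨c, rfl⟩
      exact ⟨wd ℂ (c :: l), wd_Fl (by rw [List.length_cons]; omega), by simp [wd_cons]⟩
    · rw [zero_mul]; exact zero_mem _
    · intro u v _ _ hu hv; rw [add_mul]; exact add_mem hu hv
    · intro k u _ hu; rw [smul_mul_assoc]; exact Submodule.smul_mem _ _ hu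
  | trans h1 h2 ih1 ih2 =>
    intro d hd
    have := add_mem (ih1 d hd) (ih2 d (by rw [← h1.length_eq]; exact hd))
    rwa [sub_add_sub_cancel] at this

def sig : MvPolynomial Φ ℂ →ₗ[ℂ] B := (MvPolynomial.basisMonomials Φ ℂ).constr ℂ
  fun m => FreeAlgebra.lift ℂ y (wd ℂ (Finsupp.toMultiset m).toList)

theorem sym_wd_mono (w : List Φ) : sym Φ (wd ℂ w) = MvPolynomial.monomial (Multiset.toFinsupp (w : Multiset Φ)) 1 := by
  induction w with
  | nil => rw [sym_wd_nil]; simp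
  | cons a w ih =>
    rw [sym_wd_cons, ih, ← Multiset.cons_coe, ← Multiset.singleton_add, map_add, MvPolynomial.X, MvPolynomial.monomial_mul, one_mul, Multiset.toFinsupp_singleton]

theorem sig_sym (hb : ∀ a b, y a * y b - y b * y a ∈ Submodule.span ℂ (Set.range y)) {d : ℕ} {p : FreeAlgebra ℂ Φ}
    (hp : p ∈ Hm ℂ Φ d) : FreeAlgebra.lift ℂ y p - sig y (sym Φ p) ∈ LM y d := by
  refine Hm_ind (P := fun p => FreeAlgebra.lift ℂ y p - sig y (sym Φ p) ∈ LM y d) hp ?_ ?_ ?_ ?_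
  · intro w hw
    have : sig y (sym Φ (wd ℂ w)) = FreeAlgebra.lift ℂ y (wd ℂ (Finsupp.toMultiset (Multiset.toFinsupp (w : Multiset Φ))).toList) := by
      rw [sym_wd_mono, sig, ← congr_fun (MvPolynomial.coe_basisMonomials Φ ℂ), Module.Basis.constr_basis]
    rw [this]
    apply LM_perm y hb _ d hw.le
    rw [Multiset.toFinsupp_toMultiset]
    exact (Multiset.coe_eq_coe.1 (Multiset.coe_toList _)).symm
  · simp
  · intro u v hu hv
    simp only [map_add]
    rw [add_sub_add_comm]; exact add_mem hu hv
  · intro k u hu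
    simp only [map_smul]
    rw [← smul_sub]; exact Submodule.smul_mem _ _ hu
end

/-- Abstract PBW-type theorem. -/
theorem pbw {A B : Type*} [Ring A] [Algebra ℂ A] [Ring B] [Algebra ℂ B] (π : A →ₐ[ℂ] B) (Lv : Φ → A)
    (Δ : A →ₐ[ℂ] Matrix I I A) (hΔ : ∀ a, Δ (Lv a) = Matrix.scalarAlgHom I ℂ (Lv a) + AlgHom.mapMatrix (Algebra.ofId ℂ A) (Xm a))
    (hgen : Function.Surjective (FreeAlgebra.lift ℂ Lv))
    (hb : ∀ a b, π (Lv a) * π (Lv b) - π (Lv b) * π (Lv a) ∈ Submodule.span ℂ (Set.range fun c => π (Lv c)))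
    (Z : Submodule ℂ A) (hZk : ∀ u, π u = 0 → u ∈ Z) (hZΔ : ∀ u ∈ Z, ∀ x y, Δ u x y ∈ Z)
    (hZ0 : ∀ c : ℂ, algebraMap ℂ A c ∈ Z → c = 0)
    (rr cc : Φ → I) (hrc : ∀ b, rr b ≠ cc b) (hd : ∀ b, Xm b (rr b) (cc b) ≠ 0) (ho : ∀ a b, a ≠ b → Xm a (rr b) (cc b) = 0) :
    ∀ u ∈ Z, π u = 0 := by
  have hLD : ∀ p x y, FreeAlgebra.lift ℂ Lv (DP Xm p x y) = Δ (FreeAlgebra.lift ℂ Lv p) x y := by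
    intro p x y
    have : (AlgHom.mapMatrix (FreeAlgebra.lift ℂ Lv)).comp (DP Xm) = Δ.comp (FreeAlgebra.lift ℂ Lv) := by
      apply FreeAlgebra.hom_ext
      funext a
      simp only [Function.comp, AlgHom.comp_apply, DP, FreeAlgebra.lift_ι_apply, map_add]
      rw [hΔ]
      congr 1
      · ext x y
        by_cases h : x = y <;> simp [h, Matrix.scalarAlgHom_apply, Matrix.scalar_apply]
      · ext x y
        simp [Algebra.ofId_apply]
    exact congr_fun (congr_fun (DFunLike.congr_fun this p) x) y
  have claim : ∀ d, ∀ p ∈ Fl ℂ Φ (d+1), FreeAlgebra.lift ℂ Lv p ∈ Z → MvPolynomial.homogeneousComponent d (sym Φ p) = 0 := by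
    intro d
    induction d with
    | zero =>
      intro p hp hZ
      obtain ⟨c, rfl⟩ := Fl_one hp
      rw [AlgHom.commutes] at hZ
      rw [hZ0 c hZ]; simp
    | succ d ih =>
      intro p hp hZ
      have h1 : ∀ c, MvPolynomial.pderiv c (MvPolynomial.homogeneousComponent (d+1) (sym Φ p)) = 0 := by
        intro b
        obtain ⟨h2, h3⟩ := DP_comp Xm hp (hrc b)
        have h4 := ih _ h2 (by rw [hLD]; exact hZΔ _ hZ _ _)
        rw [h4, Finset.sum_eq_single b (fun a _ hab => by rw [ho a b hab, zero_smul]) (by simp)] at h3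
        exact (smul_eq_zero.1 h3.symm).resolve_left (hd b)
      have h2 := (MvPolynomial.homogeneousComponent_isHomogeneous (d+1) (sym Φ p)).sum_X_mul_pderiv
      simp only [h1, mul_zero, Finset.sum_const_zero] at h2
      have h3 := h2.symm
      rw [← Nat.cast_smul_eq_nsmul ℂ] at h3
      exact (smul_eq_zero.1 h3).resolve_left (by exact_mod_cast Nat.succ_ne_zero d)
  have hπ : ∀ p, π (FreeAlgebra.lift ℂ Lv p) = FreeAlgebra.lift ℂ (fun c => π (Lv c)) p := by
    intro p
    have : π.comp (FreeAlgebra.lift ℂ Lv) = FreeAlgebra.lift ℂ (fun c => π (Lv c)) := by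
      apply FreeAlgebra.hom_ext; funext a; simp
    exact DFunLike.congr_fun this p
  have fin : ∀ d, ∀ p ∈ Fl ℂ Φ d, FreeAlgebra.lift ℂ Lv p ∈ Z → π (FreeAlgebra.lift ℂ Lv p) = 0 := by
    intro d
    induction d with
    | zero => intro p hp _; rw [Fl_zero hp]; simp
    | succ d ih =>
      intro p hp hZ
      have h1 := claim d p hp hZ
      obtain ⟨v, hv, w, hw, rfl⟩ := Fl_split hp
      have h2 : sym Φ v = 0 := by
        rw [map_add, map_add, comp_SG (p := sym Φ w) ⟨w, hw, rfl⟩, add_zero] at h1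
        rw [← h1]
        refine hom_Hm_ext (f := (sym Φ).toLinearMap) (g := (MvPolynomial.homogeneousComponent d).comp (sym Φ).toLinearMap) hv ?_
        intro w hw
        simp only [LinearMap.comp_apply, AlgHom.toLinearMap_apply]
        rw [comp_wd, if_pos hw]
      have h3 := sig_sym (fun c => π (Lv c)) hb hv
      rw [h2, map_zero, sub_zero] at h3
      obtain ⟨r, hr, h4⟩ := h3
      have h5 : π (FreeAlgebra.lift ℂ Lv v) = π (FreeAlgebra.lift ℂ Lv r) := by rw [hπ, hπ]; exact h4.symm
      have h6 : FreeAlgebra.lift ℂ Lv (r + w) ∈ Z := by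
        have h7 := hZk (FreeAlgebra.lift ℂ Lv v - FreeAlgebra.lift ℂ Lv r) (by rw [map_sub, h5, sub_self])
        have h8 := sub_mem hZ h7
        convert h8 using 1
        simp only [map_add]; abel
      have h7 := ih (r + w) (add_mem hr hw) h6
      rw [map_add, map_add, h5, ← map_add, ← map_add, h7]
  intro u hu
  obtain ⟨p, rfl⟩ := hgen u
  obtain ⟨d, hp⟩ := exists_Fl p
  exact fin d p hp hu
end
end

section
set_option linter.unusedSimpArgs false
set_option linter.unusedVariables false
set_option linter.unusedSectionVars false
set_option maxHeartbeats 1000000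
section
variable {R : Type*} [CommRing R] {n : ℕ}

/-- Rescaled Serre elements with parameter `z`. -/
def sr (z : R) (i j : Fin n) : FreeAlgebra R (Fin n) :=
  if (i:ℕ) + 2 ≤ j then wd R [i,j] - wd R [j,i]
  else if ((i:ℕ) + 1 = j ∨ (j:ℕ) + 1 = i) ∧ ¬ ((i:ℕ) + 2 = n ∧ (j:ℕ) + 1 = n) then
    (if (i:ℕ) + 1 < n then z else z^2) • wd R [i,i,j] - ((if (i:ℕ) + 1 < n then z else z^2)^2+1) • wd R [i,j,i]
      + (if (i:ℕ) + 1 < n then z else z^2) • wd R [j,i,i]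
  else if (i:ℕ) + 2 = n ∧ (j:ℕ) + 1 = n then
    z^2 • wd R [i,i,i,j] - (z^4+z^2+1) • wd R [i,i,j,i] + (z^4+z^2+1) • wd R [i,j,i,i] - z^2 • wd R [j,i,i,i]
  else 0

def sdeg (n : ℕ) (i j : Fin n) : ℕ :=
  if (i:ℕ) + 2 ≤ j then 2 else if ((i:ℕ) + 1 = j ∨ (j:ℕ) + 1 = i) ∧ ¬ ((i:ℕ) + 2 = n ∧ (j:ℕ) + 1 = n) then 3 else 4

theorem sr_Hm (z : R) (i j : Fin n) : sr z i j ∈ Hm R (Fin n) (sdeg n i j) := by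
  have w : ∀ (d : ℕ) (c : R) (w : List (Fin n)), w.length = d → c • wd R w ∈ Hm R (Fin n) d :=
    fun d c w h => Submodule.smul_mem _ _ (wd_Hm h)
  unfold sr sdeg
  by_cases h1 : (i:ℕ) + 2 ≤ j
  · rw [if_pos h1, if_pos h1]; exact sub_mem (wd_Hm rfl) (wd_Hm rfl)
  · rw [if_neg h1, if_neg h1]
    by_cases h2 : ((i:ℕ) + 1 = j ∨ (j:ℕ) + 1 = i) ∧ ¬ ((i:ℕ) + 2 = n ∧ (j:ℕ) + 1 = n)
    · rw [if_pos h2, if_pos h2]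
      exact add_mem (sub_mem (w _ _ _ rfl) (w _ _ _ rfl)) (w _ _ _ rfl)
    · rw [if_neg h2, if_neg h2]
      by_cases h3 : (i:ℕ) + 2 = n ∧ (j:ℕ) + 1 = n
      · rw [if_pos h3]
        exact sub_mem (add_mem (sub_mem (w _ _ _ rfl) (w _ _ _ rfl)) (w _ _ _ rfl)) (w _ _ _ rfl)
      · rw [if_neg h3]; exact zero_mem _

/-- The two-sided ideal generated by the Serre elements, as a submodule. -/
def Jm (n : ℕ) (z : R) : Submodule R (FreeAlgebra R (Fin n)) :=
  Submodule.span R {x | ∃ a i j b, x = wd R a * sr z i j * wd R b}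
/-- Its degree d part. -/
def Jd (n : ℕ) (z : R) (d : ℕ) : Submodule R (FreeAlgebra R (Fin n)) :=
  Submodule.span R {x | ∃ a i j b, a.length + sdeg n i j + b.length = d ∧ x = wd R a * sr z i j * wd R b}

theorem Jm_left (z : R) (u : FreeAlgebra R (Fin n)) {v : FreeAlgebra R (Fin n)} (hv : v ∈ Jm n z) : u * v ∈ Jm n z := by
  obtain ⟨d, hu⟩ := exists_Fl u
  refine Fl_ind (P := fun u => u * v ∈ Jm n z) hu ?_ (by simp) ?_ ?_
  · intro w hw
    refine Submodule.span_induction (p := fun v _ => wd R w * v ∈ Jm n z) ?_ (by simp) ?_ ?_ hv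
    · rintro _ ⟨a, i, j, b, rfl⟩
      exact Submodule.subset_span ⟨w ++ a, i, j, b, by rw [wd_append]; simp only [mul_assoc]⟩
    · intro x y _ _ hx hy; rw [mul_add]; exact add_mem hx hy
    · intro c x _ hx; rw [mul_smul_comm]; exact Submodule.smul_mem _ _ hx
  · intro x y hx hy; rw [add_mul]; exact add_mem hx hy
  · intro c x hx; rw [smul_mul_assoc]; exact Submodule.smul_mem _ _ hx

theorem Jm_right (z : R) (u : FreeAlgebra R (Fin n)) {v : FreeAlgebra R (Fin n)} (hv : v ∈ Jm n z) : v * u ∈ Jm n z := by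
  obtain ⟨d, hu⟩ := exists_Fl u
  refine Fl_ind (P := fun u => v * u ∈ Jm n z) hu ?_ (by simp) ?_ ?_
  · intro w hw
    refine Submodule.span_induction (p := fun v _ => v * wd R w ∈ Jm n z) ?_ (by simp) ?_ ?_ hv
    · rintro _ ⟨a, i, j, b, rfl⟩
      exact Submodule.subset_span ⟨a, i, j, b ++ w, by rw [wd_append]; simp only [mul_assoc]⟩
    · intro x y _ _ hx hy; rw [add_mul]; exact add_mem hx hy
    · intro c x _ hx; rw [smul_mul_assoc]; exact Submodule.smul_mem _ _ hx
  · intro x y hx hy; rw [mul_add]; exact add_mem hx hy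
  · intro c x hx; rw [mul_smul_comm]; exact Submodule.smul_mem _ _ hx

theorem sr_Jm (z : R) (i j : Fin n) : sr z i j ∈ Jm n z := Submodule.subset_span ⟨[], i, j, [], by simp⟩

def JI (n : ℕ) (z : R) : TwoSidedIdeal (FreeAlgebra R (Fin n)) :=
  TwoSidedIdeal.mk' (Jm n z : Set (FreeAlgebra R (Fin n))) (zero_mem _) (fun h1 h2 => add_mem h1 h2) (fun h => neg_mem h)
    (fun h => Jm_left z _ h) (fun h => Jm_right z _ h)

def Jpi (n : ℕ) (z : R) : FreeAlgebra R (Fin n) →ₐ[R] (JI n z).ringCon.Quotient := RingCon.mkₐ R (JI n z).ringCon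

theorem Jpi_zero {z : R} {u : FreeAlgebra R (Fin n)} : Jpi n z u = 0 ↔ u ∈ Jm n z := by
  have h := congr_arg (fun I => u ∈ I) (TwoSidedIdeal.ker_ringCon_mk' (JI n z))
  simp only [eq_iff_iff] at h
  rw [TwoSidedIdeal.mem_ker] at h
  exact h.trans (TwoSidedIdeal.mem_mk' _ _ _ _ _ _ _)
end

section
attribute [local instance] LieRing.ofAssociativeRing LieAlgebra.ofAssociativeAlgebra

def fC (n k : ℕ) : FreeAlgebra ℂ (Fin n) := if h : k < n then FreeAlgebra.ι ℂ ⟨k, h⟩ else 0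

theorem rv_map {A B : Type*} [Ring A] [Algebra ℂ A] [Ring B] [Algebra ℂ B] (n : ℕ) (f : ℕ → A) (π : A →ₐ[ℂ] B) (j m : ℕ) :
    π (rv n f j m) = rv n (fun k => π (f k)) j m := by
  induction m with
  | zero => rfl
  | succ m ih => rw [rv, rv, ← ih, Ring.lie_def, Ring.lie_def, map_sub, map_mul, map_mul]

theorem fC_CS (n : ℕ) : CS n (fun k => Jpi n (1:ℂ) (fC n k)) := by
  have key : ∀ i j : Fin n, Jpi n (1:ℂ) (sr 1 i j) = 0 := fun i j => Jpi_zero.2 (sr_Jm 1 i j)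
  have f0 : ∀ k, ¬ k < n → fC n k = 0 := fun k hk => by rw [fC, dif_neg hk]
  have f1 : ∀ k (h : k < n), fC n k = FreeAlgebra.ι ℂ ⟨k, h⟩ := fun k hk => by rw [fC, dif_pos hk]
  constructor
  · intro i j hij
    by_cases h : j < n
    · have := key ⟨i, by omega⟩ ⟨j, h⟩
      rw [sr, if_pos (by simpa using hij)] at this
      rw [f1 i (by omega), f1 j h, Ring.lie_def, ← map_mul, ← map_mul, ← map_sub, ← this]
      simp [wd]
    · simp only [f0 j h, map_zero, lie_zero]
  · intro i j hij hex
    by_cases h : j < n ∧ i < n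
    · have := key ⟨i, h.2⟩ ⟨j, h.1⟩
      rw [sr, if_neg (by simp only []; omega), if_pos (by exact ⟨hij, hex⟩)] at this
      simp only [f1 i h.2, f1 j h.1, Ring.lie_def, ← map_mul, ← map_sub]
      rw [← this]
      congr 1
      simp only [wd, one_pow, ite_self, one_smul, List.map_cons, List.map_nil, List.prod_cons, List.prod_nil, mul_one]
      rw [show ((1:ℂ)+1) = 2 by norm_num, two_smul]
      noncomm_ring
    · rcases not_and_or.1 h with h | h
      · simp only [f0 j h, map_zero, lie_zero]
      · simp only [f0 i h, map_zero, zero_lie]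
  · intro i j hi hj
    have := key ⟨i, by omega⟩ ⟨j, by omega⟩
    rw [sr, if_neg (by simp only []; omega), if_neg (by simp only []; omega), if_pos (by exact ⟨hi, hj⟩)] at this
    simp only [f1 i (by omega : i < n), f1 j (by omega : j < n), Ring.lie_def, ← map_mul, ← map_sub]
    rw [← this]
    congr 1
    simp only [wd, one_pow, ite_self, one_smul, List.map_cons, List.map_nil, List.prod_cons, List.prod_nil, mul_one]
    rw [show ((1:ℂ)+1+1) = 3 by norm_num, show (3:ℂ) = 1 + 1 + 1 by norm_num]
    simp only [add_smul, one_smul]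
    noncomm_ring

/-- classical coaction -/
def Dc (n : ℕ) : FreeAlgebra ℂ (Fin n) →ₐ[ℂ] Matrix (Fin (2*n)) (Fin (2*n)) (FreeAlgebra ℂ (Fin n)) :=
  FreeAlgebra.lift ℂ fun i => Matrix.scalarAlgHom (Fin (2*n)) ℂ (FreeAlgebra.ι ℂ i) + AlgHom.mapMatrix (Algebra.ofId ℂ _) (XM n i)

theorem sc_comm {A I : Type*} [Ring A] [Algebra ℂ A] [Fintype I] [DecidableEq I] (a : A) (M : Matrix I I ℂ) :
    Matrix.scalarAlgHom I ℂ a * AlgHom.mapMatrix (Algebra.ofId ℂ A) M = AlgHom.mapMatrix (Algebra.ofId ℂ A) M * Matrix.scalarAlgHom I ℂ a := by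
  ext x y
  simp only [Matrix.scalarAlgHom_apply, Matrix.scalar_apply, Matrix.diagonal_mul, Matrix.mul_diagonal, AlgHom.mapMatrix_apply, Matrix.map_apply,
    Algebra.ofId_apply]
  exact (Algebra.commutes _ _).symm

theorem Dc_rv (n j : ℕ) : ∀ m, 2*j+m+2 ≤ 2*n → Dc n (rv n (fC n) j m) =
    Matrix.scalarAlgHom (Fin (2*n)) ℂ (rv n (fC n) j m) + AlgHom.mapMatrix (Algebra.ofId ℂ _) (rv n (XM n) j m) := by
  have f1 : ∀ k (h : k < n), fC n k = FreeAlgebra.ι ℂ ⟨k, h⟩ := fun k hk => by rw [fC, dif_pos hk]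
  have hg : ∀ k, k < n → Dc n (fC n k) = Matrix.scalarAlgHom (Fin (2*n)) ℂ (fC n k) + AlgHom.mapMatrix (Algebra.ofId ℂ _) (XM n k) := by
    intro k hk
    rw [f1 k hk, Dc, FreeAlgebra.lift_ι_apply]
  intro m
  induction m with
  | zero => intro h; exact hg j (by omega)
  | succ m ih =>
    intro h
    have hr : rho n (j + m + 2) < n := by unfold rho; split_ifs <;> omega
    rw [rv, rv, Ring.lie_def, Ring.lie_def, map_sub, map_mul, map_mul, ih (by omega), hg _ hr]
    simp only [map_sub, map_mul, mul_add, add_mul]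
    rw [sc_comm (fC n (rho n (j+m+2))), sc_comm (rv n (fC n) j m)]
    abel

/-- index set of positive roots -/
abbrev PhiC (n : ℕ) : Type := {p : Fin n × Fin (2*n) // 2*(p.1:ℕ)+(p.2:ℕ)+2 ≤ 2*n}

theorem classical (n : ℕ) (Z : Submodule ℂ (FreeAlgebra ℂ (Fin n))) (hZk : Jm n (1:ℂ) ≤ Z)
    (hZΔ : ∀ u ∈ Z, ∀ x y, Dc n u x y ∈ Z) (hZ0 : ∀ c : ℂ, algebraMap ℂ _ c ∈ Z → c = 0) : Z ≤ Jm n (1:ℂ) := by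
  intro u hu
  have := pbw (Φ := PhiC n) (fun p => rv n (XM n) p.1.1 p.1.2) (Jpi n (1:ℂ)) (fun p => rv n (fC n) p.1.1 p.1.2) (Dc n)
    (fun p => Dc_rv n _ _ p.2) ?_ ?_ Z (fun u hu => hZk (Jpi_zero.1 hu)) hZΔ hZ0
    (fun p => ⟨p.1.1, by have := p.2; omega⟩) (fun p => ⟨p.1.1 + 1 + p.1.2, by have := p.2; omega⟩) ?_ ?_ ?_ u hu
  · exact Jpi_zero.1 this
  · intro v
    refine ⟨FreeAlgebra.lift ℂ (fun i : Fin n => FreeAlgebra.ι ℂ (⟨(i, ⟨0, by have := i.2; omega⟩), by have := i.2; simp only []; omega⟩ : PhiC n)) v, ?_⟩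
    rw [← AlgHom.comp_apply]
    have : ((FreeAlgebra.lift ℂ) fun p : PhiC n => rv n (fC n) p.1.1 p.1.2).comp
        (FreeAlgebra.lift ℂ (fun i : Fin n => FreeAlgebra.ι ℂ (⟨(i, ⟨0, by have := i.2; omega⟩), by have := i.2; simp only []; omega⟩ : PhiC n))) = AlgHom.id ℂ _ := by
      apply FreeAlgebra.hom_ext
      funext i
      simp [rv, fC]
    rw [this]; rfl
  · intro a b
    have h := rvs_rv (fC_CS n) a.1.1 a.1.2 a.2 _ (rv_mem (f := fun k => Jpi n (1:ℂ) (fC n k)) b.2)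
    rw [Ring.lie_def] at h
    simp only [rv_map]
    refine Submodule.span_mono ?_ h
    rintro _ ⟨j, m, hv, rfl⟩
    exact ⟨⟨(⟨j, by omega⟩, ⟨m, by omega⟩), hv⟩, rfl⟩
  · intro p h
    rw [Fin.ext_iff] at h
    simp only [] at h
    omega
  · intro p
    exact rvX_diag n _ _ p.2 _ _ rfl rfl
  · intro a b hab
    refine rvX_off n _ _ a.2 b.1.1 b.1.2 b.2 ?_ _ _ rfl rfl
    rintro ⟨h1, h2⟩
    exact hab (Subtype.ext (Prod.ext (Fin.ext h1) (Fin.ext h2)))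
end
end

section
set_option linter.unusedSimpArgs false
set_option linter.unusedVariables false
set_option linter.unusedSectionVars false
set_option maxHeartbeats 1000000
section
variable {R : Type*} [CommRing R] {R' : Type*} [CommRing R'] {X : Type*}

/-- base change of free algebras -/
def bcr (φ : R →+* R') (X : Type*) : FreeAlgebra R X →+* FreeAlgebra R' X :=
  letI : Algebra R (FreeAlgebra R' X) := ((algebraMap R' (FreeAlgebra R' X)).comp φ).toAlgebra' (fun c x => Algebra.commutes (φ c) x)
  (FreeAlgebra.lift R (FreeAlgebra.ι R') : FreeAlgebra R X →ₐ[R] FreeAlgebra R' X).toRingHom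

theorem bcr_ι (φ : R →+* R') (x : X) : bcr φ X (FreeAlgebra.ι R x) = FreeAlgebra.ι R' x := by
  letI : Algebra R (FreeAlgebra R' X) := ((algebraMap R' (FreeAlgebra R' X)).comp φ).toAlgebra' (fun c x => Algebra.commutes (φ c) x)
  exact FreeAlgebra.lift_ι_apply (R := R) (FreeAlgebra.ι R') x

theorem bcr_alg (φ : R →+* R') (r : R) : bcr φ X (algebraMap R _ r) = algebraMap R' _ (φ r) := by
  letI : Algebra R (FreeAlgebra R' X) := ((algebraMap R' (FreeAlgebra R' X)).comp φ).toAlgebra' (fun c x => Algebra.commutes (φ c) x)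
  exact AlgHom.commutes (FreeAlgebra.lift R (FreeAlgebra.ι R') : FreeAlgebra R X →ₐ[R] FreeAlgebra R' X) r

theorem bcr_smul (φ : R →+* R') (r : R) (u : FreeAlgebra R X) : bcr φ X (r • u) = φ r • bcr φ X u := by
  rw [Algebra.smul_def, map_mul, bcr_alg, Algebra.smul_def]

theorem bcr_wd (φ : R →+* R') (w : List X) : bcr φ X (wd R w) = wd R' w := by
  induction w with
  | nil => simp
  | cons a w ih => rw [wd_cons, wd_cons, map_mul, bcr_ι, ih]

theorem bcr_sr (φ : R →+* R') {n : ℕ} (z : R) (i j : Fin n) : bcr φ (Fin n) (sr z i j) = sr (φ z) i j := by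
  unfold sr
  split_ifs <;> simp only [map_sub, map_add, map_zero, bcr_smul, bcr_wd, map_pow, map_one]

theorem bcr_Hm (φ : R →+* R') {d : ℕ} {u : FreeAlgebra R X} (hu : u ∈ Hm R X d) : bcr φ X u ∈ Hm R' X d := by
  refine Hm_ind (P := fun u => bcr φ X u ∈ Hm R' X d) hu ?_ ?_ ?_ ?_
  · intro w hw; rw [bcr_wd]; exact wd_Hm hw
  · rw [map_zero]; exact zero_mem _
  · intro x y hx hy; rw [map_add]; exact add_mem hx hy
  · intro c x hx; rw [bcr_smul]; exact Submodule.smul_mem _ _ hx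

theorem bcr_Jd (φ : R →+* R') {n : ℕ} {z : R} {d : ℕ} {u : FreeAlgebra R (Fin n)} (hu : u ∈ Jd n z d) :
    bcr φ (Fin n) u ∈ Jd n (φ z) d := by
  refine Submodule.span_induction (p := fun u _ => bcr φ (Fin n) u ∈ Jd n (φ z) d) ?_ ?_ ?_ ?_ hu
  · rintro _ ⟨a, i, j, b, h, rfl⟩
    rw [map_mul, map_mul, bcr_wd, bcr_wd, bcr_sr]
    exact Submodule.subset_span ⟨a, i, j, b, h, rfl⟩
  · rw [map_zero]; exact zero_mem _
  · intro x y _ _ hx hy; rw [map_add]; exact add_mem hx hy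
  · intro c x _ hx; rw [bcr_smul]; exact Submodule.smul_mem _ _ hx

theorem bcr_Jd_surj (φ : R →+* R') (hφ : Function.Surjective φ) {n : ℕ} {z : R} {d : ℕ} {u : FreeAlgebra R' (Fin n)} (hu : u ∈ Jd n (φ z) d) :
    ∃ v ∈ Jd n z d, bcr φ (Fin n) v = u := by
  refine Submodule.span_induction (p := fun u _ => ∃ v ∈ Jd n z d, bcr φ (Fin n) v = u) ?_ ?_ ?_ ?_ hu
  · rintro _ ⟨a, i, j, b, h, rfl⟩
    exact ⟨_, Submodule.subset_span ⟨a, i, j, b, h, rfl⟩, by rw [map_mul, map_mul, bcr_wd, bcr_wd, bcr_sr]⟩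
  · exact ⟨0, zero_mem _, map_zero _⟩
  · rintro _ _ _ _ ⟨x, hx, rfl⟩ ⟨y, hy, rfl⟩; exact ⟨_, add_mem hx hy, map_add _ _ _⟩
  · rintro c _ _ ⟨x, hx, rfl⟩
    obtain ⟨c, rfl⟩ := hφ c
    exact ⟨_, Submodule.smul_mem _ c hx, bcr_smul _ _ _⟩

theorem bcr_lift (φ : R →+* R') (u : FreeAlgebra R X) : FreeAlgebra.lift R' (fun _ : X => (0:R')) (bcr φ X u) = φ (FreeAlgebra.lift R (fun _ : X => (0:R)) u) := by
  induction u using FreeAlgebra.induction with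
  | grade0 r => rw [bcr_alg, AlgHom.commutes, AlgHom.commutes]; rfl
  | grade1 x => rw [bcr_ι, FreeAlgebra.lift_ι_apply, FreeAlgebra.lift_ι_apply, map_zero]
  | mul a b ha hb => simp only [map_mul, ha, hb]
  | add a b ha hb => simp only [map_add, ha, hb]

/-- degree maps -/
def dgp (R : Type*) [CommRing R] (X : Type*) : FreeAlgebra R X →ₐ[R] Polynomial (FreeAlgebra R X) :=
  FreeAlgebra.lift R fun x => Polynomial.monomial 1 (FreeAlgebra.ι R x)

theorem dgp_wd (w : List X) : dgp R X (wd R w) = Polynomial.monomial w.length (wd R w) := by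
  induction w with
  | nil => simp
  | cons a w ih =>
    rw [wd_cons, map_mul, ih, dgp, FreeAlgebra.lift_ι_apply, Polynomial.monomial_mul_monomial, List.length_cons, add_comm]

theorem dgp_coeff_smul (d : ℕ) (c : R) (x : FreeAlgebra R X) : (dgp R X (c • x)).coeff d = c • (dgp R X x).coeff d := by
  rw [map_smul, Polynomial.coeff_smul]

theorem dgp_Hm {d e : ℕ} {u : FreeAlgebra R X} (hu : u ∈ Hm R X e) : (dgp R X u).coeff d = if e = d then u else 0 := by
  refine Hm_ind (P := fun u => (dgp R X u).coeff d = if e = d then u else 0) hu ?_ ?_ ?_ ?_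
  · intro w hw; rw [dgp_wd, Polynomial.coeff_monomial, hw]
  · simp
  · intro x y hx hy; rw [map_add, Polynomial.coeff_add, hx, hy]; split_ifs <;> simp
  · intro c x hx; rw [dgp_coeff_smul, hx]; split_ifs <;> simp

theorem Hm_mul {d e : ℕ} {u v : FreeAlgebra R X} (hu : u ∈ Hm R X d) (hv : v ∈ Hm R X e) : u * v ∈ Hm R X (d+e) := by
  refine Hm_ind (P := fun u => u * v ∈ Hm R X (d+e)) hu ?_ (by simp) ?_ ?_
  · intro w hw
    refine Hm_ind (P := fun v => wd R w * v ∈ Hm R X (d+e)) hv ?_ (by simp) ?_ ?_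
    · intro w' hw'
      rw [← wd_append]; exact wd_Hm (by rw [List.length_append]; omega)
    · intro x y hx hy; rw [mul_add]; exact add_mem hx hy
    · intro c x hx; rw [mul_smul_comm]; exact Submodule.smul_mem _ _ hx
  · intro x y hx hy; rw [add_mul]; exact add_mem hx hy
  · intro c x hx; rw [smul_mul_assoc]; exact Submodule.smul_mem _ _ hx

theorem asb_Hm {n : ℕ} (z : R) (a : List (Fin n)) (i j : Fin n) (b : List (Fin n)) :
    wd R a * sr z i j * wd R b ∈ Hm R (Fin n) (a.length + sdeg n i j + b.length) :=
  Hm_mul (Hm_mul (wd_Hm rfl) (sr_Hm z i j)) (wd_Hm rfl)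

theorem Jd_Hm {n : ℕ} {z : R} {d : ℕ} : Jd n z d ≤ Hm R (Fin n) d := by
  refine Submodule.span_le.2 ?_
  rintro _ ⟨a, i, j, b, h, rfl⟩
  rw [← h]; exact asb_Hm z a i j b

theorem Jm_Jd {n : ℕ} {z : R} {d : ℕ} {u : FreeAlgebra R (Fin n)} (hu : u ∈ Jm n z) (hd : u ∈ Hm R (Fin n) d) : u ∈ Jd n z d := by
  have h1 : (dgp R (Fin n) u).coeff d ∈ Jd n z d := by
    refine Submodule.span_induction (p := fun u _ => (dgp R (Fin n) u).coeff d ∈ Jd n z d) ?_ (by simp) ?_ ?_ hu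
    · rintro _ ⟨a, i, j, b, rfl⟩
      rw [dgp_Hm (asb_Hm z a i j b)]
      split_ifs with h
      · exact Submodule.subset_span ⟨a, i, j, b, h, rfl⟩
      · exact zero_mem _
    · intro x y _ _ hx hy; rw [map_add, Polynomial.coeff_add]; exact add_mem hx hy
    · intro c x _ hx; rw [dgp_coeff_smul]; exact Submodule.smul_mem _ _ hx
  rwa [dgp_Hm hd, if_pos rfl] at h1

theorem Hm_fg {n : ℕ} (d : ℕ) : (Hm R (Fin n) d).FG := by
  refine Submodule.fg_span ?_
  exact (List.finite_length_eq (Fin n) d).image (wd R)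
end

section
open Polynomial
variable {X : Type*}
theorem ev_lift {d : ℕ} {u : FreeAlgebra ℂ[X] X} (hu : u ∈ Hm ℂ[X] X d) :
    ∃ v ∈ Hm ℂ[X] X d, u = bcr Polynomial.C X (bcr (Polynomial.evalRingHom (1:ℂ)) X u) + (Polynomial.X - Polynomial.C 1 : ℂ[X]) • v := by
  refine (Hm_ind (P := fun u => u ∈ Hm ℂ[X] X d ∧ ∃ v ∈ Hm ℂ[X] X d, u = bcr Polynomial.C X (bcr (Polynomial.evalRingHom (1:ℂ)) X u) + (Polynomial.X - Polynomial.C 1 : ℂ[X]) • v) hu ?_ ?_ ?_ ?_).2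
  · intro w hw; exact ⟨wd_Hm hw, 0, zero_mem _, by rw [bcr_wd, bcr_wd]; simp⟩
  · exact ⟨zero_mem _, 0, zero_mem _, by simp⟩
  · rintro x y ⟨hx, v, hv, h1⟩ ⟨hy, w, hw, h2⟩
    refine ⟨add_mem hx hy, v + w, add_mem hv hw, ?_⟩
    nth_rewrite 1 [h1, h2]
    simp only [map_add, smul_add]; abel
  · rintro c x ⟨hx, v, hv, h1⟩
    obtain ⟨p, hp⟩ := Polynomial.X_sub_C_dvd_sub_C_eval (a := (1:ℂ)) (p := c)
    set e := bcr (Polynomial.evalRingHom (1:ℂ)) X x with he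
    refine ⟨Submodule.smul_mem _ _ hx, p • bcr Polynomial.C X e + c • v,
      add_mem (Submodule.smul_mem _ _ (bcr_Hm _ (bcr_Hm _ hx))) (Submodule.smul_mem _ _ hv), ?_⟩
    rw [bcr_smul, bcr_smul, ← he, smul_add, smul_smul, ← hp, Polynomial.coe_evalRingHom]
    nth_rewrite 1 [h1]
    rw [smul_add, sub_smul c, smul_comm c]
    abel
end
end

section
set_option synthInstance.maxHeartbeats 1000000
set_option maxHeartbeats 4000000
set_option linter.unusedSimpArgs false
set_option linter.unusedVariables false
set_option linter.unusedSectionVars false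
section
open Polynomial
variable {n : ℕ}

def ev (n : ℕ) : FreeAlgebra ℂ[X] (Fin n) →+* FreeAlgebra ℂ (Fin n) := bcr (Polynomial.evalRingHom (1:ℂ)) (Fin n)
def mp (n : ℕ) : FreeAlgebra ℂ[X] (Fin n) →+* FB n := bcr (algebraMap ℂ[X] F) (Fin n)

theorem amX : algebraMap ℂ[X] F X = q := RatFunc.algebraMap_X

theorem ev_smul (p : ℂ[X]) (u : FreeAlgebra ℂ[X] (Fin n)) : ev n (p • u) = p.eval 1 • ev n u := bcr_smul _ _ _
theorem mp_smul (p : ℂ[X]) (u : FreeAlgebra ℂ[X] (Fin n)) : mp n (p • u) = algebraMap ℂ[X] F p • mp n u := bcr_smul _ _ _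

theorem ka_poly (i : Fin n) (x : Ix n) : ∃ p : ℂ[X], algebraMap ℂ[X] F p = q^2 * ka q⁻¹ i x ∧ p.eval 1 = 1 := by
  have hq := q_ne
  unfold ka zi
  split_ifs
  · exact ⟨X, by rw [amX]; field_simp, by simp⟩
  · exact ⟨1, by rw [map_one]; field_simp, by simp⟩
  · exact ⟨X^3, by rw [map_pow, amX]; field_simp, by simp⟩
  · exact ⟨X^4, by rw [map_pow, amX]; field_simp, by simp⟩
  · exact ⟨X^2, by rw [map_pow, amX]; field_simp, by simp⟩

theorem XM_apply (k : ℕ) (x y : Fin (2*n)) : XM n k x y = -(if x.val = k ∧ y.val = k+1 then 1 else 0) + (if k+1<n then (if x.val=2*n-2-k ∧ y.val=2*n-1-k then 1 else 0) else 0) := by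
  unfold XM
  by_cases h : k+1<n
  · rw [if_pos h, if_pos h]; rfl
  · rw [if_neg h, if_neg h]; rfl

theorem fm_XM (i : Fin n) (x y : Ix n) : fm i x y = algebraMap ℂ[X] F (C (XM n i x y)) := by
  have hi' := i.isLt; have hx := x.isLt; have hy := y.isLt
  have v1 := lo_val i; have v2 := hi_val i
  have w1 := pr_val (n := n) (lo i); have w2 := pr_val (n := n) (hi i)
  rw [XM_apply]
  unfold fm sg ph
  simp only [Fin.ext_iff, v1, v2, w1, w2]
  split_ifs <;> first | (exfalso; omega) | simp

theorem D_lift (u : FreeAlgebra ℂ[X] (Fin n)) : ∃ N : ℕ, ∃ v : Matrix (Ix n) (Ix n) (FreeAlgebra ℂ[X] (Fin n)),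
    (∀ x y, mp n (v x y) = q^N • Dq n (mp n u) x y) ∧ (∀ x y, ev n (v x y) = Dc n (ev n u) x y) := by
  induction u using FreeAlgebra.induction with
  | grade0 r =>
    refine ⟨0, algebraMap _ _ r, ?_, ?_⟩
    · intro x y
      rw [mp, bcr_alg, AlgHom.commutes, pow_zero, one_smul, Matrix.algebraMap_matrix_apply, Matrix.algebraMap_matrix_apply]
      split_ifs
      · rw [bcr_alg]
      · rw [map_zero]
    · intro x y
      rw [ev, bcr_alg, AlgHom.commutes, Matrix.algebraMap_matrix_apply, Matrix.algebraMap_matrix_apply]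
      split_ifs
      · rw [bcr_alg]
      · rw [map_zero]
  | grade1 i =>
    choose p hp hp1 using ka_poly i
    refine ⟨2, fun x y => algebraMap ℂ[X] _ (X^2 * C (XM n i x y)) + if x = y then p x • FreeAlgebra.ι _ i else 0, ?_, ?_⟩
    · intro x y
      simp only [map_add]
      rw [mp, bcr_alg, bcr_ι, Dq, FreeAlgebra.lift_ι_apply, Matrix.add_apply, smul_add]
      congr 1
      · rw [map_mul, map_pow, amX, ← fm_XM, map_mul, Algebra.smul_def, map_pow]; rfl
      · by_cases h : x = y
        · subst h
          rw [if_pos rfl, bcr_smul, bcr_ι, hp, mul_smul]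
          simp [km, Matrix.scalarAlgHom_apply, Matrix.scalar_apply, Algebra.ofId_apply, Algebra.smul_def]
        · rw [if_neg h, map_zero]
          simp [km, Matrix.scalarAlgHom_apply, Matrix.scalar_apply, h]
    · intro x y
      simp only [map_add]
      rw [ev, bcr_alg, bcr_ι, Dc, FreeAlgebra.lift_ι_apply, Matrix.add_apply, add_comm]
      congr 1
      · by_cases h : x = y
        · subst h
          rw [if_pos rfl, bcr_smul, bcr_ι, coe_evalRingHom, hp1]
          simp [Matrix.scalarAlgHom_apply, Matrix.scalar_apply]
        · rw [if_neg h, map_zero]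
          simp [Matrix.scalarAlgHom_apply, Matrix.scalar_apply, h]
      · simp [Algebra.ofId_apply]
  | mul a b ha hb =>
    obtain ⟨N, v, h1, h2⟩ := ha
    obtain ⟨N', v', h3, h4⟩ := hb
    refine ⟨N + N', v * v', ?_, ?_⟩
    · intro x y
      rw [Matrix.mul_apply, map_sum, map_mul, map_mul, Matrix.mul_apply, Finset.smul_sum]
      apply Finset.sum_congr rfl
      intro z _
      rw [map_mul, h1, h3, smul_mul_smul_comm, pow_add]
    · intro x y
      rw [Matrix.mul_apply, map_sum, map_mul, map_mul, Matrix.mul_apply]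
      apply Finset.sum_congr rfl
      intro z _
      rw [map_mul, h2, h4]
  | add a b ha hb =>
    obtain ⟨N, v, h1, h2⟩ := ha
    obtain ⟨N', v', h3, h4⟩ := hb
    refine ⟨N + N', fun x y => (X^N' : ℂ[X]) • v x y + (X^N : ℂ[X]) • v' x y, ?_, ?_⟩
    · intro x y
      simp only [map_add, Matrix.add_apply, mp_smul, h1, h3, map_pow, amX, smul_smul, smul_add]
      rw [add_comm N N', pow_add, mul_comm (q^N) (q^N')]
    · intro x y
      simp only [map_add, Matrix.add_apply, ev_smul, h2, h4]
      simp

theorem evF_sr (i j : Fin n) : evF n (sr q i j) = 0 := by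
  have h := Fh_qs n
  have hq := q_ne
  have hw : ∀ w, evF n (wd F w) = (w.map (Fh n)).prod := fun w => lift_wd _ w
  unfold sr
  split_ifs with h1 h2 h3 h4 <;> simp only [map_sub, map_add, map_smul, hw, map_zero, List.map_cons, List.map_nil, List.prod_cons, List.prod_nil, mul_one]
  · rw [h.comm i j h1, sub_self]
  · have := congr_arg (fun x => q • x) (h.serre i j h2.1 h2.2)
    simp only [smul_zero] at this
    rw [← this, smul_add, smul_sub, smul_smul, qi, if_pos h3, mul_add, mul_inv_cancel₀ hq]
    simp only [pow_two, mul_assoc]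
  · have := congr_arg (fun x => q^2 • x) (h.serre i j h2.1 h2.2)
    simp only [smul_zero] at this
    rw [← this, smul_add, smul_sub, smul_smul, qi, if_neg h3, mul_add, mul_inv_cancel₀ (pow_ne_zero 2 hq), ← pow_two (q^2)]
    simp only [pow_two (Fh n i), mul_assoc]
  · have := congr_arg (fun x => q^2 • x) (h.quartic i j h4.1 h4.2)
    simp only [smul_zero] at this
    have e : q^2 * (q^2 + 1 + (q^2)⁻¹) = q^4 + q^2 + 1 := by field_simp
    rw [← this, smul_sub, smul_add, smul_sub, smul_smul, smul_smul, e]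
    simp only [pow_succ, pow_zero, one_mul, mul_assoc]

theorem evF_Jd {d : ℕ} {u : FB n} (hu : u ∈ Jd n q d) : evF n u = 0 := by
  refine Submodule.span_induction (p := fun u _ => evF n u = 0) ?_ (map_zero _) ?_ ?_ hu
  · rintro _ ⟨a, i, j, b, h, rfl⟩
    rw [map_mul, map_mul, evF_sr, mul_zero, zero_mul]
  · intro x y _ _ hx hy; rw [map_add, hx, hy, add_zero]
  · intro c x _ hx; rw [map_smul, hx, smul_zero]

def Z1 (n : ℕ) : Submodule ℂ (FreeAlgebra ℂ (Fin n)) where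
  carrier := {x | ∃ u, evF n (mp n u) = 0 ∧ ev n u = x}
  zero_mem' := ⟨0, by simp, by simp⟩
  add_mem' := by
    rintro _ _ ⟨u, hu, rfl⟩ ⟨v, hv, rfl⟩
    exact ⟨u + v, by rw [map_add, map_add, hu, hv, add_zero], map_add _ _ _⟩
  smul_mem' := by
    rintro c _ ⟨u, hu, rfl⟩
    exact ⟨C c • u, by rw [mp_smul, map_smul, hu, smul_zero], by rw [ev_smul, eval_C]⟩

theorem Z1_le : Z1 n ≤ Jm n (1:ℂ) := by
  apply classical
  · refine Submodule.span_le.2 ?_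
    rintro _ ⟨a, i, j, b, rfl⟩
    refine ⟨wd _ a * sr X i j * wd _ b, ?_, ?_⟩
    · simp only [mp, map_mul, bcr_sr, amX, evF_sr, mul_zero, zero_mul]
    · rw [ev, map_mul, map_mul, bcr_sr, bcr_wd, bcr_wd, coe_evalRingHom, eval_X]
  · rintro _ ⟨u, hu, rfl⟩ x y
    obtain ⟨N, v, h1, h2⟩ := D_lift u
    exact ⟨v x y, by rw [h1, map_smul, ker_Dq _ hu, smul_zero], h2 x y⟩
  · rintro c ⟨u, hu, h1⟩
    have h2 := ker_const _ hu
    rw [mp, bcr_lift] at h2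
    have h3 := (map_eq_zero_iff _ (RatFunc.algebraMap_injective ℂ)).1 h2
    have h4 := bcr_lift (X := Fin n) (Polynomial.evalRingHom (1:ℂ)) u
    rw [h3, map_zero] at h4
    change FreeAlgebra.lift ℂ _ (ev n u) = 0 at h4
    rw [h1, AlgHom.commutes] at h4
    exact h4

def NdO (n d : ℕ) : Submodule ℂ[X] (FreeAlgebra ℂ[X] (Fin n)) where
  carrier := {u | u ∈ Hm ℂ[X] (Fin n) d ∧ evF n (mp n u) = 0}
  zero_mem' := ⟨zero_mem _, by simp⟩
  add_mem' := by
    rintro u v ⟨h1, hu⟩ ⟨h2, hv⟩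
    exact ⟨add_mem h1 h2, by rw [map_add, map_add, hu, hv, add_zero]⟩
  smul_mem' := by
    rintro c u ⟨h1, hu⟩
    exact ⟨Submodule.smul_mem _ _ h1, by rw [mp_smul, map_smul, hu, smul_zero]⟩

theorem NdO_fg (d : ℕ) : (NdO n d).FG :=
  isNoetherian_submodule.1 (isNoetherian_of_fg_of_noetherian _ (Hm_fg (R := ℂ[X]) (n := n) d)) _ fun u hu => hu.1

theorem q_sub_one : algebraMap ℂ[X] F (X - C 1) ≠ 0 := by
  rw [Ne, map_eq_zero_iff _ (RatFunc.algebraMap_injective ℂ)]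
  exact X_sub_C_ne_zero 1

theorem NdO_le (d : ℕ) : NdO n d ≤ Jd n X d ⊔ (Ideal.span {(X - C 1 : ℂ[X])}) • NdO n d := by
  rintro u ⟨h1, h2⟩
  have h3 : ev n u ∈ Jd n (1:ℂ) d := Jm_Jd (Z1_le ⟨u, h2, rfl⟩) (bcr_Hm _ h1)
  have h4 : (1:ℂ) = Polynomial.evalRingHom (1:ℂ) X := by simp
  rw [h4] at h3
  obtain ⟨v, hv, h5⟩ := bcr_Jd_surj (Polynomial.evalRingHom (1:ℂ)) (fun c => ⟨C c, by simp⟩) h3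
  obtain ⟨w, hw, h6⟩ := ev_lift (sub_mem h1 (Jd_Hm hv))
  rw [map_sub, h5, ev, sub_self, map_zero, zero_add] at h6
  have h7 : evF n (mp n (u - v)) = 0 := by
    rw [map_sub, map_sub, h2, zero_sub, neg_eq_zero]
    apply evF_Jd (d := d)
    rw [← amX]; exact bcr_Jd _ hv
  rw [h6, mp_smul, map_smul] at h7
  have h8 := (smul_eq_zero.1 h7).resolve_left q_sub_one
  rw [← sub_add_cancel u v, add_comm]
  refine Submodule.add_mem_sup hv ?_
  rw [h6]
  exact Submodule.smul_mem_smul (Ideal.subset_span rfl) ⟨hw, h8⟩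

theorem clear_den {d : ℕ} {u : FB n} (hu : u ∈ Hm F (Fin n) d) : ∃ p : ℂ[X], p ≠ 0 ∧ ∃ v ∈ Hm ℂ[X] (Fin n) d, mp n v = algebraMap ℂ[X] F p • u := by
  refine Hm_ind (P := fun u => ∃ p : ℂ[X], p ≠ 0 ∧ ∃ v ∈ Hm ℂ[X] (Fin n) d, mp n v = algebraMap ℂ[X] F p • u) hu ?_ ?_ ?_ ?_
  · intro w hw; exact ⟨1, one_ne_zero, _, wd_Hm hw, by rw [mp, bcr_wd, map_one, one_smul]⟩
  · exact ⟨1, one_ne_zero, 0, zero_mem _, by simp⟩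
  · rintro x y ⟨p, hp, v, hv, h1⟩ ⟨p', hp', v', hv', h2⟩
    refine ⟨p * p', mul_ne_zero hp hp', p' • v + p • v', add_mem (Submodule.smul_mem _ _ hv) (Submodule.smul_mem _ _ hv'), ?_⟩
    rw [map_add, mp_smul, mp_smul, h1, h2, map_mul, smul_smul, smul_smul, smul_add, mul_comm]
  · rintro c x ⟨p, hp, v, hv, h1⟩
    obtain ⟨a, b, hb, rfl⟩ := IsFractionRing.div_surjective ℂ[X] c
    have hb0 : b ≠ 0 := nonZeroDivisors.ne_zero hb
    have hb1 : algebraMap ℂ[X] F b ≠ 0 := by rwa [Ne, map_eq_zero_iff _ (RatFunc.algebraMap_injective ℂ)]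
    refine ⟨b * p, mul_ne_zero hb0 hp, a • v, Submodule.smul_mem _ _ hv, ?_⟩
    rw [mp_smul, h1, smul_smul, smul_smul, map_mul]
    congr 1
    field_simp

/-- Main theorem: homogeneous relations between the `F_i` are consequences of the Serre relations. -/
theorem MT {d : ℕ} {u : FB n} (hu : u ∈ Hm F (Fin n) d) (h : evF n u = 0) : u ∈ Jd n q d := by
  obtain ⟨p, hp, v, hv, h1⟩ := clear_den hu
  obtain ⟨r, hr1, hr2⟩ := Submodule.exists_sub_one_mem_and_smul_le_of_fg_of_le_sup (NdO_fg (n := n) d) le_rfl (NdO_le d)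
  have hr : r ≠ 0 := by
    rintro rfl
    rw [Ideal.mem_span_singleton, dvd_iff_isRoot] at hr1
    simp at hr1
  have h2 : v ∈ NdO n d := ⟨hv, by rw [h1, map_smul, h, smul_zero]⟩
  have h3 : r • v ∈ Jd n X d := hr2 (Submodule.smul_mem_pointwise_smul _ r _ h2)
  have h4 := bcr_Jd (algebraMap ℂ[X] F) h3
  change mp n (r • v) ∈ _ at h4
  rw [amX, mp_smul, h1, smul_smul, ← map_mul] at h4
  have h5 : algebraMap ℂ[X] F (r * p) ≠ 0 := by
    rw [Ne, map_eq_zero_iff _ (RatFunc.algebraMap_injective ℂ)]; exact mul_ne_zero hr hp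
  exact (Submodule.smul_mem_iff _ h5).1 h4
end
end

section
set_option synthInstance.maxHeartbeats 1000000
set_option maxHeartbeats 4000000
set_option linter.unusedSimpArgs false
set_option linter.unusedVariables false
set_option linter.unusedSectionVars false
section
variable {n : ℕ} {A : Type*} [Ring A] [Algebra F A]

abbrev LA (A : Type*) [Ring A] : Type _ := AddMonoidAlgebra A ℤ
def gs (m : ℤ) : A →ₗ[F] LA A := AddMonoidAlgebra.lsingle m
theorem gs_mul (m k : ℤ) (x y : A) : gs m x * gs k y = gs (m+k) (x*y) := by
  simp only [gs, AddMonoidAlgebra.lsingle_apply, AddMonoidAlgebra.single_mul_single]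
theorem gs_one : gs 0 (1:A) = 1 := by
  simp only [gs, AddMonoidAlgebra.lsingle_apply]; rfl

def dgi (i j : Ix n) : ℤ := (i:ℕ) - (j:ℕ)
def gM (X : Matrix (Ix n) (Ix n) A) : Matrix (Ix n) (Ix n) (LA A) := fun i j => gs (dgi i j) (X i j)

theorem gM_apply (X : Matrix (Ix n) (Ix n) A) (i j : Ix n) : gM X i j = gs (dgi i j) (X i j) := rfl

theorem Rm_cons {p s : Fin (2*n) × Fin (2*n)} (h : Rm n p s ≠ 0) : (p.1:ℕ) + p.2 = (s.1:ℕ) + s.2 := by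
  by_contra hc
  apply h
  unfold Rm
  have l1 := p.1.isLt; have l2 := s.1.isLt
  rw [if_neg (by rintro ⟨a, b⟩; exact hc (by rw [a, b])), if_neg (by rintro ⟨_, a, b⟩; exact hc (by rw [a, b]; omega)),
    if_neg]
  · simp
  · rintro ⟨_, a, b⟩
    rw [a, b, pr_val, pr_val] at hc
    omega

theorem RTT_gM {X Y : Matrix (Ix n) (Ix n) A} (h : RTT n X Y) : RTT n (gM X) (gM Y) := by
  intro i a j b
  have e1 : ∀ k c, Rm n (i,a) (k,c) • (gM X k j * gM Y c b) = gs (i + a - j - b : ℤ) (Rm n (i,a) (k,c) • (X k j * Y c b)) := by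
    intro k c
    by_cases h0 : Rm n (i,a) (k,c) = 0
    · rw [h0, zero_smul, zero_smul, map_zero]
    · have := Rm_cons h0
      simp only at this
      simp only [gM]
      rw [gs_mul, map_smul]
      congr 3
      simp only [dgi]; omega
  have e2 : ∀ c l, Rm n (l,c) (j,b) • (gM Y a c * gM X i l) = gs (i + a - j - b : ℤ) (Rm n (l,c) (j,b) • (Y a c * X i l)) := by
    intro c l
    by_cases h0 : Rm n (l,c) (j,b) = 0
    · rw [h0, zero_smul, zero_smul, map_zero]
    · have := Rm_cons h0
      simp only at this
      simp only [gM]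
      rw [gs_mul, map_smul]
      congr 3
      simp only [dgi]; omega
  simp only [e1, e2, ← map_sum, h i a j b]

theorem gM_mul (X Y : Matrix (Ix n) (Ix n) A) : gM X * gM Y = gM (X * Y) := by
  ext1 i j
  rw [Matrix.mul_apply]
  simp only [gM, Matrix.mul_apply, map_sum, gs_mul]
  apply Finset.sum_congr rfl
  intro k _
  have e : dgi i k + dgi k j = dgi i j := by simp only [dgi]; omega
  rw [e]

theorem gM_one : gM (1 : Matrix (Ix n) (Ix n) A) = 1 := by
  ext1 i j
  rw [gM_apply, Matrix.one_apply, Matrix.one_apply]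
  split_ifs with h
  · rw [h, dgi, sub_self, gs_one]
  · rw [map_zero]

theorem gM_cr (X : Matrix (Ix n) (Ix n) A) : cr (gM X) = gM (cr X) := by
  ext1 i j
  have hi := i.isLt; have hj := j.isLt
  simp only [cr, gM, map_smul]
  have e : dgi (pr n j) (pr n i) = dgi i j := by simp only [dgi, pr_val]; omega
  rw [e]

def Sol.gr (S : Sol n A) : Sol n (LA A) where
  T := gM S.T
  Tb := gM S.Tb
  tu := fun i j h => by rw [gM_apply, S.tu i j h, map_zero]
  bl := fun i j h => by rw [gM_apply, S.bl i j h, map_zero]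
  td := fun i => by rw [gM_apply, gM_apply, gs_mul, S.td, dgi, sub_self, add_zero, gs_one]
  dt := fun i => by rw [gM_apply, gM_apply, gs_mul, S.dt, dgi, sub_self, add_zero, gs_one]
  tt := RTT_gM S.tt
  bb := RTT_gM S.bb
  bt := RTT_gM S.bt
  c1 := by rw [gM_cr, gM_mul, S.c1, gM_one]
  c2 := by rw [gM_cr, gM_mul, S.c2, gM_one]
  c3 := by rw [gM_cr, gM_mul, S.c3, gM_one]
  c4 := by rw [gM_cr, gM_mul, S.c4, gM_one]

def gU (n : ℕ) : Usp n →ₐ[F] LA (Usp n) := (tautSol n).gr.hom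

theorem gU_t (i j : Ix n) : gU n (tU n i j) = gs (dgi i j) (tU n i j) := Sol.hom_t _ i j
theorem gU_tb (i j : Ix n) : gU n (tbU n i j) = gs (dgi i j) (tbU n i j) := Sol.hom_tb _ i j

theorem gU_Bh (i : Fin n) : gU n (Bh n i) = gs 1 (Fh n i) + gs (-1) (Eh n i) := by
  have v1 := lo_val i; have v2 := hi_val i
  rw [Bh, map_add, Fh, Eh, map_smul, map_smul, map_smul, map_smul, Fu, Eu, map_mul, map_mul, gU_t, gU_t, gU_tb, gU_tb, gs_mul, gs_mul]
  congr 3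
  · congr 1; simp only [dgi, v1, v2]; push_cast; ring
  · congr 1; simp only [dgi, v1, v2]; push_cast; ring

def cf (m : ℤ) : LA A →ₗ[F] A := (Finsupp.lapply m) ∘ₗ (AddMonoidAlgebra.coeffLinearEquiv F).toLinearMap

theorem cf_gs_mul (m k : ℤ) (x : A) (y : LA A) : cf m (gs k x * y) = x * cf (m - k) y := by
  induction y using AddMonoidAlgebra.induction_linear with
  | zero => simp
  | add f g hf hg => rw [mul_add, map_add, hf, hg, map_add, mul_add]
  | single a b =>
    change cf m (gs k x * gs (A := A) a b) = x * cf (m-k) (gs (A := A) a b)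
    rw [gs_mul]
    change (Finsupp.single (k+a) (x*b)) m = x * (Finsupp.single a b) (m-k)
    rw [Finsupp.single_apply, Finsupp.single_apply]
    by_cases h : k + a = m
    · rw [if_pos h, if_pos (by omega)]
    · rw [if_neg h, if_neg (by omega), mul_zero]

theorem cf_wd (w : List (Fin n)) : (∀ m : ℤ, (w.length:ℤ) < m → cf m (gU n (FreeAlgebra.lift F (Bh n) (wd F w))) = 0) ∧
    cf w.length (gU n (FreeAlgebra.lift F (Bh n) (wd F w))) = evF n (wd F w) := by
  induction w with
  | nil =>
    rw [wd_nil, map_one, map_one, map_one (evF n), ← gs_one]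
    constructor
    · intro m hm
      change (Finsupp.single (0:ℤ) (1:Usp n)) m = 0
      rw [Finsupp.single_apply, if_neg]
      simp at hm; omega
    · change (Finsupp.single (0:ℤ) (1:Usp n)) 0 = 1
      rw [Finsupp.single_apply, if_pos rfl]
  | cons a w ih =>
    have e : ∀ m, cf m (gU n (FreeAlgebra.lift F (Bh n) (wd F (a :: w)))) =
        Fh n a * cf (m-1) (gU n (FreeAlgebra.lift F (Bh n) (wd F w))) + Eh n a * cf (m+1) (gU n (FreeAlgebra.lift F (Bh n) (wd F w))) := by
      intro m
      rw [wd_cons, map_mul, map_mul, FreeAlgebra.lift_ι_apply, gU_Bh, add_mul, map_add, cf_gs_mul, cf_gs_mul, sub_neg_eq_add]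
    rw [List.length_cons]
    constructor
    · intro m hm
      push_cast at hm
      rw [e, ih.1 _ (by omega), ih.1 _ (by omega), mul_zero, mul_zero, add_zero]
    · push_cast
      rw [e, ih.1 ((w.length:ℤ)+1+1) (by omega), mul_zero, add_zero, add_sub_cancel_right, ih.2, wd_cons, map_mul, evF, FreeAlgebra.lift_ι_apply]

theorem cf_Hm {d : ℕ} {u : FB n} (hu : u ∈ Hm F (Fin n) d) : cf d (gU n (FreeAlgebra.lift F (Bh n) u)) = evF n u := by
  refine Hm_ind (P := fun u => cf d (gU n (FreeAlgebra.lift F (Bh n) u)) = evF n u) hu ?_ (by simp) ?_ ?_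
  · rintro w rfl; exact (cf_wd w).2
  · intro x y hx hy; simp only [map_add, hx, hy]
  · intro c x hx; simp only [map_smul, hx]

theorem cf_Fl {d : ℕ} {u : FB n} (hu : u ∈ Fl F (Fin n) d) : cf d (gU n (FreeAlgebra.lift F (Bh n) u)) = 0 := by
  refine Fl_ind (P := fun u => cf d (gU n (FreeAlgebra.lift F (Bh n) u)) = 0) hu ?_ (by simp) ?_ ?_
  · intro w hw; exact (cf_wd w).1 _ (by omega)
  · intro x y hx hy; simp only [map_add, hx, hy, add_zero]
  · intro c x hx; simp only [map_smul, hx, smul_zero]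

theorem mk_sr (i j : Fin n) : ∃ v ∈ Fl F (Fin n) (sdeg n i j), RingQuot.mkAlgHom F (iRel n) (sr q i j) = RingQuot.mkAlgHom F (iRel n) v := by
  have hq := q_ne
  unfold sr sdeg
  by_cases h1 : (i:ℕ) + 2 ≤ j
  · rw [if_pos h1, if_pos h1]
    refine ⟨0, zero_mem _, ?_⟩
    have := RingQuot.mkAlgHom_rel F (iRel.comm (n := n) i j (Or.inl h1))
    simp only [Bgen] at this
    simp only [wd_cons, wd_nil, mul_one, map_sub, this, sub_self, map_zero]
  · rw [if_neg h1, if_neg h1]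
    by_cases h2 : ((i:ℕ) + 1 = j ∨ (j:ℕ) + 1 = i) ∧ ¬ ((i:ℕ) + 2 = n ∧ (j:ℕ) + 1 = n)
    · rw [if_pos h2, if_pos h2]
      have := RingQuot.mkAlgHom_rel F (iRel.serre (n := n) i j h2.1 h2.2)
      refine ⟨qi n i • ((-(qi n i)⁻¹) • FreeAlgebra.ι F j), Submodule.smul_mem _ _ (Submodule.smul_mem _ _ (ι_Fl j (by omega))), ?_⟩
      rw [map_smul (RingQuot.mkAlgHom F (iRel n)) (qi n i)]
      simp only [Bgen] at this
      rw [← this, ← map_smul]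
      congr 1
      have hz : (if (i:ℕ) + 1 < n then q else q^2) = qi n i := rfl
      rw [hz, smul_add, smul_sub, smul_smul, mul_add, mul_inv_cancel₀ (qi_ne i), ← pow_two]
      simp only [wd_cons, wd_nil, mul_one, pow_two, mul_assoc]
    · rw [if_neg h2, if_neg h2]
      by_cases h4 : (i:ℕ) + 2 = n ∧ (j:ℕ) + 1 = n
      · rw [if_pos h4]
        have := RingQuot.mkAlgHom_rel F (iRel.quartic (n := n) i j h4.1 h4.2)
        refine ⟨q^2 • ((-(q⁻¹) * (q + q⁻¹)^2) • (FreeAlgebra.ι F i * FreeAlgebra.ι F j - FreeAlgebra.ι F j * FreeAlgebra.ι F i)),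
          Submodule.smul_mem _ _ (Submodule.smul_mem _ _ (sub_mem (Fl_mul (d := 2) (e := 2) (by omega) (ι_Fl _ le_rfl) (ι_Fl _ le_rfl)) (Fl_mul (d := 2) (e := 2) (by omega) (ι_Fl _ le_rfl) (ι_Fl _ le_rfl)))), ?_⟩
        rw [map_smul (RingQuot.mkAlgHom F (iRel n)) (q^2)]
        simp only [Bgen] at this
        rw [← this, ← map_smul]
        congr 1
        have e : q^2 * (q^2 + 1 + (q^2)⁻¹) = q^4 + q^2 + 1 := by field_simp
        rw [smul_sub, smul_add, smul_sub, smul_smul, smul_smul, e]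
        simp only [wd_cons, wd_nil, mul_one, pow_succ, pow_zero, one_mul, mul_assoc]
      · rw [if_neg h4]; exact ⟨0, zero_mem _, rfl⟩

theorem mk_Jd {d : ℕ} {u : FB n} (hu : u ∈ Jd n q d) : ∃ v ∈ Fl F (Fin n) d, RingQuot.mkAlgHom F (iRel n) u = RingQuot.mkAlgHom F (iRel n) v := by
  refine Submodule.span_induction (p := fun u _ => ∃ v ∈ Fl F (Fin n) d, RingQuot.mkAlgHom F (iRel n) u = RingQuot.mkAlgHom F (iRel n) v) ?_ ⟨0, zero_mem _, rfl⟩ ?_ ?_ hu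
  · rintro _ ⟨a, i, j, b, h, rfl⟩
    obtain ⟨v, hv, e⟩ := mk_sr i j
    refine ⟨wd F a * v * wd F b, ?_, by simp only [map_mul, e]⟩
    refine Fl_mul (d := a.length + sdeg n i j) (e := b.length + 1) (by omega) ?_ (wd_Fl (by omega))
    exact Fl_mul (d := a.length + 1) (e := sdeg n i j) (by omega) (wd_Fl (by omega)) hv
  · rintro x y _ _ ⟨v, hv, e⟩ ⟨v', hv', e'⟩
    exact ⟨v + v', add_mem hv hv', by rw [map_add, map_add, e, e']⟩
  · rintro c x _ ⟨v, hv, e⟩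
    exact ⟨c • v, Submodule.smul_mem _ _ hv, by rw [map_smul, map_smul, e]⟩

theorem inj_Fl : ∀ (d : ℕ) (u : FB n), u ∈ Fl F (Fin n) d → FreeAlgebra.lift F (Bh n) u = 0 → RingQuot.mkAlgHom F (iRel n) u = 0
  | 0, u, hu, h => by rw [Fl_zero hu, map_zero]
  | d + 1, u, hu, h => by
    obtain ⟨v, hv, w, hw, rfl⟩ := Fl_split hu
    have h1 := congrArg (fun x => cf (d:ℤ) (gU n x)) h
    simp only [map_add, map_zero] at h1
    rw [cf_Hm hv, cf_Fl hw, add_zero] at h1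
    obtain ⟨v', hv', e⟩ := mk_Jd (MT hv h1)
    have h2 : RingQuot.mkAlgHom F (iRel n) (v + w) = RingQuot.mkAlgHom F (iRel n) (v' + w) := by
      rw [map_add, map_add, e]
    rw [h2]
    apply inj_Fl d _ (add_mem hv' hw)
    rw [← phi_mk, ← h2, phi_mk, h]

theorem phi_inj : Function.Injective (phi n) := by
  rw [injective_iff_map_eq_zero]
  intro x hx
  obtain ⟨u, rfl⟩ := RingQuot.mkAlgHom_surjective F (iRel n) x
  rw [phi_mk] at hx
  obtain ⟨d, hd⟩ := exists_Fl u
  exact inj_Fl d u hd hx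
end
end

/-- there is an algebra isomorphism from the ıquantum group 𝒰^ı of type CI
    onto U_q^{′tw}(gl_n) sending B_i to (q_i − q_i⁻¹)⁻¹ s′_{i+1,i}. -/
theorem iquantum_iso (n : ℕ) (hn : 2 ≤ n) :
    ∃ φ : UiCI n →ₐ[F] Usp n,
      Function.Injective φ ∧
      φ.range = U'tw n ∧
      (∀ i : Fin n, φ (BU n i) = (qi n i - (qi n i)⁻¹)⁻¹ • s'gen n i) := by
  exact ⟨phi n, phi_inj, phi_range, phi_B⟩

end CI
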